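/- Let f, g ∈ ℂ[z₁, z₂, z₃] be irreducible homogeneous polynomials. If there exists a bi-Lipschitz homeomorphism φ : (ℂ³, V(f), 0) → (ℂ³, V(g), 0), then deg f = deg g. (This holds with no assumption on the singular loci of V(f) and V(g), which may be one-dimensional.) -/

import Mathlib

noncomputable section

/-- `ℂ³` with the Euclidean metric. -/
abbrev E3 := EuclideanSpace ℂ (Fin 3)

/-- The zero set `V(p) ⊆ ℂ³` of a polynomial `p ∈ ℂ[z₁, z₂, z₃]`. -/
def pV (p : MvPolynomial (Fin 3) ℂ) : Set E3 :=
  {x | MvPolynomial.eval (x : Fin 3 → ℂ) p = 0}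

/-- A bi-Lipschitz homeomorphism of germs `φ : (ℂ³, X, 0) → (ℂ³, Y, 0)`. -/
def BiLipGermHomeo (X Y : Set E3) : Prop :=
  ∃ (U U' : Set E3) (φ ψ : E3 → E3) (K : NNReal),
    IsOpen U ∧ IsOpen U' ∧ (0 : E3) ∈ U ∧ (0 : E3) ∈ U' ∧
    φ 0 = 0 ∧
    Set.MapsTo φ U U' ∧ Set.MapsTo ψ U' U ∧
    Set.LeftInvOn ψ φ U ∧ Set.RightInvOn ψ φ U' ∧
    LipschitzOnWith K φ U ∧ LipschitzOnWith K ψ U' ∧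
    φ '' (X ∩ U) = Y ∩ U'


section
namespace BL
open Topology Filter Set Complex

/-- logs along homotopies -/
theorem log_homotopy {A : Type*} [TopologicalSpace A] (G : unitInterval × A → ℂ) (hG : Continuous G)
    (h0 : ∀ q, G q ≠ 0) (L0 : A → ℂ) (hL0 : Continuous L0) (hL : ∀ a, exp (L0 a) = G (0, a)) :
    ∃ L : unitInterval × A → ℂ, Continuous L ∧ (∀ q, exp (L q) = G q) ∧ ∀ a, L (0, a) = L0 a := by
  have cov := Complex.isCoveringMap_exp
  let H : C(unitInterval × A, {z : ℂ // z ≠ 0}) := ⟨fun q => ⟨G q, h0 q⟩, by fun_prop⟩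
  have H0 : ∀ a, H (0, a) = ⟨exp (L0 a), Complex.exp_ne_zero _⟩ := by
    intro a; apply Subtype.ext; exact (hL a).symm
  refine ⟨cov.liftHomotopy H ⟨L0, hL0⟩ H0, ContinuousMap.continuous _, ?_, ?_⟩
  · intro q
    have := congrFun (cov.liftHomotopy_lifts H ⟨L0, hL0⟩ H0) q
    exact congrArg Subtype.val this
  · intro a
    exact cov.liftHomotopy_zero H ⟨L0, hL0⟩ H0 a

theorem log_tvs {V : Type*} [TopologicalSpace V] [AddCommGroup V] [Module ℝ V]
    [ContinuousSMul ℝ V] (g : V → ℂ) (hg : Continuous g) (h0 : ∀ v, g v ≠ 0) :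
    ∃ L : V → ℂ, Continuous L ∧ ∀ v, exp (L v) = g v := by
  obtain ⟨L, hL, h1, h2⟩ := log_homotopy (fun q : unitInterval × V => g ((q.1 : ℝ) • q.2))
    (by fun_prop) (fun _ => h0 _) (fun _ => log (g 0)) (by fun_prop)
    (fun a => by simp [exp_log (h0 0)])
  refine ⟨fun v => L (1, v), by fun_prop, fun v => ?_⟩
  rw [h1]; simp

/-- A continuous function with values in `2πiℤ` on a preconnected space is constant -/
theorem const_of_exp_one {V : Type*} [TopologicalSpace V] [PreconnectedSpace V]
    (f : V → ℂ) (hf : Continuous f) (h1 : ∀ v, exp (f v) = 1) (a b : V) : f a = f b := by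
  have := Complex.isCoveringMap_exp.eq_of_comp_eq (g₁ := f) (g₂ := fun _ => f a) hf
    continuous_const (by ext v; simp [h1]) a rfl
  exact (congrFun this b).symm

theorem log_unique {V : Type*} [TopologicalSpace V] [PreconnectedSpace V]
    (f g : V → ℂ) (hf : Continuous f) (hg : Continuous g) (h1 : ∀ v, exp (f v) = exp (g v))
    (a b : V) : f a - g a = f b - g b :=
  const_of_exp_one (fun v => f v - g v) (by fun_prop)
    (fun v => by rw [exp_sub, h1, div_self (exp_ne_zero _)]) a b

theorem circle_degree (g : ℂ → ℂ) (ε : ℝ) (hε : 0 < ε)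
    (hg : ContinuousOn g {s | ‖s‖ = ε}) (h0 : ∀ s, ‖s‖ = ε → g s ≠ 0) :
    ∃ (w : ℤ) (h : ℂ → ℂ), Continuous h ∧ ∀ s, ‖s‖ = ε → g s = s ^ w * exp (h s) := by
  have hn : ∀ α : ℝ, ‖(ε : ℂ) * exp (α * I)‖ = ε := by
    intro α; rw [norm_mul, norm_exp_ofReal_mul_I]; simp [abs_of_pos hε]
  obtain ⟨L, hL, hLe⟩ := log_tvs (V := ℝ) (fun α => g (ε * exp (α * I)))
    (hg.comp_continuous (by fun_prop) hn) (fun α => h0 _ (hn α))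
  have hper : ∀ α : ℝ, exp (L (α + 2 * Real.pi) - L α) = 1 := by
    intro α
    rw [exp_sub, hLe, hLe]
    have : exp (((α + 2 * Real.pi : ℝ) : ℂ) * I) = exp (α * I) := by
      push_cast
      rw [add_mul, Complex.exp_add, exp_two_pi_mul_I, mul_one]
    rw [this, div_self (h0 _ (hn α))]
  obtain ⟨w, hw⟩ := Complex.exp_eq_one_iff.1 (hper 0)
  have hw' : ∀ α : ℝ, L (α + 2 * Real.pi) - L α = w * (2 * Real.pi * I) := by
    intro α
    rw [← hw]
    exact const_of_exp_one (fun α : ℝ => L (α + 2 * Real.pi) - L α) (by fun_prop) hper α 0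
  let M : ℝ → ℂ := fun α => L α - I * w * α
  have hM : Continuous M := by fun_prop
  have hMp : Function.Periodic M (2 * Real.pi) := by
    intro α
    have := hw' α
    simp only [M]
    push_cast
    linear_combination this
  let Ml : Real.Angle → ℂ := hMp.lift
  have hMl : Continuous Ml := by
    have : Topology.IsQuotientMap (fun a : ℝ => (a : Real.Angle)) := QuotientAddGroup.isQuotientMap_mk _
    rw [this.continuous_iff]
    exact hM
  have hMe : ∀ α : ℝ, Ml (α : Real.Angle) = M α := fun α => hMp.lift_coe α
  have : Fact (0 < 2 * Real.pi) := ⟨by positivity⟩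
  have : CompactSpace Real.Angle := inferInstanceAs (CompactSpace (AddCircle (2 * Real.pi)))
  obtain ⟨C, hC⟩ := (isCompact_univ.image hMl).isBounded.exists_norm_le
  have hC' : ∀ a, ‖Ml a‖ ≤ C := fun a => hC _ ⟨a, trivial, rfl⟩
  refine ⟨w, fun s => (‖s‖ / ε : ℝ) * (Ml (arg s : Real.Angle) - w * Real.log ε), ?_, ?_⟩
  · rw [continuous_iff_continuousAt]
    intro s
    by_cases hs : s = 0
    · subst hs
      unfold ContinuousAt
      simp only [norm_zero, zero_div, ofReal_zero, zero_mul]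
      apply squeeze_zero_norm (a := fun s : ℂ => (‖s‖ / ε) * (C + ‖(w * Real.log ε : ℂ)‖))
      · intro s
        rw [norm_mul, Complex.norm_real, Real.norm_of_nonneg (by positivity)]
        gcongr
        exact (norm_sub_le _ _).trans (by gcongr; exact hC' _)
      · have : Continuous fun s : ℂ => (‖s‖ / ε) * (C + ‖(w * Real.log ε : ℂ)‖) := by fun_prop
        simpa using this.tendsto 0
    · have h1 := continuousAt_arg_coe_angle hs
      have h2 : ContinuousAt (fun s => Ml (arg s : Real.Angle)) s := hMl.continuousAt.comp h1
      fun_prop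
  · intro s hs
    have hs0 : s ≠ 0 := by rintro rfl; simp at hs; linarith
    have e1 : s = ε * exp (arg s * I) := by
      rw [← hs]; exact (norm_mul_exp_arg_mul_I s).symm
    have e2 : g s = exp (L (arg s)) := by rw [hLe]; rw [← e1]
    have e3 : s ^ w = exp (w * (Real.log ε + arg s * I)) := by
      rw [Complex.exp_int_mul, exp_add, ← ofReal_exp, Real.exp_log hε, ← e1]
    rw [e2, e3, ← exp_add]
    congr 1
    beta_reduce
    rw [hMe]
    simp only [M, hs]
    rw [div_self hε.ne']
    push_cast
    ring

end BL
end

section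
namespace BL
open Topology Filter Set Complex

/-- the standard primitive root of unity -/
def om (n : ℕ) : ℂ := exp (2 * Real.pi * I / n)

theorem om_ne (n : ℕ) : om n ≠ 0 := exp_ne_zero _

theorem om_pow (n : ℕ) (h : 0 < n) : om n ^ n = 1 := by
  rw [om, ← Complex.exp_nat_mul, mul_div_cancel₀ _ (by exact_mod_cast h.ne'), exp_two_pi_mul_I]

theorem om_prim (n : ℕ) (h : 0 < n) : IsPrimitiveRoot (om n) n :=
  Complex.isPrimitiveRoot_exp n h.ne'

/-- cyclic (principal) covers -/
structure Cyc {X E : Type} [TopologicalSpace X] [TopologicalSpace E] (n : ℕ) (p : E → X)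
    (τ : E → E) : Prop where
  npos : 0 < n
  t2 : T2Space E
  cp : Continuous p
  ct : Continuous τ
  pt : ∀ e, p (τ e) = p e
  trans : ∀ e e', p e = p e' → ∃ k : ℕ, τ^[k] e = e'
  per : ∀ (k : ℕ) e, τ^[k] e = e ↔ n ∣ k
  sec : ∀ x, ∃ N ∈ 𝓝 x, ∃ σ : X → E, ContinuousOn σ N ∧ ∀ y ∈ N, p (σ y) = y

/-- weight `m` is trivialised for all cyclic covers -/
def P (X : Type) [TopologicalSpace X] (m : ℕ) : Prop :=
  ∀ (n : ℕ) (E : Type) [TopologicalSpace E] (p : E → X) (τ : E → E), Cyc n p τ →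
    ∃ s : E → ℂ, Continuous s ∧ ∀ e, s e ≠ 0 ∧ s (τ e) = om n ^ m * s e

theorem P_homeo {X Y : Type} [TopologicalSpace X] [TopologicalSpace Y] (h : X ≃ₜ Y) (m : ℕ)
    (hP : P X m) : P Y m := by
  intro n E _ p τ hc
  apply hP n E (h.symm ∘ p) τ
  refine ⟨hc.npos, hc.t2, h.symm.continuous.comp hc.cp, hc.ct, fun e => by simp [hc.pt],
    fun e e' he => hc.trans e e' (h.symm.injective he), hc.per, fun x => ?_⟩
  obtain ⟨N, hN, σ, h1, h2⟩ := hc.sec (h x)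
  refine ⟨h ⁻¹' N, h.continuous.continuousAt hN, σ ∘ h,
    h1.comp h.continuous.continuousOn (fun y hy => hy), fun y hy => ?_⟩
  simp [h2 _ hy]

namespace Cyc
variable {X E : Type} [TopologicalSpace X] [TopologicalSpace E] {n : ℕ} {p : E → X} {τ : E → E}

theorem pit (h : Cyc n p τ) (k : ℕ) (e : E) : p (τ^[k] e) = p e := by
  induction k with
  | zero => rfl
  | succ k ih => rw [Function.iterate_succ_apply', h.pt, ih]

theorem itn (h : Cyc n p τ) (e : E) : τ^[n] e = e := (h.per n e).2 dvd_rfl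

theorem inj (h : Cyc n p τ) (k : ℕ) : Function.Injective τ^[k] := by
  apply Function.Injective.iterate
  intro a b hab
  have : τ^[n-1+1] a = τ^[n-1+1] b := by
    rw [Function.iterate_succ_apply, Function.iterate_succ_apply, hab]
  rwa [Nat.sub_add_cancel h.npos, h.itn, h.itn] at this

theorem uniq (h : Cyc n p τ) {k l : ℕ} (hk : k < n) (hl : l < n) {e : E}
    (hkl : τ^[k] e = τ^[l] e) : k = l := by
  wlog hle : k ≤ l generalizing k l
  · exact (this hl hk hkl.symm (le_of_not_ge hle)).symm
  obtain ⟨j, rfl⟩ := Nat.exists_eq_add_of_le hle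
  rw [Function.iterate_add_apply] at hkl
  have := (h.inj k) hkl
  have := (h.per j e).1 this.symm
  have : j = 0 := Nat.eq_zero_of_dvd_of_lt this (by omega)
  omega

theorem itmod (h : Cyc n p τ) (k : ℕ) (e : E) : τ^[k] e = τ^[k % n] e := by
  conv_lhs => rw [← Nat.mod_add_div k n, Function.iterate_add_apply]
  rw [(h.per _ e).2 (dvd_mul_right _ _)]

theorem ex_lt (h : Cyc n p τ) {e e' : E} (he : p e = p e') : ∃ k < n, τ^[k] e = e' := by
  obtain ⟨k, hk⟩ := h.trans e e' he
  exact ⟨k % n, Nat.mod_lt _ h.npos, by rw [← h.itmod, hk]⟩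

/-- index -/
theorem index (h : Cyc n p τ) {A : Type*} [TopologicalSpace A] (e₁ e₂ : A → E)
    (h₁ : Continuous e₁) (h₂ : Continuous e₂) (he : ∀ a, p (e₁ a) = p (e₂ a)) :
    ∃ k : A → Fin n, Continuous k ∧ ∀ a, τ^[k a] (e₁ a) = e₂ a := by
  have := h.t2
  choose k hk hk' using fun a => h.ex_lt (he a)
  refine ⟨fun a => ⟨k a, hk a⟩, ?_, hk'⟩
  have hcl : ∀ j : Fin n, IsClosed ((fun a => (⟨k a, hk a⟩ : Fin n)) ⁻¹' {j}) := by
    intro j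
    have : (fun a => (⟨k a, hk a⟩ : Fin n)) ⁻¹' {j} = {a | τ^[j] (e₁ a) = e₂ a} := by
      ext a
      simp only [mem_preimage, mem_singleton_iff, mem_ofPred_eq]
      constructor
      · rintro rfl; exact hk' a
      · intro hj
        exact Fin.ext (h.uniq (hk a) j.2 ((hk' a).trans hj.symm))
    rw [this]
    exact isClosed_eq ((h.ct.iterate _).comp h₁) h₂
  rw [continuous_iff_isClosed]
  intro S _
  have : (fun a => (⟨k a, hk a⟩ : Fin n)) ⁻¹' S
    = ⋃ j ∈ S, (fun a => (⟨k a, hk a⟩ : Fin n)) ⁻¹' {j} := by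
    ext a; simp
  rw [this]
  exact (Set.toFinite S).isClosed_biUnion (fun j _ => hcl j)

theorem covering (h : Cyc n p τ) : IsCoveringMap p := by
  intro x
  obtain ⟨N, hN, σ, h1, h2⟩ := h.sec x
  obtain ⟨U, hUN, hU, hx⟩ := mem_nhds_iff.1 hN
  have h1 := h1.mono hUN
  have hσc : Continuous fun e : p ⁻¹' U => σ (p e) :=
    h1.comp_continuous (by have := h.cp; fun_prop) (fun e => e.2)
  obtain ⟨k, hk, hk'⟩ := h.index (fun e : p ⁻¹' U => σ (p e)) (fun e => e.1) hσc
    continuous_subtype_val (fun e => h2 _ (hUN e.2))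
  have key : IsEvenlyCovered p x (Fin n) := by
    refine ⟨inferInstance, U, hx, hU, hU.preimage h.cp, ?_⟩
    refine ⟨⟨⟨fun e => (⟨p e, e.2⟩, k e), fun q => ⟨τ^[q.2] (σ q.1), ?_⟩, ?_, ?_⟩, ?_, ?_⟩, ?_⟩
    · simp only [mem_preimage, h.pit, h2 _ (hUN q.1.2)]; exact q.1.2
    · intro e; apply Subtype.ext; exact hk' e
    · intro q
      have e1 : p (τ^[q.2] (σ q.1)) = q.1 := by rw [h.pit, h2 _ (hUN q.1.2)]
      apply Prod.ext
      · exact Subtype.ext e1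
      · apply Fin.ext
        have := hk' ⟨τ^[q.2] (σ q.1), by simp only [mem_preimage, e1]; exact q.1.2⟩
        simp only [e1] at this
        exact h.uniq (Fin.is_lt _) (Fin.is_lt _) this
    · have := h.cp
      fun_prop
    · apply Continuous.subtype_mk
      rw [continuous_iff_continuousAt]
      rintro ⟨u, j⟩
      have hc : Continuous fun q : U × Fin n => τ^[j] (σ q.1) :=
        (h.ct.iterate _).comp (h1.comp_continuous (by fun_prop) (fun q => q.1.2))
      apply hc.continuousAt.congr
      have : ∀ᶠ q : U × Fin n in 𝓝 (u, j), q.2 = j :=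
        continuous_snd.continuousAt ((isOpen_discrete {j}).mem_nhds (mem_singleton j))
      filter_upwards [this] with q hq
      rw [← hq]
    · intro e; rfl
  exact key.to_isEvenlyCovered_preimage

/-- pullback -/
theorem pullback (h : Cyc n p τ) {A : Type} [TopologicalSpace A] [T2Space A] (j : A → X)
    (hj : Continuous j) :
    Cyc n (fun q : {q : A × E // j q.1 = p q.2} => q.1.1)
      (fun q => ⟨(q.1.1, τ q.1.2), by rw [h.pt]; exact q.2⟩) := by
  have hE := h.t2
  have hit : ∀ (k : ℕ) (q : {q : A × E // j q.1 = p q.2}),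
      ((fun q : {q : A × E // j q.1 = p q.2} =>
        (⟨(q.1.1, τ q.1.2), by rw [h.pt]; exact q.2⟩ : {q : A × E // j q.1 = p q.2}))^[k] q).1
        = (q.1.1, τ^[k] q.1.2) := by
    intro k q
    induction k with
    | zero => rfl
    | succ k ih =>
      rw [Function.iterate_succ_apply', Function.iterate_succ_apply']
      dsimp only
      rw [ih]
  refine ⟨h.npos, inferInstance, by fun_prop, ?_, fun _ => rfl, ?_, ?_, ?_⟩
  · have := h.ct; fun_prop
  · rintro ⟨⟨a, e⟩, he⟩ ⟨⟨b, e'⟩, he'⟩ hab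
    dsimp only at *
    subst hab
    obtain ⟨k, hk⟩ := h.trans e e' (he.symm.trans he')
    refine ⟨k, Subtype.ext ?_⟩
    rw [hit, hk]
  · intro k q
    rw [Subtype.ext_iff, hit, Prod.ext_iff]
    simp only [true_and]
    exact h.per k _
  · intro a
    obtain ⟨N, hN, σ, h1, h2⟩ := h.sec (j a)
    have hN' : j ⁻¹' N ∈ 𝓝 a := hj.continuousAt hN
    have ha : j a = p (σ (j a)) := (h2 _ (mem_of_mem_nhds hN)).symm
    classical
    refine ⟨j ⁻¹' N, hN', fun b => if hb : j b ∈ N then ⟨(b, σ (j b)), (h2 _ hb).symm⟩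
      else ⟨(a, σ (j a)), ha⟩, ?_, ?_⟩
    · rw [continuousOn_iff_continuous_domRestrict]
      have : (j ⁻¹' N).domRestrict (fun b => if hb : j b ∈ N then
          (⟨(b, σ (j b)), (h2 _ hb).symm⟩ : {q : A × E // j q.1 = p q.2})
          else ⟨(a, σ (j a)), ha⟩) = fun b => ⟨(b.1, σ (j b.1)), (h2 _ b.2).symm⟩ := by
        ext1 b
        have : j b.1 ∈ N := b.2
        simp [this]
      rw [this]
      have : Continuous fun b : j ⁻¹' N => σ (j b.1) :=
        h1.comp_continuous (by fun_prop) (fun b => b.2)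
      exact Continuous.subtype_mk (continuous_subtype_val.prodMk this) _
    · intro b hb
      have : j b ∈ N := hb
      simp [this]

end Cyc

/-- equivariant nonvanishing function of weight `m` over `N` -/
structure Frame {X E : Type} [TopologicalSpace X] [TopologicalSpace E] (n : ℕ) (p : E → X)
    (τ : E → E) (N : Set X) (m : ℕ) (s : E → ℂ) : Prop where
  cont : ContinuousOn s (p ⁻¹' N)
  ne : ∀ e, p e ∈ N → s e ≠ 0
  eqv : ∀ e, p e ∈ N → s (τ e) = om n ^ m * s e

variable {X E : Type} [TopologicalSpace X] [TopologicalSpace E] {n : ℕ} {p : E → X} {τ : E → E}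

theorem Frame.mono {N N' : Set X} {m : ℕ} {s : E → ℂ} (h : Frame n p τ N m s) (hN : N' ⊆ N) :
    Frame n p τ N' m s :=
  ⟨h.cont.mono (preimage_mono hN), fun e he => h.ne e (hN he), fun e he => h.eqv e (hN he)⟩

theorem Frame.it (hc : Cyc n p τ) {N : Set X} {m : ℕ} {s : E → ℂ} (h : Frame n p τ N m s)
    (k : ℕ) (e : E) (he : p e ∈ N) : s (τ^[k] e) = (om n ^ m) ^ k * s e := by
  induction k with
  | zero => simp
  | succ k ih =>
    rw [Function.iterate_succ_apply', h.eqv _ (by rwa [hc.pit]), ih]; ring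

/-- a section gives a frame -/
theorem frame_of_section (hc : Cyc n p τ) (N : Set X) (σ : X → E) (hσ : ContinuousOn σ N)
    (hp : ∀ y ∈ N, p (σ y) = y) : ∃ s, Frame n p τ N 1 s := by
  have hσc : Continuous fun e : p ⁻¹' N => σ (p e) :=
    hσ.comp_continuous (by have := hc.cp; fun_prop) (fun e => e.2)
  obtain ⟨k, hk, hk'⟩ := hc.index (fun e : p ⁻¹' N => σ (p e)) (fun e => e.1) hσc
    continuous_subtype_val (fun e => hp _ e.2)
  classical
  refine ⟨fun e => if he : e ∈ p ⁻¹' N then om n ^ (k ⟨e, he⟩ : ℕ) else 0, ?_, ?_, ?_⟩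
  · rw [continuousOn_iff_continuous_domRestrict]
    have : (p ⁻¹' N).domRestrict (fun e => if he : e ∈ p ⁻¹' N then om n ^ (k ⟨e, he⟩ : ℕ) else 0)
        = fun e => (fun j : Fin n => om n ^ (j : ℕ)) (k e) := by
      ext1 e
      have := e.2
      simp only [domRestrict_apply, this, dif_pos]
    rw [this]
    exact (continuous_of_discreteTopology (f := fun j : Fin n => om n ^ (j : ℕ))).comp hk
  · intro e he
    have : e ∈ p ⁻¹' N := he
    simp only [this, dif_pos]
    exact pow_ne_zero _ (om_ne n)
  · intro e he
    have h1 : e ∈ p ⁻¹' N := he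
    have h2 : τ e ∈ p ⁻¹' N := by simpa [hc.pt] using he
    simp only [h1, h2, dif_pos]
    have a1 := hk' ⟨e, h1⟩
    have a2 := hk' ⟨τ e, h2⟩
    dsimp only at a1 a2
    rw [hc.pt] at a2
    have : τ^[(k ⟨e, h1⟩ + 1) % n] (σ (p e)) = τ e := by
      rw [← hc.itmod, Function.iterate_succ_apply', a1]
    have h3 := hc.uniq (Fin.is_lt _) (Nat.mod_lt _ hc.npos) (a2.trans this.symm)
    rw [h3, pow_one, ← pow_succ', ← pow_mod_orderOf, (om_prim n hc.npos).eq_orderOf.symm,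
      Nat.mod_mod, eq_comm, ← pow_mod_orderOf, (om_prim n hc.npos).eq_orderOf.symm]

end BL
end

section
namespace BL
open Topology Filter Set Complex

/-- a `ℂ*`-action written through the exponential -/
structure Act {X : Type} [TopologicalSpace X] (act : ℂ → X → X) : Prop where
  cont : Continuous fun q : ℂ × X => act q.1 q.2
  zero : ∀ x, act 0 x = x
  add : ∀ ζ ζ' x, act (ζ + ζ') x = act ζ (act ζ' x)
  per : ∀ x, act (2 * Real.pi * I) x = x

/-- lifted flow -/
structure Flow {X E : Type} [TopologicalSpace X] [TopologicalSpace E] (n : ℕ) (p : E → X)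
    (τ : E → E) (act : ℂ → X → X) (Φ : ℂ → E → E) (a : E → ℕ) : Prop where
  cont : Continuous fun q : ℂ × E => Φ q.1 q.2
  lift : ∀ ζ e, p (Φ ζ e) = act ζ (p e)
  zero : ∀ e, Φ 0 e = e
  add : ∀ ζ ζ' e, Φ (ζ + ζ') e = Φ ζ (Φ ζ' e)
  comm : ∀ ζ e, Φ ζ (τ e) = τ (Φ ζ e)
  hol : ∀ e, Φ (2 * Real.pi * I) e = τ^[a e] e
  ac : Continuous a
  at' : ∀ e, a (τ e) = a e
  aΦ : ∀ ζ e, a (Φ ζ e) = a e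

variable {X E : Type} [TopologicalSpace X] [TopologicalSpace E] {n : ℕ} {p : E → X} {τ : E → E}
  {act : ℂ → X → X}

theorem exists_flow (hc : Cyc n p τ) (ha : Act act) : ∃ Φ a, Flow n p τ act Φ a := by
  have hE := hc.t2
  have cov := hc.covering
  let H : C(unitInterval × (ℂ × E), X) := ⟨fun q => act (((q.1 : ℝ) : ℂ) * q.2.1) (p q.2.2), by
    have h1 := ha.cont
    have h2 := hc.cp
    exact h1.comp (f := fun q : unitInterval × (ℂ × E) => (((q.1 : ℝ) : ℂ) * q.2.1, p q.2.2))
      (by fun_prop)⟩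
  have H0 : ∀ q : ℂ × E, H (0, q) = p q.2 := by
    intro q; simp [H, ha.zero]
  let G := cov.liftHomotopy H ⟨fun q : ℂ × E => q.2, by fun_prop⟩ H0
  have hG : ∀ r (ζ : ℂ) e, p (G (r, (ζ, e))) = act (((r : ℝ) : ℂ) * ζ) (p e) := fun r ζ e =>
    congrFun (cov.liftHomotopy_lifts H ⟨fun q : ℂ × E => q.2, by fun_prop⟩ H0) (r, (ζ, e))
  let Φ : ℂ → E → E := fun ζ e => G (1, (ζ, e))
  have hcont : Continuous fun q : ℂ × E => Φ q.1 q.2 := by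
    exact G.continuous.comp (by fun_prop)
  have hlift : ∀ ζ e, p (Φ ζ e) = act ζ (p e) := by
    intro ζ e
    have := hG 1 ζ e
    simpa using this
  have hzero : ∀ e, Φ 0 e = e := by
    intro e
    have h1 := cov.eq_of_comp_eq (A := unitInterval) (g₁ := fun r => G (r, ((0 : ℂ), e)))
      (g₂ := fun _ => e) (G.continuous.comp (by fun_prop)) continuous_const (by
        ext r
        have := hG r 0 e
        simpa [ha.zero] using this) 0
      (cov.liftHomotopy_zero H ⟨fun q : ℂ × E => q.2, by fun_prop⟩ H0 ((0 : ℂ), e))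
    exact congrFun h1 1
  have hadd : ∀ ζ ζ' e, Φ (ζ + ζ') e = Φ ζ (Φ ζ' e) := by
    intro ζ ζ' e
    have h1 := cov.eq_of_comp_eq (A := ℂ) (g₁ := fun ζ => Φ (ζ + ζ') e)
      (g₂ := fun ζ => Φ ζ (Φ ζ' e)) (hcont.comp (f := fun ζ : ℂ => (ζ + ζ', e)) (by fun_prop))
      (hcont.comp (f := fun ζ : ℂ => (ζ, Φ ζ' e)) (by fun_prop)) (by
        ext ζ; simp [hlift, ha.add]) 0 (by simp [hzero])
    exact congrFun h1 ζ
  have hcomm : ∀ ζ e, Φ ζ (τ e) = τ (Φ ζ e) := by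
    intro ζ e
    have h1 := cov.eq_of_comp_eq (A := ℂ) (g₁ := fun ζ => Φ ζ (τ e))
      (g₂ := fun ζ => τ (Φ ζ e)) (hcont.comp (f := fun ζ : ℂ => (ζ, τ e)) (by fun_prop))
      (hc.ct.comp (hcont.comp (f := fun ζ : ℂ => (ζ, e)) (by fun_prop))) (by
        ext ζ; simp [hlift, hc.pt]) 0 (by simp [hzero])
    exact congrFun h1 ζ
  have hcommk : ∀ (k : ℕ) ζ e, Φ ζ (τ^[k] e) = τ^[k] (Φ ζ e) := by
    intro k ζ e
    induction k with
    | zero => rfl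
    | succ k ih => rw [Function.iterate_succ_apply', hcomm, ih, ← Function.iterate_succ_apply' τ]
  obtain ⟨k, hk, hk'⟩ := hc.index (fun e : E => e) (fun e => Φ (2 * Real.pi * I) e) continuous_id
    (hcont.comp (f := fun e : E => ((2 * Real.pi * I : ℂ), e)) (by fun_prop))
    (fun e => by rw [hlift, ha.per])
  refine ⟨Φ, fun e => k e, hcont, hlift, hzero, hadd, hcomm, fun e => (hk' e).symm,
    continuous_of_discreteTopology.comp hk, fun e => ?_, fun ζ e => ?_⟩
  · apply hc.uniq (Fin.is_lt _) (Fin.is_lt _) (e := τ e)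
    rw [hk', hcomm, ← hk', ← Function.iterate_succ_apply' τ, Function.iterate_succ_apply]
  · apply hc.uniq (Fin.is_lt _) (Fin.is_lt _) (e := Φ ζ e)
    rw [hk', ← hadd, add_comm, hadd, ← hk' e, hcommk]

theorem Flow.commk {Φ : ℂ → E → E} {a : E → ℕ} (hF : Flow n p τ act Φ a) (k : ℕ) (ζ : ℂ) (e : E) :
    Φ ζ (τ^[k] e) = τ^[k] (Φ ζ e) := by
  induction k with
  | zero => rfl
  | succ k ih => rw [Function.iterate_succ_apply', hF.comm, ih, ← Function.iterate_succ_apply' τ]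

theorem flow_extend (hc : Cyc n p τ) {Φ : ℂ → E → E} {a : E → ℕ}
    (hF : Flow n p τ act Φ a) (lam : X → ℂ) (hl : Continuous lam)
    (hlam : ∀ ζ x, lam (act ζ x) = exp ζ * lam x) (N : Set X)
    (hN : ∀ ζ, ∀ x ∈ N, act ζ x ∈ N) (hN0 : ∀ x ∈ N, lam x ≠ 0)
    (s0 : E → ℂ) (hs : Frame n p τ (N ∩ {x | lam x = 1}) 1 s0) :
    ∃ s, Frame n p τ N 1 s ∧ ∀ ζ e, p e ∈ N → s (Φ ζ e) = exp (a e * ζ / n) * s e := by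
  have hn0 : (n : ℂ) ≠ 0 := by exact_mod_cast hc.npos.ne'
  have memN : ∀ (ℓ : ℂ) (e : E), p e ∈ N → exp ℓ = lam (p e) →
      p (Φ (-ℓ) e) ∈ N ∩ {x | lam x = 1} := by
    intro ℓ e he hℓ
    rw [hF.lift]
    refine ⟨hN _ _ he, ?_⟩
    simp only [mem_ofPred_eq]
    rw [hlam, ← hℓ, ← exp_add]; simp
  let S : ℂ → E → ℂ := fun ℓ e => s0 (Φ (-ℓ) e) * exp (a e * ℓ / n)
  have shift1 : ∀ (ℓ : ℂ) (e : E), p e ∈ N → exp ℓ = lam (p e) →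
      S (ℓ + 2 * Real.pi * I) e = S ℓ e := by
    intro ℓ e he hℓ
    simp only [S]
    have h2 := memN ℓ e he hℓ
    have h3 := memN (ℓ + 2 * Real.pi * I) e he (by rw [exp_add, exp_two_pi_mul_I, mul_one, hℓ])
    have e1 : Φ (-ℓ) e = τ^[a e] (Φ (-(ℓ + 2 * Real.pi * I)) e) := by
      have : -ℓ = 2 * Real.pi * I + -(ℓ + 2 * Real.pi * I) := by ring
      rw [this, hF.add, hF.hol, hF.aΦ]
    rw [e1, hs.it hc _ _ h3]
    have e2 : exp (a e * (ℓ + 2 * Real.pi * I) / n) = om n ^ (a e) * exp (a e * ℓ / n) := by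
      rw [om, ← Complex.exp_nat_mul, ← exp_add]
      congr 1; field_simp; ring
    rw [e2]; ring
  have shiftn : ∀ (k : ℕ) (ℓ : ℂ) (e : E), p e ∈ N → exp ℓ = lam (p e) →
      S (ℓ + k * (2 * Real.pi * I)) e = S ℓ e := by
    intro k ℓ e he hℓ
    induction k with
    | zero => simp
    | succ k ih =>
      rw [← ih, ← shift1 (ℓ + k * (2 * Real.pi * I)) e he]
      · congr 1; push_cast; ring
      · rw [exp_add, hℓ, exp_nat_mul_two_pi_mul_I, mul_one]
  have indep : ∀ (ℓ ℓ' : ℂ) (e : E), p e ∈ N → exp ℓ = lam (p e) → exp ℓ' = lam (p e) →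
      S ℓ e = S ℓ' e := by
    intro ℓ ℓ' e he h1 h2
    obtain ⟨k, hk⟩ := Complex.exp_eq_exp_iff_exists_int.1 (h1.trans h2.symm)
    obtain ⟨k, rfl | rfl⟩ := Int.eq_nat_or_neg k
    · rw [hk]; push_cast; exact shiftn k ℓ' e he h2
    · have : ℓ' = ℓ + k * (2 * Real.pi * I) := by rw [hk]; push_cast; ring
      rw [this]; exact (shiftn k ℓ e he h1).symm
  refine ⟨fun e => S (log (lam (p e))) e, ⟨?_, ?_, ?_⟩, ?_⟩
  · intro e he
    have he' : p e ∈ N := he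
    have hl0 := hN0 _ he'
    -- local log
    let ℓ : E → ℂ := fun e' => log (lam (p e') / lam (p e)) + log (lam (p e))
    have hℓ : ∀ e', p e' ∈ N → exp (ℓ e') = lam (p e') := by
      intro e' h'
      simp only [ℓ]
      rw [exp_add, exp_log (div_ne_zero (hN0 _ h') hl0), exp_log hl0, div_mul_cancel₀ _ hl0]
    have hℓc : ContinuousAt ℓ e := by
      have h1 := hc.cp
      have h2 : ContinuousAt (fun e' => log (lam (p e') / lam (p e))) e := by
        apply ContinuousAt.clog
        · have : Continuous fun e' => lam (p e') / lam (p e) := by fun_prop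
          exact this.continuousAt
        · rw [div_self hl0]; exact one_mem_slitPlane
      exact h2.add continuousAt_const
    have hS : ContinuousWithinAt (fun e' => S (ℓ e') e') (p ⁻¹' N) e := by
      simp only [S]
      apply ContinuousWithinAt.mul
      · have hh : ContinuousWithinAt (fun e' => Φ (-(ℓ e')) e') (p ⁻¹' N) e := by
          have : ContinuousAt (fun e' => Φ (-(ℓ e')) e') e :=
            hF.cont.continuousAt.comp (f := fun e' => (-(ℓ e'), e')) (hℓc.neg.prodMk continuousAt_id)
          exact this.continuousWithinAt
        refine ContinuousWithinAt.comp (t := p ⁻¹' (N ∩ {x | lam x = 1}))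
          (hs.cont _ (memN _ _ he' (hℓ e he'))) hh ?_
        intro e' h'
        exact memN _ _ h' (hℓ e' h')
      · have hac : ContinuousAt (fun e => (a e : ℂ)) e :=
          ((continuous_of_discreteTopology (f := fun j : ℕ => (j : ℂ))).comp hF.ac).continuousAt
        have : ContinuousAt (fun e' => exp ((a e' : ℂ) * ℓ e' / n)) e :=
          ((hac.mul hℓc).div_const _).cexp
        exact this.continuousWithinAt
    apply hS.congr
    · intro e' h'
      exact indep _ _ _ h' (exp_log (hN0 _ h')) (hℓ _ h')
    · exact indep _ _ _ he' (exp_log hl0) (hℓ _ he')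
  · intro e he
    exact mul_ne_zero (hs.ne _ (memN _ _ he (exp_log (hN0 _ he)))) (exp_ne_zero _)
  · intro e he
    simp only [S, hc.pt, hF.comm, hF.at']
    rw [hs.eqv _ (memN _ _ he (exp_log (hN0 _ he)))]
    ring
  · intro ζ e he
    have h1 : exp (log (lam (p e)) + ζ) = lam (p (Φ ζ e)) := by
      rw [hF.lift, hlam, exp_add, exp_log (hN0 _ he), mul_comm]
    have hm : p (Φ ζ e) ∈ N := by rw [hF.lift]; exact hN _ _ he
    beta_reduce
    rw [indep _ _ _ hm (exp_log (hN0 _ hm)) h1]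
    simp only [S, hF.aΦ]
    rw [← hF.add]
    have : -(log (lam (p e)) + ζ) + ζ = - log (lam (p e)) := by ring
    rw [this]
    have : exp (a e * (log (lam (p e)) + ζ) / n) = exp (a e * ζ / n) * exp (a e * log (lam (p e)) / n) := by
      rw [← exp_add]; congr 1; ring
    rw [this]; ring

end BL
end

section
namespace BL
open Topology Filter Set Complex

theorem frame_ratio {X E : Type} [TopologicalSpace X] [TopologicalSpace E] {n : ℕ} {p : E → X}
    {τ : E → E} (hc : Cyc n p τ) {N : Set X} {m : ℕ} {s1 s2 : E → ℂ}
    (h1 : Frame n p τ N m s1) (h2 : Frame n p τ N m s2) :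
    ∃ g : X → ℂ, ContinuousOn g N ∧ (∀ x ∈ N, g x ≠ 0) ∧
      ∀ e, p e ∈ N → s1 e = g (p e) * s2 e := by
  have hex : ∀ x, ∃ e, p e = x := fun x => by
    obtain ⟨N, hN, σ, -, h⟩ := hc.sec x
    exact ⟨σ x, h x (mem_of_mem_nhds hN)⟩
  choose ε hε using hex
  have key : ∀ e, p e ∈ N → s1 e / s2 e = s1 (ε (p e)) / s2 (ε (p e)) := by
    intro e he
    obtain ⟨k, hk⟩ := hc.trans (ε (p e)) e (hε _)
    rw [← hk, hc.pit, hε, h1.it hc _ _ (by rwa [hε]), h2.it hc _ _ (by rwa [hε])]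
    rw [mul_div_mul_left]
    exact pow_ne_zero _ (pow_ne_zero _ (om_ne n))
  refine ⟨fun x => s1 (ε x) / s2 (ε x), ?_, ?_, ?_⟩
  · intro x hx
    obtain ⟨V, hV, σ, hσ, hp⟩ := hc.sec x
    have hcont : ContinuousWithinAt (fun y => s1 (σ y) / s2 (σ y)) (N ∩ V) x := by
      have hσ' : ContinuousWithinAt σ (N ∩ V) x :=
        (hσ x (mem_of_mem_nhds hV)).mono inter_subset_right
      have hm : MapsTo σ (N ∩ V) (p ⁻¹' N) := fun y hy => by
        simp only [mem_preimage, hp y hy.2]; exact hy.1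
      have hx' : x ∈ N ∩ V := ⟨hx, mem_of_mem_nhds hV⟩
      apply ContinuousWithinAt.div
      · exact (h1.cont _ (hm hx')).comp hσ' hm
      · exact (h2.cont _ (hm hx')).comp hσ' hm
      · exact h2.ne _ (hm hx')
    have h3 : ContinuousWithinAt (fun x => s1 (ε x) / s2 (ε x)) (N ∩ V) x := by
      apply hcont.congr
      · intro y hy
        have := key (σ y) (by rw [hp y hy.2]; exact hy.1)
        rw [hp y hy.2] at this
        exact this.symm
      · have := key (σ x) (by rw [hp x (mem_of_mem_nhds hV)]; exact hx)
        rw [hp x (mem_of_mem_nhds hV)] at this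
        exact this.symm
    exact (continuousWithinAt_inter hV).1 h3
  · intro x hx
    exact div_ne_zero (h1.ne _ (by rwa [hε])) (h2.ne _ (by rwa [hε]))
  · intro e he
    beta_reduce
    rw [← key e he, div_mul_cancel₀ _ (h2.ne _ he)]

section sweep
variable {Y : Type} [TopologicalSpace Y] [T2Space Y] [NormalSpace Y] {π : Y → ℂ}

theorem log_over_convex (hπ : Continuous π) (hfin : ∀ t, (π ⁻¹' {t}).Finite) (K : Set ℂ)
    (hK : Convex ℝ K) (hKc : IsClosed K) (hcov : IsCoveringMapOn π K) (g : Y → ℂ)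
    (hg : ContinuousOn g (π ⁻¹' K)) (hg0 : ∀ y, π y ∈ K → g y ≠ 0) :
    ∃ h : Y → ℂ, Continuous h ∧ ∀ y, π y ∈ K → exp (h y) = g y := by
  rcases K.eq_empty_or_nonempty with rfl | ⟨c, hcK⟩
  · exact ⟨fun _ => 0, continuous_const, fun y hy => hy.elim⟩
  have cov := hcov.isCoveringMap_restrictPreimage
  let Z := π ⁻¹' K
  let H : C(unitInterval × Z, K) := ⟨fun q => ⟨(1 - (q.1 : ℝ)) • π q.2 + (q.1 : ℝ) • c,
    hK q.2.2 hcK (by have := q.1.2.2; linarith) q.1.2.1 (by ring)⟩, by fun_prop⟩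
  have H0 : ∀ y : Z, H (0, y) = K.restrictPreimage π y := by
    intro y; apply Subtype.ext; simp [H]
  let G : C(unitInterval × Z, Z) := cov.liftHomotopy H ⟨fun y => y, by fun_prop⟩ H0
  have hG0 : ∀ y : Z, G (0, y) = y := fun y =>
    cov.liftHomotopy_zero H ⟨fun y => y, by fun_prop⟩ H0 y
  have hG1 : ∀ y : Z, π (G (1, y)) = c := by
    intro y
    have := congrFun (cov.liftHomotopy_lifts H ⟨fun y => y, by fun_prop⟩ H0) (1, y)
    have := congrArg Subtype.val this
    have e : (H (1, y)).1 = c := by simp [H]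
    rw [← e]; exact this
  have hgZ : Continuous fun y : Z => g y := by
    have := continuousOn_iff_continuous_domRestrict.1 hg
    exact this
  have hL0 : Continuous fun y : Z => log (g (G (1, y))) := by
    have := (hfin c).to_subtype
    have h1 : Continuous fun y : Z => (⟨G (1, y), hG1 y⟩ : π ⁻¹' {c}) :=
      Continuous.subtype_mk (continuous_subtype_val.comp (G.continuous.comp (by fun_prop))) _
    exact (continuous_of_discreteTopology (f := fun y : π ⁻¹' {c} => log (g y))).comp h1
  obtain ⟨L, hL, hLe, -⟩ := log_homotopy (fun q : unitInterval × Z => g (G (unitInterval.symm q.1, q.2)))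
    (hgZ.comp (G.continuous.comp (by fun_prop))) (fun q => hg0 _ (G _).2)
    (fun y => log (g (G (1, y)))) hL0 (fun y => by
      rw [exp_log (hg0 _ (G _).2)]; simp)
  obtain ⟨h, hh⟩ := ContinuousMap.exists_restrict_eq (hKc.preimage hπ)
    (⟨fun y => L (1, y), by fun_prop⟩ : C(Z, ℂ))
  refine ⟨h, h.continuous, fun y hy => ?_⟩
  have := DFunLike.congr_fun hh ⟨y, hy⟩
  simp only [ContinuousMap.restrict_apply, ContinuousMap.coe_mk] at this
  rw [this, hLe]
  simp [hG0]

variable {F : Type} [TopologicalSpace F] {n : ℕ} {q : F → Y} {τ : F → F}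

theorem good_local (hc : Cyc n q τ) (hfin : ∀ t, (π ⁻¹' {t}).Finite)
    (hcl : IsClosedMap π) (t : ℂ) : ∃ O ∈ 𝓝 t, ∃ σ : Y → F, ContinuousOn σ (π ⁻¹' O) ∧
      ∀ y ∈ π ⁻¹' O, q (σ y) = y := by
  classical
  choose N hN σ hσ hq using hc.sec
  obtain ⟨U, hU, hdis⟩ := (hfin t).t2_separation
  have hN' : ∀ y, ∃ V ⊆ N y ∩ U y, IsOpen V ∧ y ∈ V := fun y => by
    have := mem_nhds_iff.1 (inter_mem (hN y) ((hU y).2.mem_nhds (hU y).1))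
    obtain ⟨V, h1, h2, h3⟩ := this
    exact ⟨V, h1, h2, h3⟩
  choose V hVN hVo hyV using hN'
  have hev := hcl.eventually_nhds_fiber (p := fun y => ∃ y₀, π y₀ = t ∧ y ∈ V y₀) t (by
    intro y₀ hy₀
    filter_upwards [(hVo y₀).mem_nhds (hyV y₀)] with y hy
    exact ⟨y₀, hy₀, hy⟩)
  refine ⟨_, hev, fun y => if h : ∃ y₀, π y₀ = t ∧ y ∈ V y₀ then σ h.choose y else σ y y, ?_, ?_⟩
  · intro y hy
    obtain ⟨y₀, hy₀, hyV₀⟩ := hy y rfl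
    have : ContinuousAt (σ y₀) y :=
      ((hσ y₀).mono ((hVN y₀).trans inter_subset_left)).continuousAt ((hVo y₀).mem_nhds hyV₀)
    apply ContinuousAt.continuousWithinAt
    apply this.congr
    filter_upwards [(hVo y₀).mem_nhds hyV₀] with y' hy'
    have hex : ∃ y₀, π y₀ = t ∧ y' ∈ V y₀ := ⟨y₀, hy₀, hy'⟩
    rw [dif_pos hex]
    have : hex.choose = y₀ := by
      by_contra hne
      have := hdis hex.choose_spec.1 hy₀ hne
      exact (Set.disjoint_left.1 this) (hVN _ hex.choose_spec.2).2 (hVN _ hy').2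
    rw [this]
  · intro y hy
    have hex := hy y rfl
    beta_reduce
    rw [dif_pos hex]
    exact hq _ _ (hVN _ hex.choose_spec.2).1

def Good (n : ℕ) (q : F → Y) (τ : F → F) (π : Y → ℂ) (A : Set ℂ) : Prop :=
  ∃ s, Frame n q τ (π ⁻¹' A) 1 s

theorem Good.mono {A A' : Set ℂ} (h : Good n q τ π A) (hA : A' ⊆ A) : Good n q τ π A' := by
  obtain ⟨s, hs⟩ := h
  exact ⟨s, hs.mono (preimage_mono hA)⟩

theorem good_union (hc : Cyc n q τ) (hπ : Continuous π) (hfin : ∀ t, (π ⁻¹' {t}).Finite)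
    (A₁ A₂ : Set ℂ) (h₁ : IsClosed A₁) (h₂ : IsClosed A₂) (hK : Convex ℝ (A₁ ∩ A₂))
    (hcov : IsCoveringMapOn π (A₁ ∩ A₂)) (g₁ : Good n q τ π A₁) (g₂ : Good n q τ π A₂) :
    Good n q τ π (A₁ ∪ A₂) := by
  classical
  obtain ⟨s₁, hs₁⟩ := g₁
  obtain ⟨s₂, hs₂⟩ := g₂
  obtain ⟨g, hg, hg0, hgs⟩ := frame_ratio hc (hs₁.mono (N' := π ⁻¹' (A₁ ∩ A₂)) (fun y hy => hy.1))
    (hs₂.mono (fun y hy => hy.2))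
  obtain ⟨h, hh, hhe⟩ := log_over_convex hπ hfin _ hK (h₁.inter h₂) hcov g hg (fun y hy => hg0 y hy)
  let s : F → ℂ := fun e => if π (q e) ∈ A₁ then s₁ e else s₂ e * exp (h (q e))
  have e1 : ∀ e, π (q e) ∈ A₁ → s e = s₁ e := fun e he => if_pos he
  have e2 : ∀ e, π (q e) ∈ A₂ → s e = s₂ e * exp (h (q e)) := by
    intro e he
    by_cases h1 : π (q e) ∈ A₁
    · rw [e1 e h1, hgs e ⟨h1, he⟩, hhe _ ⟨h1, he⟩, mul_comm]
    · exact if_neg h1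
  have hqc := hc.cp
  refine ⟨s, ?_, ?_, ?_⟩
  · have : q ⁻¹' (π ⁻¹' (A₁ ∪ A₂)) = q ⁻¹' (π ⁻¹' A₁) ∪ q ⁻¹' (π ⁻¹' A₂) := by
      simp [preimage_union]
    rw [this]
    apply ContinuousOn.union_of_isClosed
    · exact hs₁.cont.congr (fun e he => e1 e he)
    · have : ContinuousOn (fun e => s₂ e * exp (h (q e))) (q ⁻¹' (π ⁻¹' A₂)) :=
        hs₂.cont.mul (by fun_prop)
      exact this.congr (fun e he => e2 e he)
    · exact (h₁.preimage hπ).preimage hqc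
    · exact (h₂.preimage hπ).preimage hqc
  · intro e he
    rcases he with he | he
    · rw [e1 e he]; exact hs₁.ne e he
    · rw [e2 e he]; exact mul_ne_zero (hs₂.ne e he) (exp_ne_zero _)
  · intro e he
    rcases he with he | he
    · rw [e1 e he, e1 _ (by rwa [hc.pt])]; exact hs₁.eqv e he
    · rw [e2 e he, e2 _ (by rwa [hc.pt]), hs₂.eqv e he, hc.pt]; ring

theorem one_dim (Q : ℝ → ℝ → Prop) (S : Set ℝ) (hS : S.Finite)
    (mono : ∀ a b a' b', a ≤ a' → b' ≤ b → Q a b → Q a' b')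
    (emp : ∀ a b, b < a → Q a b)
    (cat : ∀ a b c, a ≤ b → b ≤ c → b ∉ S → Q a b → Q b c → Q a c)
    (loc : ∀ x, ∃ ε > 0, Q (x - ε) (x + ε)) (a b : ℝ) : Q a b := by
  have hcat : ∀ a b c, b ∉ S → b ≤ c → Q a b → Q b c → Q a c := by
    intro a b c hb hbc h1 h2
    by_cases hab : a ≤ b
    · exact cat a b c hab hbc hb h1 h2
    · exact mono b c a c (le_of_not_ge hab) le_rfl h2
  have hloc : ∀ x, ∃ ε > 0, ∀ x' ∈ Ioo (x - ε) (x + ε), ∀ x'' ∈ Ioo (x - ε) (x + ε),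
      Q a x' → Q a x'' := by
    intro x
    obtain ⟨ε, hε, hQ⟩ := loc x
    refine ⟨ε, hε, fun x' hx' x'' hx'' h => ?_⟩
    rcases le_total x'' x' with hle | hle
    · exact mono _ _ _ _ le_rfl hle h
    · have hinf : (Ioo (x - ε) x').Infinite := Ioo_infinite hx'.1
      obtain ⟨c, hc, hcS⟩ := (hinf.sdiff hS).nonempty
      exact hcat a c x'' hcS (by linarith [hc.2]) (mono _ _ _ _ le_rfl hc.2.le h)
        (mono _ _ _ _ hc.1.le hx''.2.le hQ)
  have hclopen : IsClopen {x | Q a x} := by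
    constructor
    · rw [← isOpen_compl_iff, Metric.isOpen_iff]
      intro x hx
      obtain ⟨ε, hε, h⟩ := hloc x
      refine ⟨ε, hε, fun x' hx' hQ => hx ?_⟩
      rw [Real.ball_eq_Ioo] at hx'
      exact h x' hx' x ⟨by linarith, by linarith⟩ hQ
    · rw [Metric.isOpen_iff]
      intro x hx
      obtain ⟨ε, hε, h⟩ := hloc x
      refine ⟨ε, hε, fun x' hx' => ?_⟩
      rw [Real.ball_eq_Ioo] at hx'
      exact h x ⟨by linarith, by linarith⟩ x' hx' hx
  have : {x | Q a x} = univ := hclopen.eq_univ ⟨a - 1, emp _ _ (by linarith)⟩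
  have hb : b ∈ {x | Q a x} := by rw [this]; trivial
  exact hb

theorem convex_rect (a b c d : ℝ) : Convex ℝ (Icc a b ×ℂ Icc c d) := by
  have : (Icc a b ×ℂ Icc c d) = Complex.reLm ⁻¹' Icc a b ∩ Complex.imLm ⁻¹' Icc c d := rfl
  rw [this]
  exact ((convex_Icc a b).linear_preimage _).inter ((convex_Icc c d).linear_preimage _)

theorem sweep (hc : Cyc n q τ) (hπ : Continuous π) (hfin : ∀ t, (π ⁻¹' {t}).Finite)
    (hcl : IsClosedMap π) (B : Set ℂ) (hB : B.Finite) (hcov : IsCoveringMapOn π Bᶜ) (R : ℝ) :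
    Good n q τ π (Icc (-R) R ×ℂ Icc (-R) R) := by
  have hempty : Good n q τ π ∅ := by
    refine ⟨fun _ => 1, ?_, fun e he => he.elim, fun e he => he.elim⟩
    simp
  have hclos : ∀ a b c d : ℝ, IsClosed (Icc a b ×ℂ Icc c d) := fun a b c d =>
    isClosed_Icc.reProdIm isClosed_Icc
  have hst : ∀ x : ℝ, ∀ c d : ℝ, ∃ ε > 0, Good n q τ π (Icc (x - ε) (x + ε) ×ℂ Icc c d) := by
    intro x c d
    apply one_dim (fun c d => ∃ ε > 0, Good n q τ π (Icc (x - ε) (x + ε) ×ℂ Icc c d))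
      (Complex.im '' B) (hB.image _)
    · rintro a b a' b' ha hb ⟨ε, hε, h⟩
      exact ⟨ε, hε, h.mono (reProdIm_subset_iff'.2 (Or.inl ⟨le_rfl, Icc_subset_Icc ha hb⟩))⟩
    · intro a b hab
      exact ⟨1, one_pos, by rw [Icc_eq_empty (not_le.2 hab)]; exact hempty.mono (fun z hz => hz.2)⟩
    · rintro a b c hab hbc hb ⟨ε₁, hε₁, h₁⟩ ⟨ε₂, hε₂, h₂⟩
      refine ⟨min ε₁ ε₂, lt_min hε₁ hε₂, ?_⟩
      set ε := min ε₁ ε₂ with hε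
      have l1 : ε ≤ ε₁ := min_le_left _ _
      have l2 : ε ≤ ε₂ := min_le_right _ _
      have g₁ : Good n q τ π (Icc (x - ε) (x + ε) ×ℂ Icc a b) := h₁.mono
        (reProdIm_subset_iff'.2 (Or.inl ⟨Icc_subset_Icc (by linarith) (by linarith), le_rfl⟩))
      have g₂ : Good n q τ π (Icc (x - ε) (x + ε) ×ℂ Icc b c) := h₂.mono
        (reProdIm_subset_iff'.2 (Or.inl ⟨Icc_subset_Icc (by linarith) (by linarith), le_rfl⟩))
      have hi : (Icc (x - ε) (x + ε) ×ℂ Icc a b) ∩ (Icc (x - ε) (x + ε) ×ℂ Icc b c)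
          = Icc (x - ε) (x + ε) ×ℂ Icc b b := by
        ext z
        simp only [mem_inter_iff, mem_reProdIm, mem_Icc]
        constructor
        · rintro ⟨⟨h1, h2⟩, h3, h4⟩; exact ⟨h1, h4.1, h2.2⟩
        · rintro ⟨h1, h2⟩; exact ⟨⟨h1, by linarith, h2.2⟩, h1, h2.1, by linarith⟩
      have := good_union hc hπ hfin _ _ (hclos _ _ _ _) (hclos _ _ _ _)
        (by rw [hi]; exact convex_rect _ _ _ _) (by
          rw [hi]
          apply hcov.mono
          rintro z ⟨-, hz⟩ hzB
          exact hb ⟨z, hzB, le_antisymm hz.2 hz.1⟩) g₁ g₂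
      apply this.mono
      intro z hz
      rcases le_total z.im b with h | h
      · exact Or.inl ⟨hz.1, hz.2.1, h⟩
      · exact Or.inr ⟨hz.1, h, hz.2.2⟩
    · intro y
      obtain ⟨O, hO, σ, hσ, hq⟩ := good_local hc hfin hcl (⟨x, y⟩ : ℂ)
      obtain ⟨r, hr, hball⟩ := Metric.mem_nhds_iff.1 hO
      have hs := frame_of_section hc _ σ hσ hq
      have hg : Good n q τ π O := hs
      refine ⟨r / 4, by positivity, r / 4, by positivity, hg.mono (Subset.trans ?_ hball)⟩
      rintro z ⟨⟨h1, h2⟩, h3, h4⟩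
      rw [Metric.mem_ball, Complex.dist_eq]
      refine (Complex.norm_le_abs_re_add_abs_im _).trans_lt ?_
      simp only [sub_re, sub_im]
      have a1 : |z.re - x| ≤ r / 4 := abs_le.2 ⟨by linarith, by linarith⟩
      have a2 : |z.im - y| ≤ r / 4 := abs_le.2 ⟨by linarith, by linarith⟩
      linarith
  apply one_dim (fun a b => Good n q τ π (Icc a b ×ℂ Icc (-R) R)) (Complex.re '' B) (hB.image _)
  · rintro a b a' b' ha hb h
    exact h.mono (reProdIm_subset_iff'.2 (Or.inl ⟨Icc_subset_Icc ha hb, le_rfl⟩))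
  · intro a b hab
    rw [Icc_eq_empty (not_le.2 hab)]; exact hempty.mono (fun z hz => hz.1)
  · rintro a b c hab hbc hb g₁ g₂
    have hi : (Icc a b ×ℂ Icc (-R) R) ∩ (Icc b c ×ℂ Icc (-R) R)
        = Icc b b ×ℂ Icc (-R) R := by
      ext z
      simp only [mem_inter_iff, mem_reProdIm, mem_Icc]
      constructor
      · rintro ⟨⟨h1, h2⟩, h3, h4⟩; exact ⟨⟨h3.1, h1.2⟩, h2⟩
      · rintro ⟨h1, h2⟩; exact ⟨⟨⟨by linarith, h1.2⟩, h2⟩, ⟨h1.1, by linarith⟩, h2⟩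
    have := good_union hc hπ hfin _ _ (hclos _ _ _ _) (hclos _ _ _ _)
      (by rw [hi]; exact convex_rect _ _ _ _) (by
        rw [hi]
        apply hcov.mono
        rintro z ⟨hz, -⟩ hzB
        exact hb ⟨z, hzB, le_antisymm hz.2 hz.1⟩) g₁ g₂
    apply this.mono
    intro z hz
    rcases le_total z.re b with h | h
    · exact Or.inl ⟨⟨hz.1.1, h⟩, hz.2⟩
    · exact Or.inr ⟨⟨h, hz.1.2⟩, hz.2⟩
  · intro x
    exact hst x (-R) R
end sweep

end BL
end

section
namespace BL
open Topology Filter Set Complex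

/-- `r` is a tuple of roots of the monic function `P` -/
def RT {d : ℕ} (P : ℂ → ℂ) (r : Fin d → ℂ) : Prop := ∀ z, P z = ∏ i, (z - r i)

theorem RT.zero_iff {d : ℕ} {P : ℂ → ℂ} {r : Fin d → ℂ} (h : RT P r) (z : ℂ) :
    P z = 0 ↔ ∃ i, z = r i := by
  rw [h z, Finset.prod_eq_zero_iff]
  simp [sub_eq_zero]

theorem RT.prod_eq {d : ℕ} {P : ℂ → ℂ} {r r' : Fin d → ℂ} (h : RT P r) (h' : RT P r')
    (S : ℂ → ℂ) : ∏ i, S (r i) = ∏ i, S (r' i) := by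
  have key : ∀ r : Fin d → ℂ, RT P r → ∀ z, P z =
      Polynomial.eval z (Multiset.map (fun a => Polynomial.X - Polynomial.C a)
        (Multiset.map r Finset.univ.val)).prod := by
    intro r h z
    rw [h z, Multiset.map_map]
    change _ = Polynomial.eval z (∏ i, (Polynomial.X - Polynomial.C (r i)))
    rw [Polynomial.eval_prod]; simp
  have e : (Multiset.map (fun a => Polynomial.X - Polynomial.C a)
        (Multiset.map r Finset.univ.val)).prod = (Multiset.map (fun a => Polynomial.X - Polynomial.C a)
        (Multiset.map r' Finset.univ.val)).prod := by
    apply Polynomial.funext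
    intro z
    rw [← key r h, ← key r' h']
  have e2 := congrArg Polynomial.roots e
  rw [Polynomial.roots_multiset_prod_X_sub_C, Polynomial.roots_multiset_prod_X_sub_C] at e2
  have e3 := congrArg (fun m => (Multiset.map S m).prod) e2
  simp only [Multiset.map_map] at e3
  exact e3

theorem RT.of_inj {d : ℕ} {P : ℂ → ℂ} {r ρ : Fin d → ℂ} (h : RT P r)
    (hρ : Function.Injective ρ) (h0 : ∀ i, P (ρ i) = 0) : RT P ρ := by
  choose σ hσ using fun i => (h.zero_iff (ρ i)).1 (h0 i)
  have hinj : Function.Injective σ := by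
    intro i j hij
    apply hρ
    rw [hσ i, hσ j, hij]
  have hbij : Function.Bijective σ := Finite.injective_iff_bijective.1 hinj
  intro z
  rw [h z, ← hbij.prod_comp (fun i => z - r i)]
  simp [hσ]

theorem RT.deriv_ne {d : ℕ} {P : ℂ → ℂ} {r : Fin d → ℂ} (h : RT P r)
    (hr : Function.Injective r) (i : Fin d) : deriv P (r i) ≠ 0 := by
  classical
  have hP : P = fun z => ∏ i, (z - r i) := funext h
  have h1 : HasDerivAt (fun z => ∏ i, (z - r i))
      (∑ j, (∏ k ∈ Finset.univ.erase j, (r i - r k)) • (1 : ℂ)) (r i) :=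
    HasDerivAt.fun_finsetProd (fun j _ => (hasDerivAt_id (r i)).sub_const (r j))
  rw [hP, h1.deriv]
  rw [Finset.sum_eq_single i]
  · rw [smul_eq_mul, mul_one, Finset.prod_ne_zero_iff]
    intro k hk
    rw [sub_ne_zero]
    exact fun h => (Finset.ne_of_mem_erase hk) (hr h).symm
  · intro j _ hji
    rw [Finset.prod_eq_zero (i := i)]
    · simp
    · exact Finset.mem_erase.2 ⟨hji.symm, Finset.mem_univ _⟩
    · simp
  · simp

theorem RT.inj_of_deriv {d : ℕ} {P : ℂ → ℂ} {r : Fin d → ℂ} (h : RT P r)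
    (hd : ∀ z, P z = 0 → deriv P z ≠ 0) : Function.Injective r := by
  classical
  intro i j hij
  by_contra hne
  apply hd (r i) ((h.zero_iff _).2 ⟨i, rfl⟩)
  have hP : P = fun z => ∏ i, (z - r i) := funext h
  have h1 : HasDerivAt (fun z => ∏ i, (z - r i))
      (∑ j, (∏ k ∈ Finset.univ.erase j, (r i - r k)) • (1 : ℂ)) (r i) :=
    HasDerivAt.fun_finsetProd (fun j _ => (hasDerivAt_id (r i)).sub_const (r j))
  rw [hP, h1.deriv]
  apply Finset.sum_eq_zero
  intro k _
  by_cases hk : k = i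
  · subst hk
    rw [Finset.prod_eq_zero (i := j)]
    · simp
    · exact Finset.mem_erase.2 ⟨fun h => hne h.symm, Finset.mem_univ _⟩
    · rw [hij, sub_self]
  · rw [Finset.prod_eq_zero (i := i)]
    · simp
    · exact Finset.mem_erase.2 ⟨fun h => hk h.symm, Finset.mem_univ _⟩
    · rw [sub_self]

/-- one-parameter family of monic polynomials -/
structure Fam (d : ℕ) (G : ℂ → ℂ → ℂ) : Prop where
  smooth : ContDiff ℂ 1 fun q : ℂ × ℂ => G q.1 q.2
  roots : ∀ t, ∃ r : Fin d → ℂ, RT (G t) r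
  bdd : ∀ R : ℝ, ∃ C : ℝ, ∀ t z, ‖t‖ ≤ R → G t z = 0 → ‖z‖ ≤ C

/-- local sheets -/
def LS (d : ℕ) (G : ℂ → ℂ → ℂ) (t₀ : ℂ) (ε : ℝ) (ρ : Fin d → ℂ → ℂ) : Prop :=
  (∀ i, DifferentiableOn ℂ (ρ i) (Metric.ball t₀ ε)) ∧
  (∀ t ∈ Metric.ball t₀ ε, RT (G t) (fun i => ρ i t)) ∧
  ∀ t ∈ Metric.ball t₀ ε, Function.Injective fun i => ρ i t

theorem Fam.ls {d : ℕ} {G : ℂ → ℂ → ℂ} (h : Fam d G) (t₀ : ℂ) (r₀ : Fin d → ℂ)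
    (hr : RT (G t₀) r₀) (hinj : Function.Injective r₀) :
    ∃ ε > 0, ∃ ρ, LS d G t₀ ε ρ ∧ ∀ i, ρ i t₀ = r₀ i := by
  have h1 : ∀ i, ∃ ρ : ℂ → ℂ, ContDiffAt ℂ 1 ρ t₀ ∧ ρ t₀ = r₀ i ∧ ∀ᶠ t in 𝓝 t₀, G t (ρ t) = 0 := by
    intro i
    have hcd : ContDiffAt ℂ 1 (fun q : ℂ × ℂ => G q.1 q.2) (t₀, r₀ i) := h.smooth.contDiffAt
    have hdiff : HasFDerivAt (fun q : ℂ × ℂ => G q.1 q.2)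
        (fderiv ℂ (fun q : ℂ × ℂ => G q.1 q.2) (t₀, r₀ i)) (t₀, r₀ i) :=
      (hcd.differentiableAt one_ne_zero).hasFDerivAt
    have hd2 : HasFDerivAt (G t₀) (fderiv ℂ (fun q : ℂ × ℂ => G q.1 q.2) (t₀, r₀ i) ∘L
        .inr ℂ ℂ ℂ) (r₀ i) := by
      have := hdiff.comp (r₀ i) (hasFDerivAt_prodMk_right t₀ (r₀ i))
      exact this
    have hne : (fderiv ℂ (fun q : ℂ × ℂ => G q.1 q.2) (t₀, r₀ i) ∘L .inr ℂ ℂ ℂ) 1 ≠ 0 := by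
      have := hr.deriv_ne hinj i
      rwa [hd2.hasDerivAt.deriv] at this
    have hinv : (fderiv ℂ (fun q : ℂ × ℂ => G q.1 q.2) (t₀, r₀ i) ∘L .inr ℂ ℂ ℂ).IsInvertible := by
      refine ⟨ContinuousLinearEquiv.unitsEquivAut ℂ (Units.mk0 _ hne), ?_⟩
      ext
      simp
    refine ⟨hcd.implicitFunction one_ne_zero hinv,
      hcd.contDiffAt_implicitFunction one_ne_zero hinv,
      hcd.implicitFunction_apply_self one_ne_zero hinv, ?_⟩
    have := hcd.eventually_apply_implicitFunction one_ne_zero hinv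
    have h0 : G t₀ (r₀ i) = 0 := (hr.zero_iff _).2 ⟨i, rfl⟩
    simpa [h0] using this
  choose ρ hρ hρ0 hρe using h1
  have hev : ∀ᶠ t in 𝓝 t₀, (∀ i, DifferentiableAt ℂ (ρ i) t) ∧ (∀ i, G t (ρ i t) = 0) ∧
      ∀ i j, i ≠ j → ρ i t ≠ ρ j t := by
    refine (eventually_all.2 fun i => ?_).and ((eventually_all.2 hρe).and
      (eventually_all.2 fun i => eventually_all.2 fun j => ?_))
    · exact ((hρ i).eventually (by simp)).mono fun t ht => ht.differentiableAt one_ne_zero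
    · by_cases hij : i = j
      · simp [hij]
      · have : ∀ᶠ t in 𝓝 t₀, ρ i t ≠ ρ j t := by
          have hc : ContinuousAt (fun t => ρ i t - ρ j t) t₀ :=
            (hρ i).continuousAt.sub (hρ j).continuousAt
          have := hc.eventually_ne (y := 0) (by
            rw [hρ0, hρ0, sub_ne_zero]; exact fun h => hij (hinj h))
          exact this.mono fun t ht => sub_ne_zero.1 ht
        exact this.mono fun t ht _ => ht
  obtain ⟨ε, hε, hb⟩ := Metric.eventually_nhds_iff_ball.1 hev
  have hinj' : ∀ t ∈ Metric.ball t₀ ε, Function.Injective fun i => ρ i t := by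
    intro t ht i j hij
    by_contra hne
    exact (hb t ht).2.2 i j hne hij
  refine ⟨ε, hε, ρ, ⟨fun i t ht => ((hb t ht).1 i).differentiableWithinAt, fun t ht => ?_, hinj'⟩, hρ0⟩
  obtain ⟨r, hr⟩ := h.roots t
  exact hr.of_inj (hinj' t ht) (hb t ht).2.1

theorem LS.cont {d : ℕ} {G : ℂ → ℂ → ℂ} {t₀ : ℂ} {ε : ℝ} {ρ : Fin d → ℂ → ℂ} (h : LS d G t₀ ε ρ)
    (i : Fin d) : ContinuousOn (ρ i) (Metric.ball t₀ ε) := (h.1 i).continuousOn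

theorem continuous_fin_of_closed {A : Type*} [TopologicalSpace A] {d : ℕ} (k : A → Fin d)
    (hcl : ∀ j, IsClosed (k ⁻¹' {j})) : Continuous k := by
  rw [continuous_iff_isClosed]
  intro S _
  have : k ⁻¹' S = ⋃ j ∈ S, k ⁻¹' {j} := by ext a; simp
  rw [this]
  exact (Set.toFinite S).isClosed_biUnion (fun j _ => hcl j)

/-- the total space of a family -/
abbrev Fam.Tot (G : ℂ → ℂ → ℂ) : Set (ℂ × ℂ) := {q | G q.1 q.2 = 0}

/-- projection -/
def Fam.pr (G : ℂ → ℂ → ℂ) : Fam.Tot G → ℂ := fun q => q.1.1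

namespace Fam
variable {d : ℕ} {G : ℂ → ℂ → ℂ}

theorem isClosed_tot (h : Fam d G) : IsClosed (Tot G) :=
  isClosed_eq h.smooth.continuous continuous_const

theorem pr_cont : Continuous (pr G) := by unfold pr; fun_prop

theorem pr_fin (h : Fam d G) (t : ℂ) : (pr G ⁻¹' {t}).Finite := by
  obtain ⟨r, hr⟩ := h.roots t
  apply Set.Finite.of_finite_image (f := fun q : Tot G => q.1.2)
  · apply (Set.finite_range r).subset
    rintro _ ⟨q, hq, rfl⟩
    have h0 : G q.1.1 q.1.2 = 0 := q.2
    have hq : q.1.1 = t := hq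
    rw [hq] at h0
    obtain ⟨i, hi⟩ := (hr.zero_iff _).1 h0
    exact ⟨i, hi.symm⟩
  · intro q hq q' hq' he
    have hq : q.1.1 = t := hq
    have hq' : q'.1.1 = t := hq'
    exact Subtype.ext (Prod.ext (hq.trans hq'.symm) he)

theorem pr_closed (h : Fam d G) : IsClosedMap (pr G) := by
  apply IsProperMap.isClosedMap
  rw [isProperMap_iff_isCompact_preimage]
  refine ⟨pr_cont, fun K hK => ?_⟩
  rw [Topology.IsEmbedding.subtypeVal.isCompact_iff]
  obtain ⟨R, hR⟩ := hK.isBounded.exists_norm_le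
  obtain ⟨C, hC⟩ := h.bdd R
  have : Subtype.val '' (pr G ⁻¹' K) = Tot G ∩ Prod.fst ⁻¹' K := by
    ext q
    constructor
    · rintro ⟨q, hq, rfl⟩; exact ⟨q.2, hq⟩
    · rintro ⟨h1, h2⟩; exact ⟨⟨q, h1⟩, h2, rfl⟩
  rw [this]
  apply Metric.isCompact_of_isClosed_isBounded
  · exact h.isClosed_tot.inter (hK.isClosed.preimage continuous_fst)
  · rw [isBounded_iff_forall_norm_le]
    refine ⟨max R C, fun q hq => ?_⟩
    rw [Prod.norm_def]
    exact max_le_max (hR _ hq.2) (hC _ _ (hR _ hq.2) hq.1)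

theorem pr_evenly {t₀ : ℂ} {ε : ℝ} {ρ : Fin d → ℂ → ℂ}
    (hε : 0 < ε) (hl : LS d G t₀ ε ρ) : IsEvenlyCovered (pr G) t₀ (Fin d) := by
  have hex : ∀ q : pr G ⁻¹' Metric.ball t₀ ε, ∃ i, q.1.1.2 = ρ i q.1.1.1 := fun q =>
    ((hl.2.1 _ q.2).zero_iff _).1 q.1.2
  choose k hk using hex
  have hkc : Continuous k := by
    apply continuous_fin_of_closed
    intro j
    have : k ⁻¹' {j} = {q | q.1.1.2 = ρ j q.1.1.1} := by
      ext q
      constructor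
      · rintro rfl; exact hk q
      · intro hq
        exact hl.2.2 _ q.2 ((hk q).symm.trans hq)
    rw [this]
    exact isClosed_eq (by fun_prop) ((hl.cont j).comp_continuous (by fun_prop) (fun q => q.2))
  refine ⟨inferInstance, Metric.ball t₀ ε, Metric.mem_ball_self hε, Metric.isOpen_ball,
    Metric.isOpen_ball.preimage pr_cont, ?_⟩
  refine ⟨⟨⟨fun q => (⟨pr G q, q.2⟩, k q), fun u => ⟨⟨(u.1, ρ u.2 u.1), ?_⟩, u.1.2⟩, ?_, ?_⟩, ?_, ?_⟩, ?_⟩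
  · exact ((hl.2.1 _ u.1.2).zero_iff _).2 ⟨u.2, rfl⟩
  · intro q
    apply Subtype.ext; apply Subtype.ext
    exact Prod.ext rfl (hk q).symm
  · intro u
    apply Prod.ext
    · rfl
    · exact hl.2.2 _ u.1.2 (hk ⟨⟨(u.1, ρ u.2 u.1), _⟩, u.1.2⟩).symm
  · exact Continuous.prodMk (Continuous.subtype_mk (pr_cont.comp continuous_subtype_val) _) hkc
  · apply Continuous.subtype_mk
    apply Continuous.subtype_mk
    apply Continuous.prodMk (by fun_prop)
    rw [continuous_iff_continuousAt]
    rintro ⟨u, j⟩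
    have hc : Continuous fun q : Metric.ball t₀ ε × Fin d => ρ j q.1 :=
      (hl.cont j).comp_continuous (by fun_prop) (fun q => q.1.2)
    apply hc.continuousAt.congr
    have : ∀ᶠ q : Metric.ball t₀ ε × Fin d in 𝓝 (u, j), q.2 = j :=
      continuous_snd.continuousAt ((isOpen_discrete {j}).mem_nhds (mem_singleton j))
    filter_upwards [this] with q hq
    rw [← hq]
  · intro q; rfl

end Fam

/-- cone data -/
structure CD (d : ℕ) where
  F : ℂ → ℂ → ℂ → ℂ
  smooth : ContDiff ℂ 1 fun v : ℂ × ℂ × ℂ => F v.1 v.2.1 v.2.2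
  hom : ∀ l x y z, F (l * x) (l * y) (l * z) = l ^ d * F x y z
  roots : ∀ x y, ∃ r : Fin d → ℂ, RT (F x y) r
  B : Set ℂ
  Bfin : B.Finite
  B0 : (0 : ℂ) ∉ B
  simple : ∀ s ∉ B, ∀ r : Fin d → ℂ, RT (F 1 s) r → Function.Injective r
  conn : IsPreconnected {q : ℂ × ℂ | q.1 ∉ B ∧ F 1 q.1 q.2 = 0}
  dpos : 0 < d

namespace CD
variable {d : ℕ} (D : CD d)

/-- the punctured cone -/
def W : Set (ℂ × ℂ × ℂ) := {v | v ≠ 0 ∧ D.F v.1 v.2.1 v.2.2 = 0}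

theorem F00 : D.F 0 0 1 ≠ 0 := by
  obtain ⟨r, hr⟩ := D.roots 0 0
  intro h0
  have hall : ∀ z, D.F 0 0 z = 0 := by
    intro z
    have := D.hom z 0 0 1
    simpa [h0] using this
  have hfin : (Set.range r).Finite := Set.finite_range r
  obtain ⟨z, hz⟩ := hfin.exists_notMem
  obtain ⟨i, hi⟩ := (hr.zero_iff z).1 (hall z)
  exact hz ⟨i, hi.symm⟩

theorem bound : ∃ C : ℝ, 0 < C ∧ ∀ x y z, D.F x y z = 0 → ‖z‖ ≤ C * max ‖x‖ ‖y‖ := by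
  have hc : Continuous fun q : ℂ × ℂ => D.F q.1 q.2 1 :=
    D.smooth.continuous.comp (f := fun q : ℂ × ℂ => (q.1, q.2, (1 : ℂ))) (by fun_prop)
  have hev : ∀ᶠ q : ℂ × ℂ in 𝓝 0, D.F q.1 q.2 1 ≠ 0 := hc.continuousAt.eventually_ne D.F00
  obtain ⟨δ, hδ, hb⟩ := Metric.eventually_nhds_iff_ball.1 hev
  refine ⟨δ⁻¹, by positivity, fun x y z h => ?_⟩
  by_contra! hlt
  have hz : z ≠ 0 := by
    rintro rfl
    simp only [norm_zero] at hlt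
    have : 0 ≤ δ⁻¹ * max ‖x‖ ‖y‖ := by positivity
    linarith
  have hz' : 0 < ‖z‖ := norm_pos_iff.2 hz
  have h1 := D.hom z⁻¹ x y z
  rw [h, mul_zero, inv_mul_cancel₀ hz] at h1
  apply hb (z⁻¹ * x, z⁻¹ * y) _ h1
  rw [mem_ball_zero_iff, Prod.norm_def]
  simp only [norm_mul, norm_inv]
  have h3 : max ‖x‖ ‖y‖ < δ * ‖z‖ := by
    rw [inv_mul_lt_iff₀ hδ] at hlt; exact hlt
  rw [max_lt_iff] at h3 ⊢
  constructor
  · rw [inv_mul_lt_iff₀ hz', mul_comm]; exact h3.1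
  · rw [inv_mul_lt_iff₀ hz', mul_comm]; exact h3.2

theorem W_iff (x y z : ℂ) : (x, y, z) ∈ D.W ↔ (x ≠ 0 ∨ y ≠ 0) ∧ D.F x y z = 0 := by
  constructor
  · rintro ⟨h1, h2⟩
    refine ⟨?_, h2⟩
    by_contra! h
    obtain ⟨rfl, rfl⟩ := h
    obtain ⟨C, hC, hb⟩ := D.bound
    have := hb 0 0 z h2
    simp at this
    simp [this] at h1
  · rintro ⟨h1, h2⟩
    refine ⟨?_, h2⟩
    rintro h
    simp only [Prod.mk_eq_zero] at h
    rcases h1 with h1 | h1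
    · exact h1 h.1
    · exact h1 h.2.1

theorem famX : Fam d (fun s ζ => D.F 1 s ζ) := by
  refine ⟨D.smooth.comp (f := fun q : ℂ × ℂ => ((1 : ℂ), q.1, q.2)) (by fun_prop), fun t => D.roots 1 t, fun R => ?_⟩
  obtain ⟨C, hC, hb⟩ := D.bound
  refine ⟨C * max ‖(1 : ℂ)‖ R, fun t z ht h => (hb _ _ _ h).trans ?_⟩
  gcongr

theorem famY : Fam d (fun t ζ => D.F t 1 ζ) := by
  refine ⟨D.smooth.comp (f := fun q : ℂ × ℂ => (q.1, (1 : ℂ), q.2)) (by fun_prop), fun t => D.roots t 1, fun R => ?_⟩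
  obtain ⟨C, hC, hb⟩ := D.bound
  refine ⟨C * max R ‖(1 : ℂ)‖, fun t z ht h => (hb _ _ _ h).trans ?_⟩
  gcongr

theorem lsX (s : ℂ) (hs : s ∉ D.B) : ∃ ε > 0, ∃ ρ, LS d (fun s ζ => D.F 1 s ζ) s ε ρ := by
  obtain ⟨r, hr⟩ := D.roots 1 s
  obtain ⟨ε, hε, ρ, h, -⟩ := D.famX.ls s r hr (D.simple s hs r hr)
  exact ⟨ε, hε, ρ, h⟩

theorem covX : IsCoveringMapOn (Fam.pr (fun s ζ => D.F 1 s ζ)) D.Bᶜ := by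
  intro s hs
  obtain ⟨ε, hε, ρ, h⟩ := D.lsX s hs
  exact (Fam.pr_evenly hε h).to_isEvenlyCovered_preimage

/-- bad parameters in the chart `y = 1` -/
def By : Set ℂ := {0} ∪ (fun s => s⁻¹) '' D.B

theorem covY : IsCoveringMapOn (Fam.pr (fun t ζ => D.F t 1 ζ)) D.Byᶜ := by
  intro t ht
  have ht0 : t ≠ 0 := fun h => ht (Or.inl h)
  have htB : t⁻¹ ∉ D.B := fun h => ht (Or.inr ⟨_, h, inv_inv t⟩)
  obtain ⟨r, hr⟩ := D.roots t 1
  have hr' : RT (D.F 1 t⁻¹) (fun i => t⁻¹ * r i) := by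
    intro z
    have := D.hom t⁻¹ t 1 (t * z)
    rw [inv_mul_cancel₀ ht0, mul_one, inv_mul_cancel_left₀ ht0] at this
    have hp : t⁻¹ ^ d = ∏ _i : Fin d, t⁻¹ := by simp
    rw [this, hr, hp, ← Finset.prod_mul_distrib]
    apply Finset.prod_congr rfl
    intro i _
    rw [mul_sub, inv_mul_cancel_left₀ ht0]
  have hinj : Function.Injective r := by
    intro i j hij
    apply D.simple _ htB _ hr'
    simp [hij]
  obtain ⟨ε, hε, ρ, h, -⟩ := D.famY.ls t r hr hinj
  exact (Fam.pr_evenly hε h).to_isEvenlyCovered_preimage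

theorem By_fin : D.By.Finite := (Set.finite_singleton 0).union (D.Bfin.image _)

/-- continuity of the norm -/
theorem norm_cont (S : ℂ × ℂ × ℂ → ℂ) (hS : ContinuousOn S D.W) :
    ∃ N : ℂ × ℂ → ℂ, ContinuousOn N {v | v ≠ 0} ∧
      ∀ x y (r : Fin d → ℂ), RT (D.F x y) r → N (x, y) = ∏ i, S (x, y, r i) := by
  choose r hr using fun v : ℂ × ℂ => D.roots v.1 v.2
  have hN : ∀ x y (r' : Fin d → ℂ), RT (D.F x y) r' →
      ∏ i, S (x, y, r (x, y) i) = ∏ i, S (x, y, r' i) := fun x y r' h =>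
    (hr (x, y)).prod_eq h (fun z => S (x, y, z))
  refine ⟨fun v => ∏ i, S (v.1, v.2, r v i), ?_, hN⟩
  rintro ⟨x, y⟩ hv
  have hmem : ∀ (v : ℂ × ℂ), v ≠ 0 → ∀ r : Fin d → ℂ, RT (D.F v.1 v.2) r → ∀ i,
      (v.1, v.2, r i) ∈ D.W := by
    intro v hv r hr i
    rw [D.W_iff]
    refine ⟨?_, (hr.zero_iff _).2 ⟨i, rfl⟩⟩
    by_contra! h
    exact hv (Prod.ext h.1 h.2)
  apply tendsto_of_subseq_tendsto
  intro v hvt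
  have hv1 : Tendsto v atTop (𝓝 (x, y)) := tendsto_nhds_of_tendsto_nhdsWithin hvt
  have hv2 : ∀ᶠ n in atTop, v n ≠ 0 := hvt self_mem_nhdsWithin
  obtain ⟨C, hC, hb⟩ := D.bound
  obtain ⟨M, hM⟩ := (Metric.isBounded_range_of_tendsto v hv1).exists_norm_le
  have hbd : ∀ n, r (v n) ∈ Metric.closedBall (0 : Fin d → ℂ) (C * M) := by
    intro n
    have hM0 : 0 ≤ M := (norm_nonneg _).trans (hM _ ⟨n, rfl⟩)
    rw [mem_closedBall_zero_iff, pi_norm_le_iff_of_nonneg (by positivity)]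
    intro i
    refine (hb _ _ _ (((hr (v n)).zero_iff _).2 ⟨i, rfl⟩)).trans ?_
    gcongr
    exact hM _ ⟨n, rfl⟩
  obtain ⟨r', -, φ, hφ, hlim⟩ := tendsto_subseq_of_bounded Metric.isBounded_closedBall hbd
  have hvφ : Tendsto (v ∘ φ) atTop (𝓝 (x, y)) := hv1.comp hφ.tendsto_atTop
  have hi : ∀ i, Tendsto (fun n => r (v (φ n)) i) atTop (𝓝 (r' i)) := fun i =>
    (continuous_apply i).continuousAt.tendsto.comp hlim
  have hx : Tendsto (fun n => (v (φ n)).1) atTop (𝓝 x) :=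
    (continuous_fst.tendsto _).comp hvφ
  have hy : Tendsto (fun n => (v (φ n)).2) atTop (𝓝 y) :=
    (continuous_snd.tendsto _).comp hvφ
  have hr' : RT (D.F x y) r' := by
    intro z
    have l1 : Tendsto (fun n => D.F (v (φ n)).1 (v (φ n)).2 z) atTop (𝓝 (D.F x y z)) :=
      (D.smooth.continuous.tendsto (x, y, z)).comp (hx.prodMk_nhds (hy.prodMk_nhds tendsto_const_nhds))
    have l2 : Tendsto (fun n => D.F (v (φ n)).1 (v (φ n)).2 z) atTop (𝓝 (∏ i, (z - r' i))) := by
      have : (fun n => D.F (v (φ n)).1 (v (φ n)).2 z) = fun n => ∏ i, (z - r (v (φ n)) i) := by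
        ext n; exact hr (v (φ n)) z
      rw [this]
      exact tendsto_finsetProd _ (fun i _ => tendsto_const_nhds.sub (hi i))
    exact tendsto_nhds_unique l1 l2
  refine ⟨φ, ?_⟩
  change Tendsto _ _ (𝓝 (∏ i, S (x, y, r (x, y) i)))
  rw [hN x y r' hr']
  apply tendsto_finsetProd
  intro i _
  have hw := hS _ (hmem (x, y) hv r' hr' i)
  apply hw.tendsto.comp
  rw [tendsto_nhdsWithin_iff]
  refine ⟨hx.prodMk_nhds (hy.prodMk_nhds (hi i)), ?_⟩
  filter_upwards [hφ.tendsto_atTop.eventually hv2] with n hn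
  exact hmem _ hn _ (hr _) i

end CD
end BL
end

section
namespace BL
open Topology Filter Set Complex

section theta
set_option linter.unusedSectionVars false
set_option linter.unusedSimpArgs false
variable {X : Type} [TopologicalSpace X] [T2Space X] (s : X → ℂ) (X0 : Set X)

/-- `θ` has divisor `D` -/
structure Dv (θ : X → ℂ) (D : X → ℤ) : Prop where
  cpt : ∃ κ, IsCompact κ ∧ ∀ x ∉ κ, θ x = 1
  reg : ∃ T : Set X, T.Finite ∧ ∀ x ∉ T, D x = 0 ∧ ContinuousAt θ x ∧ θ x ≠ 0
  lim : ∀ x, ∃ c : ℂ, c ≠ 0 ∧ Tendsto (fun x' => θ x' * (s x' - s x) ^ (-D x)) (𝓝[≠] x) (𝓝 c)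
  out : ∀ x ∉ X0, D x = 0

variable {s X0}

theorem Dv.one : Dv s X0 (fun _ => 1) 0 := by
  refine ⟨⟨∅, isCompact_empty, fun _ _ => rfl⟩, ⟨∅, finite_empty, fun x _ => ?_⟩, fun x => ?_, fun _ _ => rfl⟩
  · exact ⟨rfl, continuousAt_const, one_ne_zero⟩
  · exact ⟨1, one_ne_zero, by simpa using tendsto_const_nhds⟩

theorem loc_inj (hs : IsLocalHomeomorphOn s X0) (x : X) (hx : x ∈ X0) :
    ∀ᶠ x' in 𝓝[≠] x, s x' - s x ≠ 0 := by
  obtain ⟨e, hxe, rfl⟩ := hs x hx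
  have : ∀ᶠ x' in 𝓝 x, x' ∈ e.source := e.open_source.mem_nhds hxe
  filter_upwards [this.filter_mono nhdsWithin_le_nhds, self_mem_nhdsWithin] with x' h1 h2 h3
  exact h2 (e.injOn h1 hxe (sub_eq_zero.1 h3))

theorem Dv.mul (hs : IsLocalHomeomorphOn s X0) {θ θ' : X → ℂ} {D D' : X → ℤ} (h : Dv s X0 θ D) (h' : Dv s X0 θ' D') :
    Dv s X0 (fun x => θ x * θ' x) (D + D') := by
  obtain ⟨κ, hκ, hθ⟩ := h.cpt
  obtain ⟨κ', hκ', hθ'⟩ := h'.cpt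
  obtain ⟨T, hT, hr⟩ := h.reg
  obtain ⟨T', hT', hr'⟩ := h'.reg
  refine ⟨⟨κ ∪ κ', hκ.union hκ', fun x hx => ?_⟩, ⟨T ∪ T', hT.union hT', fun x hx => ?_⟩, fun x => ?_, fun x hx => ?_⟩
  · simp only [mem_union, not_or] at hx
    simp [hθ x hx.1, hθ' x hx.2]
  · simp only [mem_union, not_or] at hx
    obtain ⟨a1, a2, a3⟩ := hr x hx.1
    obtain ⟨b1, b2, b3⟩ := hr' x hx.2
    exact ⟨by simp [a1, b1], a2.mul b2, mul_ne_zero a3 b3⟩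
  · obtain ⟨c, hc, hl⟩ := h.lim x
    obtain ⟨c', hc', hl'⟩ := h'.lim x
    refine ⟨c * c', mul_ne_zero hc hc', (hl.mul hl').congr' ?_⟩
    by_cases hx : x ∈ X0
    · filter_upwards [loc_inj hs x hx] with x' hx'
      rw [Pi.add_apply, neg_add, zpow_add₀ hx']; ring
    · refine Eventually.of_forall fun x' => ?_
      simp [h.out x hx, h'.out x hx]
  · simp [h.out x hx, h'.out x hx]

theorem Dv.inv {θ : X → ℂ} {D : X → ℤ} (h : Dv s X0 θ D) :
    Dv s X0 (fun x => (θ x)⁻¹) (-D) := by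
  obtain ⟨κ, hκ, hθ⟩ := h.cpt
  obtain ⟨T, hT, hr⟩ := h.reg
  refine ⟨⟨κ, hκ, fun x hx => ?_⟩, ⟨T, hT, fun x hx => ?_⟩, fun x => ?_, fun x hx => ?_⟩
  · simp [hθ x hx]
  · obtain ⟨a1, a2, a3⟩ := hr x hx
    exact ⟨by simp [a1], a2.inv₀ a3, inv_ne_zero a3⟩
  · obtain ⟨c, hc, hl⟩ := h.lim x
    refine ⟨c⁻¹, inv_ne_zero hc, (hl.inv₀ hc).congr fun x' => ?_⟩
    simp [mul_comm]
  · simp [h.out x hx]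

theorem Dv.zpow (hs : IsLocalHomeomorphOn s X0) {θ : X → ℂ} {D : X → ℤ} (h : Dv s X0 θ D) (k : ℤ) :
    ∃ θ', Dv s X0 θ' (k • D) := by
  induction k using Int.induction_on with
  | zero => exact ⟨_, by simpa using Dv.one⟩
  | succ i ih =>
    obtain ⟨θ', h'⟩ := ih
    have := h'.mul hs h
    refine ⟨fun x => θ' x * θ x, ?_⟩
    · rw [add_smul, one_smul]
      exact this
  | pred i ih =>
    obtain ⟨θ', h'⟩ := ih
    have := h'.mul hs h.inv
    refine ⟨fun x => θ' x * (θ x)⁻¹, ?_⟩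
    · rw [sub_smul, one_smul, sub_eq_add_neg]
      exact this

open Classical in
theorem Dv.loc (hs : IsLocalHomeomorphOn s X0) (x0 : X) (hx0 : x0 ∈ X0) (hX0 : IsOpen X0) :
    ∀ᶠ b in 𝓝 x0, ∃ θ, Dv s X0 θ (Pi.single b 1 - Pi.single x0 1) := by
  obtain ⟨e, hxe, rfl⟩ := hs x0 hx0
  obtain ⟨r', hr', hb'⟩ := Metric.isOpen_iff.1 e.open_target (e x0) (e.map_source hxe)
  set r := r' / 3 with hr
  have hr0 : 0 < r := by positivity
  have hrC : (r : ℂ) ≠ 0 := by exact_mod_cast hr0.ne'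
  set V : Set X := e.source ∩ e ⁻¹' Metric.ball (e x0) (3 * r) with hV
  have hVo : IsOpen V := e.isOpen_inter_preimage Metric.isOpen_ball
  have hVn : ∀ᶠ b in 𝓝 x0, b ∈ e.source ∩ e ⁻¹' Metric.ball (e x0) r :=
    (e.isOpen_inter_preimage Metric.isOpen_ball).mem_nhds ⟨hxe, Metric.mem_ball_self hr0⟩
  filter_upwards [hVn, hX0.mem_nhds hx0] with b hb hbX
  by_cases hbx : b = x0
  · subst hbx
    exact ⟨_, by simpa using Dv.one⟩
  set κ : Set X := e.symm '' Metric.closedBall (e x0) (2 * r) with hκ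
  have hsub : Metric.closedBall (e x0) (2 * r) ⊆ e.target := by
    refine (Metric.closedBall_subset_ball ?_).trans hb'
    rw [hr]; linarith
  have hκc : IsCompact κ := (isCompact_closedBall _ _).image_of_continuousOn (e.continuousOn_symm.mono hsub)
  have hκs : κ ⊆ e.source := by
    rintro _ ⟨t, ht, rfl⟩; exact e.map_target (hsub ht)
  have hκi : ∀ x ∈ e.source, x ∈ κ ↔ ‖e x - e x0‖ ≤ 2 * r := by
    intro x hx
    constructor
    · rintro ⟨t, ht, rfl⟩
      rw [e.right_inv (hsub ht)]
      simpa [dist_eq_norm] using ht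
    · intro h
      exact ⟨e x, by simpa [dist_eq_norm] using h, e.left_inv hx⟩
  set z : X → ℂ := fun x => (e x - e x0) / r with hz
  set α := z b with hα
  have hα1 : ‖α‖ < 1 := by
    have := hb.2
    simp only [mem_preimage, Metric.mem_ball, dist_eq_norm] at this
    rw [hα, hz]
    simp only [norm_div, norm_real, Real.norm_eq_abs, abs_of_pos hr0]
    rwa [div_lt_one hr0]
  have hα0 : α ≠ 0 := by
    rw [hα, hz]
    refine div_ne_zero (sub_ne_zero.2 fun h => hbx (e.injOn hb.1 hxe h)) hrC
  set ρ : ℂ → ℝ := fun z => min 1 (max 0 (2 - ‖z‖)) with hρ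
  have hρc : Continuous ρ := by rw [hρ]; fun_prop
  have hρ0 : ∀ z, 2 ≤ ‖z‖ → ρ z = 0 := by
    intro z hz; simp only [hρ]; rw [max_eq_left (by linarith)]; simp
  have hρ1 : ∀ z, ‖z‖ ≤ 1 → ρ z = 1 := by
    intro z hz; simp only [hρ]; rw [max_eq_right (by linarith), min_eq_left (by linarith)]
  have hρn : ∀ z, |ρ z| ≤ 1 := by
    intro z
    rw [abs_le]; constructor
    · have : 0 ≤ ρ z := le_min zero_le_one (le_max_left _ _)
      linarith
    · exact min_le_left _ _
  have hzn : ∀ x, ‖z x‖ = ‖e x - e x0‖ / r := by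
    intro x; simp [hz, abs_of_pos hr0]
  set Θ : X → ℂ := fun x => 1 - α * ρ (z x) / z x with hΘ
  set θ : X → ℂ := fun x => if x ∈ κ then Θ x else 1 with hθ
  have hθe : ∀ x ∈ e.source, θ x = Θ x := by
    intro x hx
    by_cases hk : x ∈ κ
    · simp [hθ, hk]
    · simp only [hθ, hk, if_false, hΘ]
      rw [hκi x hx, not_le] at hk
      rw [hρ0 (z x)]
      · simp
      · rw [hzn, le_div_iff₀ hr0]; exact hk.le
  have hzc : ∀ x ∈ e.source, ContinuousAt z x := fun x hx =>
    ((e.continuousAt hx).sub continuousAt_const).div_const _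
  have hz0 : ∀ x ∈ e.source, x ≠ x0 → z x ≠ 0 := fun x hx hne =>
    div_ne_zero (sub_ne_zero.2 fun h => hne (e.injOn hx hxe h)) hrC
  have hcont : ∀ x, x ≠ x0 → ContinuousAt θ x := by
    intro x hx
    by_cases hxs : x ∈ e.source
    · have h1 : ContinuousAt Θ x :=
        continuousAt_const.sub ((continuousAt_const.mul
          ((Complex.continuous_ofReal.comp hρc).continuousAt.comp (hzc x hxs))).div (hzc x hxs) (hz0 x hxs hx))
      apply h1.congr
      filter_upwards [e.open_source.mem_nhds hxs] with y hy
      exact (hθe y hy).symm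
    · have : x ∈ κᶜ := fun h => hxs (hκs h)
      apply (continuousAt_const (y := (1:ℂ))).congr
      filter_upwards [hκc.isClosed.isOpen_compl.mem_nhds this] with y hy
      simp only [hθ]; rw [if_neg hy]
  have hne : ∀ x, x ≠ x0 → x ≠ b → θ x ≠ 0 := by
    intro x hx hxb
    by_cases hxs : x ∈ e.source
    · rw [hθe x hxs]
      simp only [hΘ]
      have hzx := hz0 x hxs hx
      intro h0
      have h1 : α * ρ (z x) = z x := by
        field_simp at h0
        linear_combination -h0
      by_cases hz1 : ‖z x‖ ≤ 1
      · rw [hρ1 _ hz1] at h1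
        apply hxb
        apply e.injOn hxs hb.1
        have h2 : z b = z x := by rw [← hα, ← h1]; simp
        simp only [hz] at h2
        field_simp at h2
        linear_combination -h2
      · have h2 : ‖z x‖ = ‖α‖ * |ρ (z x)| := by
          conv_lhs => rw [← h1]
          simp
        have h3 := hρn (z x)
        have : ‖α‖ * |ρ (z x)| ≤ 1 * 1 := by gcongr
        linarith [not_le.1 hz1]
    · have : x ∉ κ := fun h => hxs (hκs h)
      simp [hθ, this]
  have hnear : ∀ᶠ x in 𝓝 x0, θ x = 1 - α / z x := by
    filter_upwards [hVn] with x hx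
    rw [hθe x hx.1]
    simp only [hΘ]
    rw [hρ1]
    · simp
    · rw [hzn, div_le_one hr0]
      have := hx.2
      simp only [mem_preimage, Metric.mem_ball, dist_eq_norm] at this
      exact this.le
  have hnearb : ∀ᶠ x in 𝓝 b, θ x = 1 - α / z x := by
    filter_upwards [(e.isOpen_inter_preimage Metric.isOpen_ball).mem_nhds hb] with x hx
    rw [hθe x hx.1]
    simp only [hΘ]
    rw [hρ1]
    · simp
    · rw [hzn, div_le_one hr0]
      have := hx.2
      simp only [mem_preimage, Metric.mem_ball, dist_eq_norm] at this
      exact this.le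
  refine ⟨θ, ⟨κ, hκc, fun x hx => by simp [hθ, hx]⟩, ⟨{x0, b}, by simp, fun x hx => ?_⟩, fun x => ?_, fun x hx => ?_⟩
  · simp only [mem_insert_iff, mem_singleton_iff, not_or] at hx
    refine ⟨?_, hcont x hx.1, hne x hx.1 hx.2⟩
    simp [Pi.single_apply, hx.1, hx.2]
  · by_cases h1 : x = x0
    · subst h1
      refine ⟨r * (0 - α), mul_ne_zero hrC (by simpa using hα0), ?_⟩
      have hD : -(Pi.single b (1:ℤ) - Pi.single x 1 : X → ℤ) x = 1 := by
        simp [Pi.single_apply, Ne.symm hbx]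
      rw [hD]
      have hzl : Tendsto z (𝓝[≠] x) (𝓝 0) := by
        have := (hzc x hxe).tendsto
        simp only [hz, sub_self, zero_div] at this
        exact this.mono_left nhdsWithin_le_nhds
      refine ((tendsto_const_nhds (x := (r : ℂ))).mul (hzl.sub_const α)).congr' ?_
      filter_upwards [hnear.filter_mono nhdsWithin_le_nhds, self_mem_nhdsWithin,
        (e.open_source.mem_nhds hxe |> mem_nhdsWithin_of_mem_nhds)] with y hy1 hy2 hy3
      have := hz0 y hy3 hy2
      have h4 : e y - e x = r * z y := by simp only [hz]; field_simp
      rw [hy1, zpow_one, h4]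
      field_simp
    · by_cases h2 : x = b
      · rw [h2]
        refine ⟨(r * α)⁻¹, inv_ne_zero (mul_ne_zero hrC hα0), ?_⟩
        have hD : -(Pi.single b (1:ℤ) - Pi.single x0 1 : X → ℤ) b = -1 := by
          simp [Pi.single_apply, hbx]
        rw [hD]
        have hzl : Tendsto z (𝓝[≠] b) (𝓝 α) := by
          have := (hzc b hb.1).tendsto
          exact this.mono_left nhdsWithin_le_nhds
        refine ((tendsto_const_nhds (x := (r : ℂ))).mul hzl |>.inv₀ (mul_ne_zero hrC hα0)).congr' ?_
        filter_upwards [hnearb.filter_mono nhdsWithin_le_nhds, self_mem_nhdsWithin,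
          (e.open_source.mem_nhds hb.1 |> mem_nhdsWithin_of_mem_nhds),
          (hzc b hb.1).eventually_ne hα0 |>.filter_mono nhdsWithin_le_nhds] with y hy1 hy2 hy3 hy4
        have h4 : e y - e b = r * (z y - α) := by simp only [hz, hα]; field_simp; ring
        have h5 : z y - α ≠ 0 := by
          intro h
          rw [h, mul_zero] at h4
          exact hy2 (e.injOn hy3 hb.1 (sub_eq_zero.1 h4))
        rw [hy1, zpow_neg_one, h4]
        field_simp
      · refine ⟨θ x, hne x h1 h2, ?_⟩
        have hD : -(Pi.single b (1:ℤ) - Pi.single x0 1 : X → ℤ) x = 0 := by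
          simp [Pi.single_apply, h1, h2]
        rw [hD]
        simpa using (hcont x h1).tendsto.mono_left nhdsWithin_le_nhds
  · have h1 : x ≠ x0 := fun h => hx (h ▸ hx0)
    have h2 : x ≠ b := fun h => hx (h ▸ hbX)
    simp [Pi.single_apply, h1, h2]

open Classical in
theorem Dv.pair (hs : IsLocalHomeomorphOn s X0) (hX0 : IsOpen X0) (hc : IsPreconnected X0) {a b : X}
    (ha : a ∈ X0) (hb : b ∈ X0) : ∃ θ, Dv s X0 θ (Pi.single a 1 - Pi.single b 1) := by
  apply hc.induction₂ (fun a b => ∃ θ, Dv s X0 θ (Pi.single a 1 - Pi.single b 1)) _ _ _ ha hb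
  · intro x hx
    filter_upwards [(Dv.loc hs x hx hX0).filter_mono nhdsWithin_le_nhds] with y hy
    obtain ⟨θ, h⟩ := hy
    exact ⟨_, by simpa using h.inv⟩
  · rintro x y z - - - ⟨θ, h⟩ ⟨θ', h'⟩
    exact ⟨_, by simpa using h.mul hs h'⟩
  · rintro x y - - ⟨θ, h⟩
    exact ⟨_, by simpa using h.inv⟩

open Classical in
theorem Dv.exists_sum (hs : IsLocalHomeomorphOn s X0) (hX0 : IsOpen X0) (hc : IsPreconnected X0) {ι : Type}
    (S : Finset ι) (p : ι → X) (hp : ∀ i, p i ∈ X0) (k : ι → ℤ) (x0 : X) (hx0 : x0 ∈ X0) :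
    ∃ θ, Dv s X0 θ (∑ i ∈ S, k i • (Pi.single (p i) 1 - Pi.single x0 1)) := by
  induction S using Finset.induction_on with
  | empty => exact ⟨_, by simpa using Dv.one⟩
  | insert i S hi ih =>
    obtain ⟨θ, h⟩ := ih
    obtain ⟨θ1, h1⟩ := Dv.pair hs hX0 hc (hp i) hx0
    obtain ⟨θ2, h2⟩ := h1.zpow hs (k i)
    rw [Finset.sum_insert hi]
    exact ⟨_, h2.mul hs h⟩

open Classical in
theorem Dv.final (hs : IsLocalHomeomorphOn s X0) (hX0 : IsOpen X0) (hc : IsPreconnected X0) {d : ℕ}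
    (p : Fin d → X) (hinj : Function.Injective p) (hp : ∀ i, p i ∈ X0) (k : Fin d → ℤ) (hk : ∑ i, k i = 0) :
    ∃ θ : X → ℂ, (∃ κ, IsCompact κ ∧ ∀ x ∉ κ, θ x = 1) ∧
      (∀ x, x ∉ Set.range p → ContinuousAt θ x ∧ θ x ≠ 0) ∧
      ∀ i, ∃ c : ℂ, c ≠ 0 ∧ Tendsto (fun x' => θ x' * (s x' - s (p i)) ^ (-k i)) (𝓝[≠] (p i)) (𝓝 c) := by
  rcases Nat.eq_zero_or_pos d with rfl | hd
  · exact ⟨fun _ => 1, ⟨∅, isCompact_empty, fun _ _ => rfl⟩,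
      fun x _ => ⟨continuousAt_const, one_ne_zero⟩, fun i => i.elim0⟩
  obtain ⟨θ, h⟩ := Dv.exists_sum hs hX0 hc Finset.univ p hp k (p ⟨0, hd⟩) (hp _)
  have hD : (∑ i, k i • (Pi.single (p i) 1 - Pi.single (p ⟨0, hd⟩) 1) : X → ℤ) =
      ∑ i, k i • Pi.single (p i) 1 := by
    simp only [smul_sub, Finset.sum_sub_distrib]
    rw [← Finset.sum_smul, hk]; simp
  rw [hD] at h
  have hDp : ∀ i, (∑ i, k i • Pi.single (p i) 1 : X → ℤ) (p i) = k i := by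
    intro i
    simp [Finset.sum_apply, Pi.single_apply, hinj.eq_iff]
  have hD0 : ∀ x, x ∉ Set.range p → (∑ i, k i • Pi.single (p i) 1 : X → ℤ) x = 0 := by
    intro x hx
    rw [Finset.sum_apply]
    apply Finset.sum_eq_zero
    intro i _
    have : x ≠ p i := fun h => hx ⟨i, h.symm⟩
    simp [Pi.single_apply, this]
  obtain ⟨κ, hκ, hθ⟩ := h.cpt
  obtain ⟨T, hT, hr⟩ := h.reg
  choose c hc0 hcl using h.lim
  have hpun : ∀ x : X, ∀ᶠ y in 𝓝[≠] x, y ∉ T := by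
    intro x
    have h1 : IsClosed (T \ {x}) := (hT.subset sdiff_subset).isClosed
    have : ∀ᶠ y in 𝓝 x, y ∈ (T \ {x})ᶜ := h1.isOpen_compl.mem_nhds (by simp)
    filter_upwards [this.filter_mono nhdsWithin_le_nhds, self_mem_nhdsWithin] with y h1 h2 h3
    exact h1 ⟨h3, h2⟩
  refine ⟨fun x => if x ∈ T then c x else θ x, ⟨κ ∪ T, hκ.union hT.isCompact, fun x hx => ?_⟩, fun x hx => ?_, fun i => ?_⟩
  · simp only [mem_union, not_or] at hx
    simp [hx.2, hθ x hx.1]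
  · refine ⟨?_, ?_⟩
    · have key : Tendsto θ (𝓝[≠] x) (𝓝 (if x ∈ T then c x else θ x)) := by
        split_ifs with hxT
        · have := hcl x
          rw [hD0 x hx] at this
          simpa using this
        · exact (hr x hxT).2.1.tendsto.mono_left nhdsWithin_le_nhds
      rw [continuousAt_iff_punctured_nhds]
      refine key.congr' ?_
      filter_upwards [hpun x] with y hy
      simp [hy]
    · beta_reduce
      split_ifs with hxT
      · exact hc0 x
      · exact (hr x hxT).2.2
  · refine ⟨c (p i), hc0 _, ?_⟩
    have := hcl (p i)
    rw [hDp] at this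
    refine this.congr' ?_
    filter_upwards [hpun (p i)] with y hy
    simp [hy]
end theta
end BL
end

section
namespace BL
open Topology Filter Set Complex
namespace CD
variable {d : ℕ} (D : CD d)

theorem mem_W_smul {l : ℂ} (hl : l ≠ 0) {v : ℂ × ℂ × ℂ} (hv : v ∈ D.W) : l • v ∈ D.W := by
  refine ⟨smul_ne_zero hl hv.1, ?_⟩
  have := D.hom l v.1 v.2.1 v.2.2
  simp only [Prod.smul_fst, Prod.smul_snd, smul_eq_mul]
  rw [this, hv.2, mul_zero]

theorem X0_open : IsOpen (Fam.pr (fun s ζ => D.F 1 s ζ) ⁻¹' D.Bᶜ) :=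
  D.Bfin.isClosed.isOpen_compl.preimage Fam.pr_cont

theorem X0_conn : IsPreconnected (Fam.pr (fun s ζ => D.F 1 s ζ) ⁻¹' D.Bᶜ) := by
  rw [← Topology.IsInducing.subtypeVal.isPreconnected_image]
  convert D.conn using 1
  ext q
  constructor
  · rintro ⟨q, hq, rfl⟩; exact ⟨hq, q.2⟩
  · rintro ⟨h1, h2⟩; exact ⟨⟨q, h2⟩, h1, rfl⟩

open Classical in
theorem theta {ε : ℝ} (hε : 0 < ε) {ρ : Fin d → ℂ → ℂ} (h : LS d (fun s ζ => D.F 1 s ζ) 0 ε ρ)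
    (k : Fin d → ℤ) (hk : ∑ i, k i = 0) :
    ∃ θ : ℂ × ℂ × ℂ → ℂ, (∀ (l : ℂ) v, l ≠ 0 → θ (l • v) = θ v) ∧
      (∀ v ∈ D.W, v.2.1 ≠ 0 → ContinuousWithinAt θ D.W v ∧ θ v ≠ 0) ∧
      ∃ e : Fin d → ℂ → ℂ, ∀ i, ContinuousOn (e i) (Metric.ball 0 ε) ∧
        (∀ s ∈ Metric.ball (0 : ℂ) ε, e i s ≠ 0) ∧
        ∀ s ∈ Metric.ball (0 : ℂ) ε, s ≠ 0 → θ (1, s, ρ i s) = s ^ k i * e i s := by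
  set G : ℂ → ℂ → ℂ := fun s ζ => D.F 1 s ζ with hG
  have h0 : (0 : ℂ) ∈ Metric.ball (0 : ℂ) ε := Metric.mem_ball_self hε
  have hz : ∀ i, ∀ s ∈ Metric.ball (0 : ℂ) ε, G s (ρ i s) = 0 := fun i s hs =>
    ((h.2.1 s hs).zero_iff _).2 ⟨i, rfl⟩
  let p : Fin d → Fam.Tot G := fun i => ⟨(0, ρ i 0), hz i 0 h0⟩
  have hinj : Function.Injective p := by
    intro i j hij
    have : (p i).1.2 = (p j).1.2 := by rw [hij]
    exact h.2.2 0 h0 this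
  obtain ⟨θ, ⟨κ, hκ, hθ⟩, hreg, hlim⟩ := Dv.final D.covX.isLocalHomeomorphOn D.X0_open D.X0_conn p hinj
    (fun i => D.B0) k hk
  have hT : IsClosed (Fam.Tot G) := D.famX.isClosed_tot
  let Θ : ℂ × ℂ × ℂ → ℂ := fun v => if hv : v.1 ≠ 0 ∧ G (v.2.1 / v.1) (v.2.2 / v.1) = 0 then
    θ ⟨(v.2.1 / v.1, v.2.2 / v.1), hv.2⟩ else 1
  have hΘ1 : ∀ (s ζ : ℂ) (hs : G s ζ = 0), Θ (1, s, ζ) = θ ⟨(s, ζ), hs⟩ := by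
    intro s ζ hs
    have hs' : (1 : ℂ) ≠ 0 ∧ G (s / 1) (ζ / 1) = 0 := ⟨one_ne_zero, by simpa using hs⟩
    simp only [Θ]
    rw [dif_pos hs']
    simp
  have hWG : ∀ v ∈ D.W, v.1 ≠ 0 → G (v.2.1 / v.1) (v.2.2 / v.1) = 0 := by
    intro v hv h1
    have := (D.mem_W_smul (inv_ne_zero h1) hv).2
    simp only [Prod.smul_fst, Prod.smul_snd, smul_eq_mul] at this
    rw [inv_mul_cancel₀ h1] at this
    simpa [hG, div_eq_inv_mul] using this
  obtain ⟨R, hR⟩ : ∃ R, ∀ q ∈ κ, ‖(q : Fam.Tot G).1.1‖ ≤ R := by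
    obtain ⟨R, hR⟩ := ((hκ.image (Fam.pr_cont (G := G))).isBounded).exists_norm_le
    exact ⟨R, fun q hq => hR _ ⟨q, hq, rfl⟩⟩
  refine ⟨Θ, ?_, ?_, ?_⟩
  · intro l v hl
    simp only [Θ, Prod.smul_fst, Prod.smul_snd, smul_eq_mul]
    simp only [mul_div_mul_left _ _ hl, mul_ne_zero_iff, hl, ne_eq, not_false_eq_true, true_and]
  · intro v hv hy
    by_cases h1 : v.1 = 0
    · have hev : ∀ᶠ w : ℂ × ℂ × ℂ in 𝓝 v, |R| * ‖w.1‖ < ‖w.2.1‖ := by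
        apply ContinuousAt.eventually_lt (f := fun w : ℂ × ℂ × ℂ => |R| * ‖w.1‖) (g := fun w => ‖w.2.1‖)
        · fun_prop
        · fun_prop
        · simp [h1, hy]
      have hone : ∀ w : ℂ × ℂ × ℂ, |R| * ‖w.1‖ < ‖w.2.1‖ → Θ w = 1 := by
        intro w hw
        simp only [Θ]
        split_ifs with hw2
        · apply hθ
          intro hk
          have := hR _ hk
          simp only [norm_div] at this
          rw [div_le_iff₀ (norm_pos_iff.2 hw2.1)] at this
          have h3 : R * ‖w.1‖ ≤ |R| * ‖w.1‖ := by gcongr; exact le_abs_self R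
          linarith
        · rfl
      refine ⟨?_, ?_⟩
      · apply ContinuousAt.continuousWithinAt
        apply (continuousAt_const (y := (1:ℂ))).congr
        filter_upwards [hev] with w hw
        exact (hone w hw).symm
      · rw [hone v (by simp [h1, hy])]; exact one_ne_zero
    · have hG0 := hWG v hv h1
      have hnr : (⟨(v.2.1 / v.1, v.2.2 / v.1), hG0⟩ : Fam.Tot G) ∉ Set.range p := by
        rintro ⟨i, hi⟩
        have : (0 : ℂ) = v.2.1 / v.1 := congrArg (fun q : Fam.Tot G => q.1.1) hi
        exact div_ne_zero hy h1 this.symm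
      obtain ⟨hc, hne⟩ := hreg _ hnr
      have hev : ∀ᶠ w : ℂ × ℂ × ℂ in 𝓝[D.W] v, w.1 ≠ 0 :=
        (continuous_fst.continuousAt.eventually_ne h1).filter_mono nhdsWithin_le_nhds
      have hΘv : Θ v = θ ⟨(v.2.1 / v.1, v.2.2 / v.1), hG0⟩ := by simp only [Θ]; rw [dif_pos ⟨h1, hG0⟩]
      refine ⟨?_, by rw [hΘv]; exact hne⟩
      -- extend to a map into Tot
      let j : ℂ × ℂ × ℂ → Fam.Tot G := fun w => if hw : G (w.2.1 / w.1) (w.2.2 / w.1) = 0 then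
        ⟨(w.2.1 / w.1, w.2.2 / w.1), hw⟩ else ⟨(v.2.1 / v.1, v.2.2 / v.1), hG0⟩
      have hjv : j v = ⟨(v.2.1 / v.1, v.2.2 / v.1), hG0⟩ := by simp only [j]; rw [dif_pos hG0]
      have hj : ContinuousWithinAt j D.W v := by
        rw [ContinuousWithinAt, tendsto_subtype_rng, hjv]
        have : ContinuousAt (fun w : ℂ × ℂ × ℂ => (w.2.1 / w.1, w.2.2 / w.1)) v := by
          apply ContinuousAt.prodMk
          · exact ContinuousAt.div (by fun_prop) (by fun_prop) h1
          · exact ContinuousAt.div (by fun_prop) (by fun_prop) h1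
        refine (this.tendsto.mono_left nhdsWithin_le_nhds).congr' ?_
        filter_upwards [hev, self_mem_nhdsWithin] with w hw hwW
        simp only [j]; rw [dif_pos (hWG w hwW hw)]
      have hc' : ContinuousAt θ (j v) := by rw [hjv]; exact hc
      have := hc'.comp_continuousWithinAt hj
      refine this.congr_of_eventuallyEq ?_ ?_
      · filter_upwards [hev, self_mem_nhdsWithin] with w hw hwW
        simp only [Θ, j, Function.comp]; rw [dif_pos ⟨hw, hWG w hwW hw⟩, dif_pos (hWG w hwW hw)]
      · rw [Function.comp, hjv, hΘv]
  · choose c hc0 hcl using hlim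
    have hreg' : ∀ i, ∀ s (hs : s ∈ Metric.ball (0 : ℂ) ε), s ≠ 0 →
        ContinuousAt θ ⟨(s, ρ i s), hz i s hs⟩ ∧ θ ⟨(s, ρ i s), hz i s hs⟩ ≠ 0 := by
      intro i s hs hs0
      apply hreg
      rintro ⟨j, hj⟩
      exact hs0 (congrArg (fun q : Fam.Tot G => q.1.1) hj).symm
    -- section map
    let σ : Fin d → ℂ → Fam.Tot G := fun i s => if hs : s ∈ Metric.ball (0 : ℂ) ε then
      ⟨(s, ρ i s), hz i s hs⟩ else p i
    have hσ : ∀ i s (hs : s ∈ Metric.ball (0 : ℂ) ε), σ i s = ⟨(s, ρ i s), hz i s hs⟩ := by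
      intro i s hs; simp only [σ]; rw [dif_pos hs]
    have hσc : ∀ i, ContinuousOn (σ i) (Metric.ball 0 ε) := by
      intro i s hs
      rw [ContinuousWithinAt, tendsto_subtype_rng]
      have : ContinuousWithinAt (fun s => (s, ρ i s)) (Metric.ball 0 ε) s :=
        continuousWithinAt_id.prodMk (h.cont i s hs)
      rw [hσ i s hs]
      refine this.tendsto.congr' ?_
      filter_upwards [self_mem_nhdsWithin] with t ht
      rw [hσ i t ht]
    refine ⟨fun i s => if s = 0 then c i else s ^ (-k i) * θ (σ i s), fun i => ⟨?_, ?_, ?_⟩⟩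
    · intro s hs
      by_cases hs0 : s = 0
      · subst hs0
        apply ContinuousAt.continuousWithinAt
        rw [continuousAt_iff_punctured_nhds]
        beta_reduce
        rw [if_pos rfl]
        have h1 : Tendsto (σ i) (𝓝[≠] 0) (𝓝[≠] (p i)) := by
          rw [tendsto_nhdsWithin_iff]
          constructor
          · have := ((hσc i).continuousAt (Metric.isOpen_ball.mem_nhds h0)).tendsto
            rw [hσ i 0 h0] at this
            exact this.mono_left nhdsWithin_le_nhds
          · filter_upwards [self_mem_nhdsWithin, mem_nhdsWithin_of_mem_nhds (Metric.isOpen_ball.mem_nhds h0)] with t ht ht2 ht3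
            rw [hσ i t ht2] at ht3
            exact ht (congrArg (fun q : Fam.Tot G => q.1.1) ht3)
        refine ((hcl i).comp h1).congr' ?_
        filter_upwards [self_mem_nhdsWithin, mem_nhdsWithin_of_mem_nhds (Metric.isOpen_ball.mem_nhds h0)] with t ht ht2
        rw [if_neg (show t ≠ 0 from ht)]
        simp only [Function.comp]
        rw [hσ i t ht2]
        simp only [Fam.pr, p, sub_zero]
        rw [mul_comm]
      · have h1 : ContinuousAt (fun s => s ^ (-k i) * θ (σ i s)) s := by
          apply ContinuousAt.mul
          · exact continuousAt_zpow₀ _ _ (Or.inl hs0)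
          · apply ContinuousAt.comp
            · rw [hσ i s hs]; exact (hreg' i s hs hs0).1
            · exact (hσc i).continuousAt (Metric.isOpen_ball.mem_nhds hs)
        apply ContinuousAt.continuousWithinAt
        apply h1.congr
        filter_upwards [isOpen_ne.mem_nhds hs0] with t ht
        rw [if_neg ht]
    · intro s hs
      beta_reduce
      split_ifs with hs0
      · exact hc0 i
      · rw [hσ i s hs]
        exact mul_ne_zero (zpow_ne_zero _ hs0) (hreg' i s hs hs0).2
    · intro s hs hs0
      beta_reduce
      rw [if_neg hs0, hσ i s hs, hΘ1 s _ (hz i s hs), ← mul_assoc, ← zpow_add₀ hs0]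
      simp
end CD
end BL
end

section
namespace BL
open Topology Filter Set Complex

theorem transfer {X E Y : Type} [TopologicalSpace X] [TopologicalSpace E] [TopologicalSpace Y]
    {n : ℕ} {p : E → X} {τ : E → E} (hc : Cyc n p τ) (j : Y → X) (N : Set X) (r : N → Y)
    (hr : Continuous r) (hjr : ∀ x, j (r x) = x) (A : Set Y) (hA : ∀ x, r x ∈ A)
    (s : {q : Y × E // j q.1 = p q.2} → ℂ)
    (hs : Frame n (fun q : {q : Y × E // j q.1 = p q.2} => q.1.1)
      (fun q => ⟨(q.1.1, τ q.1.2), by rw [hc.pt]; exact q.2⟩) A 1 s) :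
    ∃ s0, Frame n p τ N 1 s0 := by
  classical
  let g : p ⁻¹' N → {q : Y × E // j q.1 = p q.2} := fun e => ⟨(r ⟨p e.1, e.2⟩, e.1), hjr _⟩
  have hg : Continuous g := by
    have := hc.cp
    apply Continuous.subtype_mk
    apply Continuous.prodMk _ continuous_subtype_val
    exact hr.comp (Continuous.subtype_mk (by fun_prop) _)
  refine ⟨fun e => if he : e ∈ p ⁻¹' N then s (g ⟨e, he⟩) else 0, ?_, ?_, ?_⟩
  · rw [continuousOn_iff_continuous_domRestrict]
    have : (p ⁻¹' N).domRestrict (fun e => if he : e ∈ p ⁻¹' N then s (g ⟨e, he⟩) else 0) = fun e => s (g e) := by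
      ext e
      simp only [domRestrict]
      rw [dif_pos e.2]
    rw [this]
    exact hs.cont.comp_continuous hg (fun e => hA _)
  · intro e he
    rw [dif_pos (show e ∈ p ⁻¹' N from he)]
    exact hs.ne _ (hA _)
  · intro e he
    have he' : τ e ∈ p ⁻¹' N := by rw [mem_preimage, hc.pt]; exact he
    rw [dif_pos (show e ∈ p ⁻¹' N from he), dif_pos he']
    have := hs.eqv (g ⟨e, he⟩) (hA _)
    rw [← this]
    congr 1
    apply Subtype.ext
    simp only [g]
    congr 2
    apply Subtype.ext
    exact hc.pt e

namespace CD
variable {d : ℕ} (D : CD d)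

/-- the region near `y = 0` -/
def Q (ε : ℝ) : Set (ℂ × ℂ × ℂ) := D.W ∩ {v | ‖v.2.1‖ < ε * ‖v.1‖}

theorem Q_ne {ε : ℝ} {v : ℂ × ℂ × ℂ} (h : v ∈ D.Q ε) : v.1 ≠ 0 := by
  intro h0
  have := h.2
  simp only [mem_ofPred_eq, h0, norm_zero, mul_zero] at this
  linarith [norm_nonneg v.2.1]

theorem Q_ball {ε : ℝ} {v : ℂ × ℂ × ℂ} (h : v ∈ D.Q ε) : v.2.1 / v.1 ∈ Metric.ball (0 : ℂ) ε := by
  have h0 := norm_pos_iff.2 (D.Q_ne h)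
  rw [mem_ball_zero_iff, norm_div, div_lt_iff₀ h0]
  exact h.2

theorem W_div {v : ℂ × ℂ × ℂ} (hv : v ∈ D.W) (h1 : v.1 ≠ 0) : D.F 1 (v.2.1 / v.1) (v.2.2 / v.1) = 0 := by
  have := (D.mem_W_smul (inv_ne_zero h1) hv).2
  simp only [Prod.smul_fst, Prod.smul_snd, smul_eq_mul] at this
  rw [inv_mul_cancel₀ h1] at this
  simpa [div_eq_inv_mul] using this

theorem sheet_glue {ε : ℝ} {ρ : Fin d → ℂ → ℂ} (h : LS d (fun s ζ => D.F 1 s ζ) 0 ε ρ)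
    (m : Fin d → ℂ → ℂ) (hm : ∀ i, ContinuousOn (m i) (Metric.ball 0 ε)) :
    ∃ M : ℂ × ℂ × ℂ → ℂ, ContinuousOn M (D.Q ε) ∧
      ∀ i, ∀ v ∈ D.Q ε, v.2.2 / v.1 = ρ i (v.2.1 / v.1) → M v = m i (v.2.1 / v.1) := by
  classical
  have hex : ∀ v : D.Q ε, ∃ i, v.1.2.2 / v.1.1 = ρ i (v.1.2.1 / v.1.1) := fun v =>
    ((h.2.1 _ (D.Q_ball v.2)).zero_iff _).1 (D.W_div v.2.1 (D.Q_ne v.2))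
  choose k hk using hex
  have c1 : Continuous fun v : D.Q ε => v.1.2.1 / v.1.1 :=
    Continuous.div (by fun_prop) (by fun_prop) (fun v => D.Q_ne v.2)
  have c2 : Continuous fun v : D.Q ε => v.1.2.2 / v.1.1 :=
    Continuous.div (by fun_prop) (by fun_prop) (fun v => D.Q_ne v.2)
  have huniq : ∀ (v : D.Q ε) i, v.1.2.2 / v.1.1 = ρ i (v.1.2.1 / v.1.1) → k v = i := fun v i hi =>
    h.2.2 _ (D.Q_ball v.2) ((hk v).symm.trans hi)
  have hkc : Continuous k := by
    apply continuous_fin_of_closed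
    intro j
    have : k ⁻¹' {j} = {v | v.1.2.2 / v.1.1 = ρ j (v.1.2.1 / v.1.1)} := by
      ext v
      constructor
      · rintro rfl; exact hk v
      · intro hv; exact huniq v j hv
    rw [this]
    exact isClosed_eq c2 ((h.cont j).comp_continuous c1 (fun v => D.Q_ball v.2))
  refine ⟨fun v => if hv : v ∈ D.Q ε then m (k ⟨v, hv⟩) (v.2.1 / v.1) else 0, ?_, ?_⟩
  · rw [continuousOn_iff_continuous_domRestrict]
    have : (D.Q ε).domRestrict (fun v => if hv : v ∈ D.Q ε then m (k ⟨v, hv⟩) (v.2.1 / v.1) else 0)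
        = fun v : D.Q ε => m (k v) (v.1.2.1 / v.1.1) := by
      ext v
      simp only [domRestrict]
      rw [dif_pos v.2]
    rw [this, continuous_iff_continuousAt]
    intro v
    have hc : Continuous fun w : D.Q ε => m (k v) (w.1.2.1 / w.1.1) :=
      (hm (k v)).comp_continuous c1 (fun v => D.Q_ball v.2)
    apply hc.continuousAt.congr
    have : ∀ᶠ w in 𝓝 v, k w = k v :=
      hkc.continuousAt ((isOpen_discrete {k v}).mem_nhds (mem_singleton _))
    filter_upwards [this] with w hw
    rw [hw]
  · intro i v hv hi
    beta_reduce
    rw [dif_pos hv, huniq ⟨v, hv⟩ i hi]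

/-- the scaling flow on `W` -/
def act (ζ : ℂ) (v : D.W) : D.W := ⟨exp ζ • v.1, D.mem_W_smul (exp_ne_zero ζ) v.2⟩

theorem act_isAct : Act D.act := by
  refine ⟨?_, fun x => ?_, fun ζ ζ' x => ?_, fun x => ?_⟩
  · apply Continuous.subtype_mk
    fun_prop
  · apply Subtype.ext; simp [act]
  · apply Subtype.ext; simp [act, exp_add, mul_smul]
  · apply Subtype.ext; simp [act, exp_two_pi_mul_I]

section frames
variable {E : Type} [TopologicalSpace E] {n : ℕ} {p : E → D.W} {τ : E → E}

theorem frameY (hc : Cyc n p τ) {Φ : ℂ → E → E} {a : E → ℕ} (hF : Flow n p τ D.act Φ a) (R : ℝ) :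
    ∃ s, Frame n p τ {v : D.W | v.1.2.1 ≠ 0 ∧ ‖v.1.1‖ ≤ R * ‖v.1.2.1‖} 1 s ∧
      ∀ ζ e, p e ∈ {v : D.W | v.1.2.1 ≠ 0 ∧ ‖v.1.1‖ ≤ R * ‖v.1.2.1‖} →
        s (Φ ζ e) = exp (a e * ζ / n) * s e := by
  set G : ℂ → ℂ → ℂ := fun t ζ => D.F t 1 ζ with hG
  let j : Fam.Tot G → D.W := fun q => ⟨(q.1.1, 1, q.1.2), (D.W_iff _ _ _).2 ⟨Or.inr one_ne_zero, q.2⟩⟩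
  have hj : Continuous j := by apply Continuous.subtype_mk; fun_prop
  obtain ⟨s, hs⟩ := sweep (hc.pullback j hj) (Fam.pr_cont (G := G)) D.famY.pr_fin D.famY.pr_closed D.By
    D.By_fin D.covY R
  set N := {v : D.W | v.1.2.1 ≠ 0 ∧ ‖v.1.1‖ ≤ R * ‖v.1.2.1‖} with hN
  have hmem : ∀ x : ↥(N ∩ {v : D.W | v.1.2.1 = 1}), G x.1.1.1 x.1.1.2.2 = 0 := by
    intro x
    have := x.1.2.2
    rw [show x.1.1.2.1 = 1 from x.2.2] at this
    exact this
  let r : ↥(N ∩ {v : D.W | v.1.2.1 = 1}) → Fam.Tot G := fun x => ⟨(x.1.1.1, x.1.1.2.2), hmem x⟩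
  obtain ⟨s0, hs0⟩ := transfer hc j (N ∩ {v : D.W | v.1.2.1 = 1}) r (by
      apply Continuous.subtype_mk; fun_prop) (by
      intro x
      apply Subtype.ext
      exact Prod.ext rfl (Prod.ext (show (1:ℂ) = x.1.1.2.1 from (show x.1.1.2.1 = 1 from x.2.2).symm) rfl)) _ (by
      intro x
      have h1 : ‖x.1.1.1‖ ≤ R * ‖x.1.1.2.1‖ := x.2.1.2
      rw [show x.1.1.2.1 = 1 from x.2.2] at h1
      simp only [norm_one, mul_one] at h1
      change x.1.1.1 ∈ Icc (-R) R ×ℂ Icc (-R) R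
      rw [Complex.mem_reProdIm]
      constructor
      · exact abs_le.1 ((Complex.abs_re_le_norm _).trans h1)
      · exact abs_le.1 ((Complex.abs_im_le_norm _).trans h1)) s hs
  apply flow_extend hc hF (fun v => v.1.2.1) (by fun_prop) (fun ζ x => by simp [act]) N _ (fun x hx => hx.1) s0 hs0
  intro ζ x hx
  refine ⟨?_, ?_⟩
  · simp only [act, Prod.smul_snd, Prod.smul_fst, smul_eq_mul]
    exact mul_ne_zero (exp_ne_zero _) hx.1
  · simp only [act, Prod.smul_snd, Prod.smul_fst, smul_eq_mul, norm_mul]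
    have := hx.2
    nlinarith [norm_nonneg (exp ζ)]

theorem frameX (hc : Cyc n p τ) {Φ : ℂ → E → E} {a : E → ℕ} (hF : Flow n p τ D.act Φ a) :
    ∃ δ > 0, ∀ ε : ℝ, 0 < ε → ε < δ → ∃ s, Frame n p τ {v : D.W | ‖v.1.2.1‖ ≤ ε * ‖v.1.1‖} 1 s ∧
      ∀ ζ e, p e ∈ {v : D.W | ‖v.1.2.1‖ ≤ ε * ‖v.1.1‖} →
        s (Φ ζ e) = exp (a e * ζ / n) * s e := by
  set G : ℂ → ℂ → ℂ := fun t ζ => D.F 1 t ζ with hG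
  let j : Fam.Tot G → D.W := fun q => ⟨(1, q.1.1, q.1.2), (D.W_iff _ _ _).2 ⟨Or.inl one_ne_zero, q.2⟩⟩
  have hj : Continuous j := by apply Continuous.subtype_mk; fun_prop
  obtain ⟨O, hO, σ, hσ, hσ'⟩ := good_local (hc.pullback j hj) D.famX.pr_fin D.famX.pr_closed 0
  obtain ⟨s, hs⟩ := frame_of_section (hc.pullback j hj) _ σ hσ hσ'
  obtain ⟨δ, hδ, hb⟩ := Metric.mem_nhds_iff.1 hO
  refine ⟨δ, hδ, fun ε hε hεδ => ?_⟩
  set N := {v : D.W | ‖v.1.2.1‖ ≤ ε * ‖v.1.1‖} with hN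
  have hmem : ∀ x : ↥(N ∩ {v : D.W | v.1.1 = 1}), G x.1.1.2.1 x.1.1.2.2 = 0 := by
    intro x
    have := x.1.2.2
    rw [show x.1.1.1 = 1 from x.2.2] at this
    exact this
  let r : ↥(N ∩ {v : D.W | v.1.1 = 1}) → Fam.Tot G := fun x => ⟨(x.1.1.2.1, x.1.1.2.2), hmem x⟩
  obtain ⟨s0, hs0⟩ := transfer hc j (N ∩ {v : D.W | v.1.1 = 1}) r (by
      apply Continuous.subtype_mk; fun_prop) (by
      intro x
      apply Subtype.ext
      exact Prod.ext (show (1:ℂ) = x.1.1.1 from (show x.1.1.1 = 1 from x.2.2).symm) rfl) _ (by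
      intro x
      have h1 : ‖x.1.1.2.1‖ ≤ ε * ‖x.1.1.1‖ := x.2.1
      rw [show x.1.1.1 = 1 from x.2.2] at h1
      simp only [norm_one, mul_one] at h1
      apply hb
      rw [mem_ball_zero_iff]
      exact h1.trans_lt hεδ) s hs
  apply flow_extend hc hF (fun v => v.1.1) (by fun_prop) (fun ζ x => by simp [act]) N _ _ s0 hs0
  · intro ζ x hx
    have := show ‖x.1.2.1‖ ≤ ε * ‖x.1.1‖ from hx
    change ‖(exp ζ • x.1).2.1‖ ≤ ε * ‖(exp ζ • x.1).1‖
    simp only [Prod.smul_snd, Prod.smul_fst, smul_eq_mul, norm_mul]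
    nlinarith [norm_nonneg (exp ζ)]
  · intro x hx h0
    have := show ‖x.1.2.1‖ ≤ ε * ‖x.1.1‖ from hx
    rw [h0, norm_zero, mul_zero] at this
    have h2 := norm_le_zero_iff.1 this
    have := (D.W_iff x.1.1 x.1.2.1 x.1.2.2).1 x.2
    rcases this.1 with h | h
    · exact h h0
    · exact h h2
end frames
end CD
end BL
end

section
namespace BL
open Topology Filter Set Complex
namespace CD
variable {d : ℕ} (D : CD d)

theorem PW : P D.W d := by
  intro n E _ p τ hc
  obtain ⟨Φ, a, hF⟩ := exists_flow hc D.act_isAct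
  obtain ⟨ε0, hε0, ρ, hls⟩ := D.lsX 0 D.B0
  obtain ⟨δ, hδ, hX⟩ := D.frameX hc hF
  obtain ⟨ε, hε, hεm⟩ := exists_between (lt_min hε0 hδ)
  have hεε0 : ε < ε0 := hεm.trans_le (min_le_left _ _)
  obtain ⟨t, ht, htΦ⟩ := hX ε hε (hεm.trans_le (min_le_right _ _))
  obtain ⟨s, hs, hsΦ⟩ := D.frameY hc hF ε⁻¹
  set NX := {v : D.W | ‖v.1.2.1‖ ≤ ε * ‖v.1.1‖} with hNX
  set NY := {v : D.W | v.1.2.1 ≠ 0 ∧ ‖v.1.1‖ ≤ ε⁻¹ * ‖v.1.2.1‖} with hNY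
  have hNYi : ∀ v : D.W, v ∈ NY ↔ ε * ‖v.1.1‖ ≤ ‖v.1.2.1‖ := by
    intro v
    rw [hNY, mem_ofPred_eq, ← div_eq_inv_mul, le_div_iff₀ hε, mul_comm]
    refine ⟨fun h => h.2, fun h => ⟨fun h0 => ?_, h⟩⟩
    rw [h0, norm_zero] at h
    have h1 : v.1.1 = 0 := by
      rw [← norm_eq_zero]
      exact le_antisymm (nonpos_of_mul_nonpos_right h hε) (norm_nonneg _)
    have := (D.W_iff v.1.1 v.1.2.1 v.1.2.2).1 v.2
    rcases this.1 with h | h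
    · exact h h1
    · exact h h0
  have hx0 : ∀ v : D.W, v ∈ NX → v.1 ∈ D.Q ε0 := by
    intro v hv
    have hv' : ‖v.1.2.1‖ ≤ ε * ‖v.1.1‖ := hv
    refine ⟨v.2, ?_⟩
    have h0 : v.1.1 ≠ 0 := by
      intro h0
      rw [h0, norm_zero, mul_zero] at hv'
      have := (D.W_iff v.1.1 v.1.2.1 v.1.2.2).1 v.2
      rcases this.1 with h | h
      · exact h h0
      · exact h (norm_le_zero_iff.1 hv')
    have : 0 < ‖v.1.1‖ := norm_pos_iff.2 h0
    change ‖v.1.2.1‖ < ε0 * ‖v.1.1‖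
    nlinarith
  obtain ⟨g, hgc, hg0, hg⟩ := frame_ratio hc (hs.mono (inter_subset_left : NY ∩ NX ⊆ NY))
    (ht.mono (inter_subset_right : NY ∩ NX ⊆ NX))
  -- invariance
  have hactX : ∀ ζ, ∀ v ∈ NX, D.act ζ v ∈ NX := by
    intro ζ v hv
    have := show ‖v.1.2.1‖ ≤ ε * ‖v.1.1‖ from hv
    change ‖(exp ζ • v.1).2.1‖ ≤ ε * ‖(exp ζ • v.1).1‖
    simp only [Prod.smul_snd, Prod.smul_fst, smul_eq_mul, norm_mul]
    nlinarith [norm_nonneg (exp ζ)]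
  have hactY : ∀ ζ, ∀ v ∈ NY, D.act ζ v ∈ NY := by
    intro ζ v hv
    rw [hNYi] at hv ⊢
    simp only [act, Prod.smul_snd, Prod.smul_fst, smul_eq_mul, norm_mul]
    nlinarith [norm_nonneg (exp ζ)]
  have hsurj : ∀ x, ∃ e, p e = x := fun x => by
    obtain ⟨N, hN, σ, -, h⟩ := hc.sec x
    exact ⟨σ x, h x (mem_of_mem_nhds hN)⟩
  have hginv : ∀ ζ, ∀ v ∈ NY ∩ NX, g (D.act ζ v) = g v := by
    intro ζ v hv
    obtain ⟨e, rfl⟩ := hsurj v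
    have h1 := hg e hv
    have hm : p (Φ ζ e) ∈ NY ∩ NX := by rw [hF.lift]; exact ⟨hactY _ _ hv.1, hactX _ _ hv.2⟩
    have h2 := hg (Φ ζ e) hm
    rw [hF.lift, hsΦ ζ e hv.1, htΦ ζ e hv.2, h1] at h2
    have h3 := ht.ne e hv.2
    have h4 := exp_ne_zero (a e * ζ / n)
    have h5 : (exp (a e * ζ / n) * t e) * (g (p e) - g (D.act ζ (p e))) = 0 := by
      linear_combination h2
    rcases mul_eq_zero.1 h5 with h | h
    · exact absurd h (mul_ne_zero h4 h3)
    · exact (sub_eq_zero.1 h).symm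
  -- points on the circle
  have hcb : ∀ z : ℂ, ‖z‖ = ε → z ∈ Metric.ball (0 : ℂ) ε0 := fun z hz => by
    rw [mem_ball_zero_iff, hz]; exact hεε0
  have hpt : ∀ i, ∀ z : ℂ, z ∈ Metric.ball (0 : ℂ) ε0 → ((1 : ℂ), z, ρ i z) ∈ D.W := fun i z hz =>
    (D.W_iff _ _ _).2 ⟨Or.inl one_ne_zero, ((hls.2.1 z hz).zero_iff _).2 ⟨i, rfl⟩⟩
  have hptN : ∀ i, ∀ z (hz : ‖z‖ = ε), (⟨(1, z, ρ i z), hpt i z (hcb z hz)⟩ : D.W) ∈ NY ∩ NX := by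
    intro i z hz
    refine ⟨(hNYi _).2 ?_, ?_⟩
    · simp [hz]
    · change ‖z‖ ≤ ε * ‖(1 : ℂ)‖
      simp [hz]
  classical
  have hcirc : ∀ i, ∃ (w : ℤ) (h : ℂ → ℂ), Continuous h ∧ ∀ z (hz : ‖z‖ = ε),
      g ⟨(1, z, ρ i z), hpt i z (hcb z hz)⟩ = z ^ w * exp (h z) := by
    intro i
    let γ : {z : ℂ | ‖z‖ = ε} → ↥(NY ∩ NX) := fun z => ⟨⟨(1, z.1, ρ i z.1), hpt i z.1 (hcb z.1 z.2)⟩, hptN i z.1 z.2⟩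
    have hγ : Continuous γ := by
      apply Continuous.subtype_mk
      apply Continuous.subtype_mk
      apply Continuous.prodMk continuous_const
      apply Continuous.prodMk continuous_subtype_val
      exact (hls.cont i).comp_continuous continuous_subtype_val (fun z => hcb z.1 z.2)
    let G : ℂ → ℂ := fun z => if hz : z ∈ {z : ℂ | ‖z‖ = ε} then g (γ ⟨z, hz⟩).1 else 1
    have hG : ∀ z (hz : ‖z‖ = ε), G z = g ⟨(1, z, ρ i z), hpt i z (hcb z hz)⟩ := by
      intro z hz; simp only [G]; rw [dif_pos (show z ∈ {z : ℂ | ‖z‖ = ε} from hz)]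
    obtain ⟨w, h, hh, hw⟩ := circle_degree G ε hε (by
      rw [continuousOn_iff_continuous_domRestrict]
      have : {z : ℂ | ‖z‖ = ε}.domRestrict G = fun z => g (γ z).1 := by
        ext z
        simp only [domRestrict, G]
        rw [dif_pos z.2]
      rw [this]
      exact hgc.comp_continuous (continuous_subtype_val.comp hγ) (fun z => (γ z).2)) (by
      intro z hz
      rw [hG z hz]
      exact hg0 _ (hptN i z hz))
    exact ⟨w, h, hh, fun z hz => by rw [← hG z hz]; exact hw z hz⟩
  choose w h hhc hgw using hcirc
  set wt : ℤ := ∑ i, w i with hwt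
  obtain ⟨θ, hθh, hθ, e, he⟩ := D.theta hε0 hls (fun i => wt - d * w i) (by
    rw [Finset.sum_sub_distrib, ← Finset.mul_sum]
    simp [hwt])
  obtain ⟨M, hM, hMi⟩ := D.sheet_glue hls (fun i z => e i z * exp (d * h i z)) (fun i =>
    (he i).1.mul ((continuous_exp.comp (continuous_const.mul (hhc i))).continuousOn))
  have hidx : ∀ v ∈ D.Q ε0, ∃ i, v.2.2 / v.1 = ρ i (v.2.1 / v.1) := fun v hv =>
    ((hls.2.1 _ (D.Q_ball hv)).zero_iff _).1 (D.W_div hv.1 (D.Q_ne hv))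
  let s1 : E → ℂ := fun e => s e ^ d * (p e).1.2.1 ^ (-wt) * θ (p e).1
  let s2 : E → ℂ := fun e => t e ^ d * (p e).1.1 ^ (-wt) * M (p e).1
  have heq : ∀ e, p e ∈ NY → p e ∈ NX → s1 e = s2 e := by
    intro e' hy hx
    have hQ := hx0 _ hx
    have hx1 := D.Q_ne hQ
    have hy1 := hy.1
    obtain ⟨i, hi⟩ := hidx _ hQ
    set z := (p e').1.2.1 / (p e').1.1 with hz
    have hzb : z ∈ Metric.ball (0 : ℂ) ε0 := D.Q_ball hQ
    have hz0 : z ≠ 0 := div_ne_zero hy1 hx1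
    have hzn : ‖z‖ = ε := by
      rw [hz, norm_div, div_eq_iff (norm_ne_zero_iff.2 hx1)]
      exact le_antisymm hx ((hNYi _).1 hy)
    obtain ⟨ζ, hζ⟩ : ∃ ζ, exp ζ = ((p e').1.1)⁻¹ := ⟨_, exp_log (inv_ne_zero hx1)⟩
    have hpe : exp ζ • (p e').1 = (1, z, ρ i z) := by
      rw [hζ, ← hi, hz]
      refine Prod.ext ?_ (Prod.ext ?_ ?_)
      · simp [hx1]
      · simp [div_eq_inv_mul]
      · simp [div_eq_inv_mul]
    have hg1 : g (p e') = z ^ w i * exp (h i z) := by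
      rw [← hginv ζ _ ⟨hy, hx⟩, ← hgw i z hzn]
      congr 1
      exact Subtype.ext hpe
    have hθ1 : θ (p e').1 = z ^ (wt - d * w i) * e i z := by
      rw [← hθh (exp ζ) _ (exp_ne_zero _), hpe]
      exact (he i).2.2 z hzb hz0
    have hse := hg e' ⟨hy, hx⟩
    have hMe := hMi i _ hQ hi
    simp only [s1, s2]
    rw [hse, hg1, hθ1, hMe, ← hz]
    have hyz : (p e').1.2.1 = z * (p e').1.1 := by rw [hz]; field_simp
    rw [hyz, mul_zpow, mul_pow, mul_pow, ← exp_nat_mul, zpow_sub₀ hz0, ← zpow_natCast (z ^ w i) d, ← zpow_mul, zpow_neg z wt,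
      mul_comm (w i) (d : ℤ)]
    have a1 := zpow_ne_zero wt hz0
    have a2 := zpow_ne_zero (d * w i) hz0
    field_simp
  have hcov : ∀ v, v ∈ NY ∨ v ∈ NX := fun v => by
    rw [hNYi]; exact le_total _ _
  have hYcl : IsClosed (p ⁻¹' NY) := by
    have : NY = {v : D.W | ε * ‖v.1.1‖ ≤ ‖v.1.2.1‖} := by ext v; exact hNYi v
    rw [this]
    exact (isClosed_le (by fun_prop) (by fun_prop)).preimage hc.cp
  have hXcl : IsClosed (p ⁻¹' NX) :=
    IsClosed.preimage hc.cp (isClosed_le (by fun_prop) (by fun_prop))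
  have hcp := hc.cp
  have c1 : ContinuousOn s1 (p ⁻¹' NY) := by
    refine ((hs.cont.pow d).mul (ContinuousOn.zpow₀ (by fun_prop) _ (fun e he => Or.inl he.1))).mul ?_
    intro e he
    have := (hθ _ (p e).2 he.1).1
    exact ContinuousWithinAt.comp (t := D.W) this (by fun_prop) (fun e _ => (p e).2)
  have c2 : ContinuousOn s2 (p ⁻¹' NX) := by
    refine ((ht.cont.pow d).mul (ContinuousOn.zpow₀ (by fun_prop) _ (fun e he => Or.inl (D.Q_ne (hx0 _ he))))).mul ?_
    exact hM.comp (by fun_prop) (fun e he => hx0 _ he)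
  let S : E → ℂ := fun e => if p e ∈ NY then s1 e else s2 e
  have SY : ∀ e, p e ∈ NY → S e = s1 e := fun e he => if_pos he
  have SX : ∀ e, p e ∈ NX → S e = s2 e := by
    intro e he
    by_cases hy : p e ∈ NY
    · rw [SY e hy, heq e hy he]
    · exact if_neg hy
  refine ⟨S, ?_, fun e' => ⟨?_, ?_⟩⟩
  · rw [← continuousOn_univ]
    have hu : (univ : Set E) = p ⁻¹' NY ∪ p ⁻¹' NX := by
      ext e; simpa using hcov (p e)
    rw [hu]
    exact ContinuousOn.union_of_isClosed (c1.congr SY) (c2.congr SX) hYcl hXcl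
  · rcases hcov (p e') with hy | hx
    · rw [SY e' hy]
      exact mul_ne_zero (mul_ne_zero (pow_ne_zero _ (hs.ne e' hy)) (zpow_ne_zero _ hy.1)) (hθ _ (p e').2 hy.1).2
    · rw [SX e' hx]
      have hQ := hx0 _ hx
      obtain ⟨i, hi⟩ := hidx _ hQ
      refine mul_ne_zero (mul_ne_zero (pow_ne_zero _ (ht.ne e' hx)) (zpow_ne_zero _ (D.Q_ne hQ))) ?_
      rw [hMi i _ hQ hi]
      exact mul_ne_zero ((he i).2.1 _ (D.Q_ball hQ)) (exp_ne_zero _)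
  · rcases hcov (p e') with hy | hx
    · rw [SY e' hy, SY (τ e') (by rw [hc.pt]; exact hy)]
      simp only [s1]
      rw [hs.eqv e' hy, hc.pt]
      ring
    · rw [SX e' hx, SX (τ e') (by rw [hc.pt]; exact hx)]
      simp only [s2]
      rw [ht.eqv e' hx, hc.pt]
      ring
end CD
end BL
end

section
namespace BL
open Topology Filter Set Complex
namespace CD
variable {d : ℕ} (D : CD d)

/-- the loop parameter -/
def ee (t : unitInterval) : ℂ := exp (2 * Real.pi * I * (t : ℝ))

theorem ee_cont : Continuous ee := by unfold ee; fun_prop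
theorem ee_ne (t : unitInterval) : ee t ≠ 0 := exp_ne_zero _
theorem ee_zero : ee 0 = 1 := by simp [ee]
theorem ee_one : ee 1 = 1 := by simp [ee, exp_two_pi_mul_I]

theorem hopf (S : ℂ × ℂ × ℂ → ℂ) (hS : ContinuousOn S D.W) (h0 : ∀ v ∈ D.W, S v ≠ 0) (r0 : ℂ)
    (hr0 : ((1 : ℂ), (0 : ℂ), r0) ∈ D.W) :
    ∃ L : unitInterval → ℂ, Continuous L ∧ (∀ t, exp (L t) = S (ee t • (1, 0, r0)) / S (1, 0, r0)) ∧
      L 0 = 0 ∧ L 1 = 0 := by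
  let A := {q : ℂ × ℂ | q.1 ∉ D.B ∧ D.F 1 q.1 q.2 = 0}
  have hA : PreconnectedSpace A := Subtype.preconnectedSpace D.conn
  have hAW : ∀ q : A, ((1 : ℂ), q.1.1, q.1.2) ∈ D.W := fun q =>
    (D.W_iff _ _ _).2 ⟨Or.inl one_ne_zero, q.2.2⟩
  let G : unitInterval × A → ℂ := fun u => S (ee u.1 • (1, u.2.1.1, u.2.1.2)) / S (1, u.2.1.1, u.2.1.2)
  have ecc := ee_cont
  have hG : Continuous G := by
    apply Continuous.div
    · apply hS.comp_continuous (by fun_prop)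
      intro u; exact D.mem_W_smul (ee_ne _) (hAW _)
    · apply hS.comp_continuous (by fun_prop)
      intro u; exact hAW _
    · intro u; exact h0 _ (hAW _)
  obtain ⟨L, hL, hLe, hL0⟩ := log_homotopy G hG (fun u => div_ne_zero (h0 _ (D.mem_W_smul (ee_ne _) (hAW _)))
    (h0 _ (hAW _))) (fun _ => 0) continuous_const (fun a => by
      simp only [G, ee_zero, one_smul, exp_zero]
      rw [div_self (h0 _ (hAW _))])
  have hconst : ∀ a b : A, L (1, a) = L (1, b) := by
    apply const_of_exp_one (fun a => L (1, a)) (by fun_prop)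
    intro a
    rw [hLe]
    simp only [G, ee_one, one_smul]
    rw [div_self (h0 _ (hAW _))]
  obtain ⟨N, hN, hNr⟩ := D.norm_cont S hS
  have hNne : ∀ v : ℂ × ℂ, v ≠ 0 → N v ≠ 0 := by
    intro v hv
    obtain ⟨r, hr⟩ := D.roots v.1 v.2
    have := hNr v.1 v.2 r hr
    rw [show (v.1, v.2) = v from rfl] at this
    rw [this, Finset.prod_ne_zero_iff]
    intro i _
    apply h0
    rw [D.W_iff]
    refine ⟨?_, (hr.zero_iff _).2 ⟨i, rfl⟩⟩
    by_contra! h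
    exact hv (Prod.ext h.1 h.2)
  have hv : ∀ (t β : unitInterval), (ee t * (1 - ((β : ℝ) : ℂ)), ((β : ℝ) : ℂ)) ≠ (0 : ℂ × ℂ) := by
    intro t β h
    have h2 : ((β : ℝ) : ℂ) = 0 := congrArg Prod.snd h
    have h1 : ee t * (1 - ((β : ℝ) : ℂ)) = 0 := congrArg Prod.fst h
    rw [h2, sub_zero, mul_one] at h1
    exact ee_ne t h1
  let G' : unitInterval × unitInterval → ℂ := fun u =>
    N (ee u.1 * (1 - ((u.2 : ℝ) : ℂ)), ((u.2 : ℝ) : ℂ)) / N (ee 0 * (1 - ((u.2 : ℝ) : ℂ)), ((u.2 : ℝ) : ℂ))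
  have hG' : Continuous G' := by
    apply Continuous.div
    · exact hN.comp_continuous (by fun_prop) (fun u => hv _ _)
    · exact hN.comp_continuous (by fun_prop) (fun u => hv _ _)
    · intro u; exact hNne _ (hv _ _)
  obtain ⟨L', hL', hLe', hL0'⟩ := log_homotopy G' hG' (fun u => div_ne_zero (hNne _ (hv _ _)) (hNne _ (hv _ _)))
    (fun _ => 0) continuous_const (fun a => by
      simp only [G', exp_zero]
      rw [div_self (hNne _ (hv _ _))])
  have hconst' : ∀ a b : unitInterval, L' (1, a) = L' (1, b) := by
    apply const_of_exp_one (fun a => L' (1, a)) (by fun_prop)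
    intro a
    rw [hLe']
    simp only [G', ee_one, ee_zero]
    rw [div_self]
    have := hNne _ (hv 0 a)
    rwa [ee_zero] at this
  have h11 : L' (1, 1) = 0 := by
    rw [← hL0' 1]
    apply const_of_exp_one (fun t => L' (t, 1)) (by fun_prop)
    intro t
    rw [hLe']
    simp only [G']
    have := hNne _ (hv 0 1)
    simp at this ⊢
    exact this
  have h10 : L' (1, 0) = 0 := by rw [hconst' 0 1, h11]
  -- compare
  obtain ⟨r, hr⟩ := D.roots 1 0
  let a : Fin d → A := fun i => ⟨(0, r i), D.B0, (hr.zero_iff _).2 ⟨i, rfl⟩⟩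
  have hr' : ∀ t, RT (D.F (ee t) 0) (fun i => ee t * r i) := by
    intro t z
    have h1 := D.hom (ee t) 1 0 ((ee t)⁻¹ * z)
    rw [mul_one, mul_zero, mul_inv_cancel_left₀ (ee_ne t), hr] at h1
    have hp : ee t ^ d = ∏ _i : Fin d, ee t := by simp
    rw [h1, hp, ← Finset.prod_mul_distrib]
    apply Finset.prod_congr rfl
    intro i _
    rw [mul_sub, mul_inv_cancel_left₀ (ee_ne t)]
  have hGG : ∀ t, G' (t, 0) = ∏ i, G (t, a i) := by
    intro t
    simp only [G', G, a]
    have e1 := hNr _ _ _ (hr' t)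
    have e2 := hNr _ _ _ (hr' 0)
    simp only [Icc.coe_zero, ofReal_zero, sub_zero, mul_one]
    rw [e1, e2, ← Finset.prod_div_distrib]
    apply Finset.prod_congr rfl
    intro i _
    simp [ee_zero]
  have hsum : L' (1, 0) - (∑ i, L (1, a i)) = L' (0, 0) - ∑ i, L (0, a i) := by
    apply log_unique (fun t => L' (t, 0)) (fun t => ∑ i, L (t, a i)) (by fun_prop)
      (by fun_prop)
    intro t
    rw [exp_sum, hLe', hGG]
    apply Finset.prod_congr rfl
    intro i _
    rw [hLe]
  let a0 : A := ⟨(0, r0), D.B0, ((D.W_iff _ _ _).1 hr0).2⟩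
  have hz : L (1, a0) = 0 := by
    simp only [hL0', hL0, h10, Finset.sum_const_zero, sub_zero, zero_sub] at hsum
    rw [Finset.sum_congr rfl (fun i _ => hconst (a i) a0)] at hsum
    simp only [Finset.sum_const, Finset.card_univ, Fintype.card_fin, nsmul_eq_mul, neg_eq_zero] at hsum
    rcases mul_eq_zero.1 hsum with h | h
    · exact absurd h (by exact_mod_cast D.dpos.ne')
    · exact h
  exact ⟨fun t => L (t, a0), by fun_prop, fun t => hLe _, hL0 _, hz⟩
end CD
end BL
end

section
namespace BL
open Topology Filter Set Complex

theorem local_root {X : Type} [TopologicalSpace X] (d : ℕ) (hd : 0 < d) (A : Set X) (hA : IsOpen A)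
    (u : X → ℂ) (hu : ContinuousOn u A) (h0 : ∀ x ∈ A, u x ≠ 0) (x0 : X) (hx0 : x0 ∈ A) :
    ∃ N ∈ 𝓝 x0, N ⊆ A ∧ ∃ α : X → ℂ, ContinuousOn α N ∧ ∀ x ∈ N, α x ^ d = u x := by
  have hd' : (d : ℂ) ≠ 0 := by exact_mod_cast hd.ne'
  obtain ⟨c, hc⟩ := IsAlgClosed.exists_pow_nat_eq (u x0) hd
  have hq : ContinuousOn (fun x => u x / u x0) A := hu.div_const _
  refine ⟨A ∩ (fun x => u x / u x0) ⁻¹' slitPlane,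
    (hq.isOpen_inter_preimage hA isOpen_slitPlane).mem_nhds ⟨hx0, ?_⟩, inter_subset_left,
    fun x => c * exp (log (u x / u x0) / d), ?_, ?_⟩
  · simp [div_self (h0 x0 hx0)]
  · refine continuousOn_const.mul (ContinuousOn.cexp (ContinuousOn.div_const ?_ _))
    exact (hq.mono inter_subset_left).clog (fun x hx => hx.2)
  · intro x hx
    rw [mul_pow, hc, ← exp_nat_mul, mul_div_cancel₀ _ hd', exp_log, mul_div_cancel₀ _ (h0 x0 hx0)]
    exact div_ne_zero (h0 x hx.1) (h0 x0 hx0)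

section glueCyc
variable {X : Type} [TopologicalSpace X] [T2Space X] (d : ℕ) (A B : Set X) (u w κ κ' : X → ℂ)

def GE : Set (X × ℂ × ℂ) := {q | (q.1 ∈ A → q.2.1 ^ d = u q.1 ∧ q.2.2 = κ q.1 * q.2.1) ∧
  (q.1 ∈ B → q.2.2 ^ d = w q.1 ∧ q.2.1 = κ' q.1 * q.2.2)}

theorem root_rel (hd : 0 < d) {a b : ℂ} (ha : a ≠ 0) (h : a ^ d = b ^ d) : ∃ k, om d ^ k * a = b := by
  have : NeZero d := ⟨hd.ne'⟩
  obtain ⟨k, -, hk⟩ := (om_prim d hd).eq_pow_of_pow_eq_one (ξ := b / a)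
    (by rw [div_pow, ← h, div_self (pow_ne_zero _ ha)])
  exact ⟨k, by rw [hk, div_mul_cancel₀ _ ha]⟩

def gτ (hd : 0 < d) (e : GE d A B u w κ κ') : GE d A B u w κ κ' :=
  ⟨(e.1.1, om d * e.1.2.1, om d * e.1.2.2), by
    obtain ⟨h1, h2⟩ := e.2
    refine ⟨fun h => ?_, fun h => ?_⟩
    · obtain ⟨h3, h4⟩ := h1 h
      simp only [mul_pow, om_pow d hd, one_mul]
      exact ⟨h3, by rw [h4]; ring⟩
    · obtain ⟨h3, h4⟩ := h2 h
      simp only [mul_pow, om_pow d hd, one_mul]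
      exact ⟨h3, by rw [h4]; ring⟩⟩

theorem gτ_it (hd : 0 < d) (k : ℕ) (e : GE d A B u w κ κ') :
    ((gτ d A B u w κ κ' hd)^[k] e).1 = (e.1.1, om d ^ k * e.1.2.1, om d ^ k * e.1.2.2) := by
  induction k with
  | zero => simp
  | succ k ih =>
    rw [Function.iterate_succ_apply']
    simp only [gτ, ih, pow_succ']
    simp [mul_assoc]

theorem glueCyc (hd : 0 < d) (hA : IsOpen A) (hB : IsOpen B) (hAB : ∀ x, x ∈ A ∨ x ∈ B)
    (hu : ContinuousOn u A) (hw : ContinuousOn w B) (hκ : ContinuousOn κ A)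
    (hκ' : ContinuousOn κ' B) (hu0 : ∀ x ∈ A, u x ≠ 0) (hw0 : ∀ x ∈ B, w x ≠ 0)
    (h1 : ∀ x ∈ A, x ∈ B → w x = κ x ^ d * u x ∧ κ x * κ' x = 1) :
    Cyc d (fun e : GE d A B u w κ κ' => e.1.1) (gτ d A B u w κ κ' hd) := by
  have h2 : ∀ x ∈ A, x ∈ B → u x = κ' x ^ d * w x := by
    intro x hx hx'
    obtain ⟨h3, h4⟩ := h1 x hx hx'
    rw [h3, ← mul_assoc, ← mul_pow, mul_comm (κ' x), h4, one_pow, one_mul]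
  have key : ∀ (x0 : X) (N : Set X), N ∈ 𝓝 x0 → ∀ α β : X → ℂ, ContinuousOn α N → ContinuousOn β N →
      (∀ x ∈ N, (x, α x, β x) ∈ GE d A B u w κ κ') → ∃ N ∈ 𝓝 x0, ∃ σ : X → GE d A B u w κ κ',
      ContinuousOn σ N ∧ ∀ y ∈ N, (σ y).1.1 = y := by
    intro x0 N hN α β hα hβ h
    classical
    let σ : X → GE d A B u w κ κ' := fun x => if hx : x ∈ N then ⟨_, h x hx⟩ else
      ⟨_, h x0 (mem_of_mem_nhds hN)⟩
    have hσ : ∀ x ∈ N, (σ x).1 = (x, α x, β x) := by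
      intro x hx
      simp only [σ, dif_pos hx]
    refine ⟨N, hN, σ, ?_, fun y hy => by rw [hσ y hy]⟩
    rw [IsInducing.subtypeVal.continuousOn_iff]
    exact (continuousOn_id.prodMk (hα.prodMk hβ)).congr (fun x hx => hσ x hx)
  have hne : ∀ e : GE d A B u w κ κ', e.1.2.1 ≠ 0 ∨ e.1.2.2 ≠ 0 := by
    intro e
    rcases hAB e.1.1 with h | h
    · left; intro h0
      have := (e.2.1 h).1
      rw [h0, zero_pow hd.ne'] at this
      exact hu0 _ h this.symm
    · right; intro h0
      have := (e.2.2 h).1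
      rw [h0, zero_pow hd.ne'] at this
      exact hw0 _ h this.symm
  refine ⟨hd, inferInstance, by fun_prop, ?_, fun e => rfl, ?_, ?_, ?_⟩
  · rw [IsInducing.subtypeVal.continuous_iff]
    change Continuous (fun e : GE d A B u w κ κ' => (e.1.1, om d * e.1.2.1, om d * e.1.2.2))
    fun_prop
  · rintro ⟨⟨x, a, b⟩, he⟩ ⟨⟨x', a', b'⟩, he'⟩ hx
    have hx : x = x' := hx
    subst hx
    rcases hAB x with h | h
    · have := (he.1 h); have h' := (he'.1 h)
      dsimp only at this h'
      have ha : a ≠ 0 := by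
        rintro rfl
        apply hu0 x h; rw [← this.1, zero_pow hd.ne']
      obtain ⟨k, hk⟩ := root_rel d hd ha (this.1.trans h'.1.symm)
      refine ⟨k, Subtype.ext ?_⟩
      rw [gτ_it]
      dsimp only
      rw [hk, h'.2, this.2, ← hk]
      congr 2; ring
    · have := (he.2 h); have h' := (he'.2 h)
      dsimp only at this h'
      have ha : b ≠ 0 := by
        rintro rfl
        apply hw0 x h; rw [← this.1, zero_pow hd.ne']
      obtain ⟨k, hk⟩ := root_rel d hd ha (this.1.trans h'.1.symm)
      refine ⟨k, Subtype.ext ?_⟩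
      rw [gτ_it]
      dsimp only
      rw [hk, h'.2, this.2, ← hk]
      congr 2; ring
  · intro k e
    rw [← (om_prim d hd).pow_eq_one_iff_dvd, Subtype.ext_iff, gτ_it, Prod.ext_iff, Prod.ext_iff]
    dsimp only
    constructor
    · rintro ⟨-, h3, h4⟩
      rcases hne e with h | h
      · exact (mul_eq_right₀ h).1 h3
      · exact (mul_eq_right₀ h).1 h4
    · intro h; simp [h]
  · intro x0
    rcases hAB x0 with h | h
    · obtain ⟨N, hN, hNA, α, hα, hr⟩ := local_root d hd A hA u hu hu0 x0 h
      refine key x0 N hN α (fun x => κ x * α x) hα ((hκ.mono hNA).mul hα) ?_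
      intro x hx
      refine ⟨fun _ => ⟨hr x hx, rfl⟩, fun hxB => ?_⟩
      obtain ⟨h3, h4⟩ := h1 x (hNA hx) hxB
      dsimp only
      refine ⟨by rw [mul_pow, hr x hx, h3], by rw [← mul_assoc, mul_comm (κ' x), h4, one_mul]⟩
    · obtain ⟨N, hN, hNA, α, hα, hr⟩ := local_root d hd B hB w hw hw0 x0 h
      refine key x0 N hN (fun x => κ' x * α x) α ((hκ'.mono hNA).mul hα) hα ?_
      intro x hx
      refine ⟨fun hxA => ?_, fun _ => ⟨hr x hx, rfl⟩⟩
      obtain ⟨h3, h4⟩ := h1 x hxA (hNA hx)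
      dsimp only
      refine ⟨by rw [mul_pow, hr x hx, h2 x hxA (hNA hx)], by rw [← mul_assoc, h4, one_mul]⟩

end glueCyc
end BL
end

section
namespace BL
open Topology Filter Set Complex
namespace CD
variable {d : ℕ} (D : CD d)

theorem bundle : ∃ (u w κ κ' : D.W → ℂ) (A B : Set D.W) (r0 c : ℂ), (1, 0, r0) ∈ D.W ∧ c ≠ 0 ∧
    IsOpen A ∧ IsOpen B ∧ (∀ x, x ∈ A ∨ x ∈ B) ∧ ContinuousOn u A ∧ ContinuousOn w B ∧
    ContinuousOn κ A ∧ ContinuousOn κ' B ∧ (∀ x ∈ A, u x ≠ 0) ∧ (∀ x ∈ B, w x ≠ 0) ∧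
    (∀ x ∈ A, x ∈ B → w x = κ x ^ d * u x ∧ κ x * κ' x = 1) ∧
    ∀ v : D.W, ∀ l : ℂ, v.1 = l • (1, 0, r0) → v ∉ A ∧ w v = l * c ∧ κ' v = 0 := by
  classical
  obtain ⟨ε, hε, ρ, h⟩ := D.lsX 0 D.B0
  have hd := D.dpos
  let i1 : Fin d := ⟨0, hd⟩
  have hε0 : (0 : ℂ) ∈ Metric.ball (0 : ℂ) ε := Metric.mem_ball_self hε
  obtain ⟨θ, hθl, hθ, e, he⟩ := D.theta hε h (fun i => -1 + (if i = i1 then (d : ℤ) else 0)) (by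
    rw [Finset.sum_add_distrib]; simp)
  obtain ⟨N, hN, hNe⟩ := D.sheet_glue h (fun i s => if i = i1 then s else 1) (by
    intro i; split_ifs <;> fun_prop)
  obtain ⟨H, hH, hHe⟩ := D.sheet_glue h e (fun i => (he i).1)
  obtain ⟨M, hM, hMe⟩ := D.sheet_glue h
    (fun i s => if i = i1 then ((max 0 (ε / 2 - ‖s‖) : ℝ) : ℂ) else 0) (by
    intro i; split_ifs <;> fun_prop)
  have hsh : ∀ v ∈ D.Q ε, ∃ i, v.2.2 / v.1 = ρ i (v.2.1 / v.1) := by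
    intro v hv
    exact ((h.2.1 _ (D.Q_ball hv)).zero_iff _).1 (D.W_div hv.1 (D.Q_ne hv))
  have hQo : IsOpen {v : D.W | v.1 ∈ D.Q ε} := by
    have : {v : D.W | v.1 ∈ D.Q ε} = {v : D.W | ‖v.1.2.1‖ < ε * ‖v.1.1‖} := by
      ext v; exact ⟨fun h => h.2, fun h => ⟨v.2, h⟩⟩
    rw [this]
    exact isOpen_lt (by fun_prop) (by fun_prop)
  have hH0 : ∀ v ∈ D.Q ε, H v ≠ 0 := by
    intro v hv
    obtain ⟨i, hi⟩ := hsh v hv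
    rw [hHe i v hv hi]
    exact (he i).2.1 _ (D.Q_ball hv)
  have hval : ∀ f : ℂ × ℂ × ℂ → ℂ, ContinuousOn f (D.Q ε) →
      ContinuousOn (fun v : D.W => f v.1) {v : D.W | v.1 ∈ D.Q ε} := fun f hf =>
    hf.comp (by fun_prop) (fun v hv => hv)
  let u : D.W → ℂ := fun v => if v.1 ∈ D.Q ε then v.1.1 * (N v.1 ^ d * H v.1) else v.1.2.1 * θ v.1
  have hu1 : ∀ v : D.W, v.1 ∈ D.Q ε → u v = v.1.1 * (N v.1 ^ d * H v.1) := fun v hv => if_pos hv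
  have hu2 : ∀ v : D.W, v.1.2.1 ≠ 0 → u v = v.1.2.1 * θ v.1 := by
    intro v hy
    by_cases hv : v.1 ∈ D.Q ε
    · rw [hu1 v hv]
      obtain ⟨i, hi⟩ := hsh _ hv
      have hx := D.Q_ne hv
      rw [hNe i _ hv hi, hHe i _ hv hi]
      have hs : v.1.2.1 / v.1.1 ≠ 0 := div_ne_zero hy hx
      have h1 := (he i).2.2 _ (D.Q_ball hv) hs
      have h2 := hθl v.1.1 (1, v.1.2.1 / v.1.1, ρ i (v.1.2.1 / v.1.1)) hx
      have h3 : v.1.1 • ((1 : ℂ), v.1.2.1 / v.1.1, ρ i (v.1.2.1 / v.1.1)) = v.1 := by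
        rw [← hi]
        ext <;> simp <;> field_simp
      rw [h3, h1] at h2
      rw [h2, zpow_add₀ hs, zpow_neg_one]
      have : v.1.2.1 = v.1.1 * (v.1.2.1 / v.1.1) := by field_simp
      generalize v.1.2.1 / v.1.1 = s at *
      rw [this]
      by_cases hi1 : i = i1
      · simp only [if_pos hi1, zpow_natCast]; field_simp
      · simp only [if_neg hi1]; simp; field_simp
    · exact if_neg hv
  have hnQ : ∀ v : D.W, v.1 ∉ D.Q ε → v.1.2.1 ≠ 0 := by
    intro v hv hy
    apply hv
    refine ⟨v.2, ?_⟩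
    change ‖v.1.2.1‖ < ε * ‖v.1.1‖
    rw [hy, norm_zero]
    have := ((D.W_iff v.1.1 v.1.2.1 v.1.2.2).1 v.2).1
    have : v.1.1 ≠ 0 := by
      rcases this with h | h
      · exact h
      · exact absurd hy h
    positivity
  have hyo : IsOpen {v : D.W | v.1.2.1 ≠ 0} := isOpen_ne_fun (by fun_prop) (by fun_prop)
  have huc : Continuous u := by
    rw [continuous_iff_continuousAt]
    intro v
    by_cases hv : v.1 ∈ D.Q ε
    · have h1 : ContinuousOn u {v : D.W | v.1 ∈ D.Q ε} := by
        refine ContinuousOn.congr (f := fun v : D.W => v.1.1 * (N v.1 ^ d * H v.1)) ?_ hu1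
        exact ContinuousOn.mul (by fun_prop) (((hval N hN).pow d).mul (hval H hH))
      exact h1.continuousAt (hQo.mem_nhds hv)
    · have h1 : ContinuousOn u {v : D.W | v.1.2.1 ≠ 0} := by
        refine ContinuousOn.congr (f := fun v : D.W => v.1.2.1 * θ v.1) ?_ hu2
        refine ContinuousOn.mul (by fun_prop) ?_
        intro v hv
        refine (ContinuousWithinAt.comp (t := D.W) (hθ v.1 v.2 hv).1 (by fun_prop) ?_)
        intro v _; exact v.2
      exact h1.continuousAt (hyo.mem_nhds (hnQ v hv))
  let κ : D.W → ℂ := fun v => if v.1 ∈ D.Q ε then M v.1 / N v.1 else 0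
  have hκ1 : ∀ v : D.W, v.1 ∈ D.Q ε → κ v = M v.1 / N v.1 := fun v hv => if_pos hv
  have hNA : ∀ v : D.W, v.1 ∈ D.Q ε → u v ≠ 0 → N v.1 ≠ 0 := by
    intro v hv hu h0
    apply hu
    rw [hu1 v hv, h0, zero_pow hd.ne']; ring
  have hκ2 : ∀ v : D.W, ε / 2 * ‖v.1.1‖ < ‖v.1.2.1‖ → κ v = 0 := by
    intro v h1
    by_cases hv : v.1 ∈ D.Q ε
    · rw [hκ1 v hv]
      obtain ⟨i, hi⟩ := hsh _ hv
      rw [hMe i _ hv hi]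
      have : ε / 2 < ‖v.1.2.1 / v.1.1‖ := by
        rw [norm_div, lt_div_iff₀ (norm_pos_iff.2 (D.Q_ne hv))]; exact h1
      rw [max_eq_left (by linarith)]
      simp
    · exact if_neg hv
  have hAo : IsOpen {v : D.W | u v ≠ 0} := isOpen_ne_fun huc continuous_const
  have hBo : IsOpen ({v : D.W | v.1 ∈ D.Q ε} ∩ (fun v : D.W => M v.1) ⁻¹' {0}ᶜ) :=
    (hval M hM).isOpen_inter_preimage hQo isOpen_compl_singleton
  have hr0 : ((1 : ℂ), (0 : ℂ), ρ i1 0) ∈ D.W := by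
    rw [D.W_iff]
    exact ⟨Or.inl one_ne_zero, ((h.2.1 0 hε0).zero_iff _).2 ⟨i1, rfl⟩⟩
  refine ⟨u, fun v => v.1.1 * (M v.1 ^ d * H v.1), κ, fun v => N v.1 / M v.1, {v | u v ≠ 0},
    {v : D.W | v.1 ∈ D.Q ε} ∩ (fun v : D.W => M v.1) ⁻¹' {0}ᶜ, ρ i1 0,
    (((ε / 2 : ℝ) : ℂ)) ^ d * e i1 0, hr0, ?_, hAo, hBo, ?_, huc.continuousOn, ?_, ?_, ?_,
    fun v hv => hv, ?_, ?_, ?_⟩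
  · refine mul_ne_zero (pow_ne_zero _ ?_) ((he i1).2.1 0 hε0)
    exact_mod_cast (by positivity : ε / 2 ≠ 0)
  · intro v
    by_cases hu : u v = 0
    · right
      have hv : v.1 ∈ D.Q ε := by
        by_contra hv
        rw [hu2 v (hnQ v hv)] at hu
        exact mul_ne_zero (hnQ v hv) (hθ v.1 v.2 (hnQ v hv)).2 hu
      refine ⟨hv, ?_⟩
      rw [hu1 v hv] at hu
      have hN0 : N v.1 = 0 := by
        by_contra hN0
        exact mul_ne_zero (D.Q_ne hv) (mul_ne_zero (pow_ne_zero _ hN0) (hH0 _ hv)) hu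
      obtain ⟨i, hi⟩ := hsh _ hv
      rw [hNe i _ hv hi] at hN0
      change M v.1 ≠ 0
      rw [hMe i _ hv hi]
      by_cases hii : i = i1
      · rw [if_pos hii] at hN0 ⊢
        rw [hN0, norm_zero, sub_zero, max_eq_right (by positivity)]
        exact_mod_cast (by positivity : ε / 2 ≠ 0)
      · rw [if_neg hii] at hN0
        exact absurd hN0 one_ne_zero
    · left; exact hu
  · refine ContinuousOn.mono (s := {v : D.W | v.1 ∈ D.Q ε}) ?_ inter_subset_left
    exact ContinuousOn.mul (by fun_prop) (((hval M hM).pow d).mul (hval H hH))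
  · intro v hv
    by_cases hvQ : v.1 ∈ D.Q ε
    · have h1 : ContinuousOn κ ({v : D.W | v.1 ∈ D.Q ε} ∩ {v | u v ≠ 0}) := by
        refine ContinuousOn.congr (f := fun v : D.W => M v.1 / N v.1) ?_ (fun v hv => hκ1 v hv.1)
        exact ((hval M hM).mono inter_subset_left).div ((hval N hN).mono inter_subset_left)
          (fun v hv => hNA v hv.1 hv.2)
      exact (h1.continuousAt ((hQo.inter hAo).mem_nhds ⟨hvQ, hv⟩)).continuousWithinAt
    · have h1 : ContinuousOn κ {v : D.W | ε / 2 * ‖v.1.1‖ < ‖v.1.2.1‖} :=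
        ContinuousOn.congr (f := fun v : D.W => 0) continuousOn_const (fun v hv => hκ2 v hv)
      refine (h1.continuousAt ((isOpen_lt (by fun_prop) (by fun_prop)).mem_nhds ?_)).continuousWithinAt
      change ε / 2 * ‖v.1.1‖ < ‖v.1.2.1‖
      have hy := norm_pos_iff.2 (hnQ v hvQ)
      have h2 : ε * ‖v.1.1‖ ≤ ‖v.1.2.1‖ := not_lt.1 fun h => hvQ ⟨v.2, h⟩
      nlinarith [norm_nonneg v.1.1]
  · exact ((hval N hN).mono inter_subset_left).div ((hval M hM).mono inter_subset_left)
      (fun v hv => hv.2)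
  · rintro v ⟨hv, hm⟩
    exact mul_ne_zero (D.Q_ne hv) (mul_ne_zero (pow_ne_zero _ hm) (hH0 _ hv))
  · rintro v hu ⟨hv, hm⟩
    have hm : M v.1 ≠ 0 := hm
    have hn := hNA v hv hu
    rw [hκ1 v hv, hu1 v hv]
    constructor
    · rw [div_pow]; field_simp
    · field_simp
  · rintro ⟨v, hvW⟩ l hl
    dsimp only at hl
    have hl0 : l ≠ 0 := by
      rintro rfl
      rw [zero_smul] at hl
      exact hvW.1 hl
    have h1 : v.1 = l := by rw [hl]; simp
    have h2 : v.2.1 = 0 := by rw [hl]; simp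
    have h3 : v.2.2 = l * ρ i1 0 := by rw [hl]; simp
    have hv : v ∈ D.Q ε := by
      refine ⟨hvW, ?_⟩
      change ‖v.2.1‖ < ε * ‖v.1‖
      rw [h1, h2, norm_zero]
      have := norm_pos_iff.2 hl0
      positivity
    have hi : v.2.2 / v.1 = ρ i1 (v.2.1 / v.1) := by
      rw [h1, h2, h3, zero_div, mul_div_cancel_left₀ _ hl0]
    have hN0 : N v = 0 := by
      rw [hNe i1 _ hv hi, if_pos rfl, h2, zero_div]
    refine ⟨fun h => hNA ⟨v, hvW⟩ hv h hN0, ?_, by simp only [hN0, zero_div]⟩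
    simp only
    rw [hMe i1 _ hv hi, hHe i1 _ hv hi, if_pos rfl, h2, zero_div, h1, norm_zero, sub_zero,
      max_eq_right (by positivity)]

end CD
end BL
end

section
namespace BL
open Topology Filter Set Complex
namespace CD
variable {d : ℕ} (D : CD d)

theorem ee_norm (t : unitInterval) : ‖ee t‖ = 1 := by
  unfold ee
  have : (2 * Real.pi * I * ((t : ℝ) : ℂ)) = ((2 * Real.pi * (t : ℝ) : ℝ) : ℂ) * I := by push_cast; ring
  rw [this, norm_exp_ofReal_mul_I]

theorem dvd_of_P (O : Set (ℂ × ℂ × ℂ)) (hOW : O ⊆ D.W) (δ : ℝ) (hδ : 0 < δ)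
    (hO : ∀ v ∈ D.W, ‖v‖ < δ → v ∈ O) (m : ℕ) (hP : P O m) : d ∣ m := by
  classical
  obtain ⟨u, w, κ, κ', A, B, r0, c, hr0, hc0, hA, hB, hAB, hu, hw, hκ, hκ', hu0, hw0, h1, hray⟩ :=
    D.bundle
  have hd := D.dpos
  have hdC : (d : ℂ) ≠ 0 := by exact_mod_cast hd.ne'
  let j : O → D.W := Set.inclusion hOW
  have hj : Continuous j := continuous_inclusion hOW
  have hc := glueCyc d (j ⁻¹' A) (j ⁻¹' B) (u ∘ j) (w ∘ j) (κ ∘ j) (κ' ∘ j) hd (hA.preimage hj)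
    (hB.preimage hj) (fun x => hAB _) (hu.comp hj.continuousOn fun x hx => hx)
    (hw.comp hj.continuousOn fun x hx => hx) (hκ.comp hj.continuousOn fun x hx => hx)
    (hκ'.comp hj.continuousOn fun x hx => hx) (fun x hx => hu0 _ hx) (fun x hx => hw0 _ hx)
    (fun x hx hx' => h1 _ hx hx')
  obtain ⟨s, hs, hse⟩ := hP d _ _ _ hc
  obtain ⟨S, hSc, hS0, hS⟩ := frame_ratio hc (N := univ) (m := d) (s1 := fun e => s e ^ d)
    (s2 := fun _ => 1)
    ⟨(hs.pow d).continuousOn, fun e _ => pow_ne_zero _ (hse e).1, fun e _ => by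
      simp only [(hse e).2, mul_pow, om_pow d hd, one_mul, ← pow_mul, mul_comm m d]
      simp only [pow_mul, om_pow d hd, one_pow, one_mul]⟩
    ⟨continuousOn_const, fun e _ => one_ne_zero, fun e _ => by rw [om_pow d hd, one_mul]⟩
  have hSc' : Continuous S := by rwa [← continuousOn_univ]
  let r : ℂ × ℂ × ℂ → ℂ := fun v => ((δ / (1 + ‖v‖) : ℝ) : ℂ)
  have hrpos : ∀ v : ℂ × ℂ × ℂ, 0 < δ / (1 + ‖v‖) := fun v => by positivity
  have hr : Continuous r := by
    refine continuous_ofReal.comp (continuous_const.div (by fun_prop) (fun v => by positivity))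
  have hrne : ∀ v, r v ≠ 0 := fun v => ofReal_ne_zero.2 (hrpos v).ne'
  have hrO : ∀ v ∈ D.W, r v • v ∈ O := by
    intro v hv
    refine hO _ (D.mem_W_smul (hrne v) hv) ?_
    rw [norm_smul, norm_real, Real.norm_of_nonneg (hrpos v).le, div_mul_eq_mul_div,
      div_lt_iff₀ (by positivity)]
    nlinarith [norm_nonneg v]
  let S' : ℂ × ℂ × ℂ → ℂ := fun v => if h : r v • v ∈ O then S ⟨_, h⟩ else 1
  have hS' : ∀ v (hv : v ∈ D.W), S' v = S ⟨_, hrO v hv⟩ := fun v hv => dif_pos (hrO v hv)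
  have hS'c : ContinuousOn S' D.W := by
    rw [continuousOn_iff_continuous_domRestrict]
    have : D.W.domRestrict S' = fun v : D.W => S ⟨r v.1 • v.1, hrO v.1 v.2⟩ := by
      funext v; exact hS' v.1 v.2
    rw [this]
    refine hSc'.comp (Continuous.subtype_mk ?_ _)
    exact (hr.comp continuous_subtype_val).smul continuous_subtype_val
  obtain ⟨L, hLc, hLe, hL0, hL1⟩ := D.hopf S' hS'c
    (fun v hv => by rw [hS' v hv]; exact hS0 _ trivial) r0 hr0
  set v0 : ℂ × ℂ × ℂ := (1, 0, r0) with hv0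
  obtain ⟨b0, hb0⟩ := IsAlgClosed.exists_pow_nat_eq (r v0 * c) hd
  have hrv : ∀ t, r (ee t • v0) = r v0 := by
    intro t
    simp only [r, norm_smul, ee_norm, one_mul]
  have hW : ∀ t, ee t • v0 ∈ D.W := fun t => D.mem_W_smul (ee_ne t) hr0
  let ed : unitInterval → ℂ := fun t => exp (2 * Real.pi * I * ((t : ℝ) : ℂ) / d)
  have hed : ∀ t, ed t ^ d = ee t := by
    intro t
    simp only [ed, ee]
    rw [← exp_nat_mul, mul_div_cancel₀ _ hdC]
    try (congr 1; ring)
  let Et := GE d (j ⁻¹' A) (j ⁻¹' B) (u ∘ j) (w ∘ j) (κ ∘ j) (κ' ∘ j)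
  have hmem : ∀ t, ((⟨_, hrO _ (hW t)⟩, 0, ed t * b0) : O × ℂ × ℂ) ∈ Et := by
    intro t
    have hh := hray (j ⟨_, hrO _ (hW t)⟩) (r v0 * ee t) (by
      change r (ee t • v0) • ee t • v0 = _
      rw [hrv, smul_smul])
    refine ⟨fun h => absurd h hh.1, fun h => ⟨?_, ?_⟩⟩
    · change (ed t * b0) ^ d = w (j ⟨_, hrO _ (hW t)⟩)
      rw [hh.2.1, mul_pow, hed, hb0]; ring
    · change (0 : ℂ) = κ' (j ⟨_, hrO _ (hW t)⟩) * _
      rw [hh.2.2, zero_mul]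
  let γ : unitInterval → Et := fun t => ⟨_, hmem t⟩
  have hγ : Continuous γ := by
    refine Continuous.subtype_mk ?_ _
    refine Continuous.prodMk (Continuous.subtype_mk ?_ _) ?_
    · have : Continuous fun t => ee t • v0 := ee_cont.smul continuous_const
      exact (hr.comp this).smul this
    · fun_prop
  let h : unitInterval → ℂ := fun t => s (γ t) / exp (L t / d)
  have hhc : Continuous h := (hs.comp hγ).div (by fun_prop) (fun t => exp_ne_zero _)
  have hSv : S' v0 ≠ 0 := by rw [hS' v0 hr0]; exact hS0 _ trivial
  have hhd : ∀ t, h t ^ d = S' v0 := by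
    intro t
    simp only [h]
    rw [div_pow, ← exp_nat_mul, mul_div_cancel₀ _ hdC, hLe, hS (γ t) trivial, mul_one]
    have : S' (ee t • v0) = S (γ t).1.1 := hS' _ (hW t)
    rw [← this]
    have h2 : S' (ee t • v0) ≠ 0 := by rw [hS' _ (hW t)]; exact hS0 _ trivial
    field_simp
  have hfin : (range h).Finite := by
    refine (Polynomial.finite_setOfPred_isRoot (Polynomial.X_pow_sub_C_ne_zero hd (S' v0))).subset ?_
    rintro _ ⟨t, rfl⟩
    simp [hhd]
  have hsub : (range h).Subsingleton := by
    by_contra hns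
    exact (isPreconnected_range hhc).infinite_of_nontrivial (not_subsingleton_iff.1 hns) hfin
  have h01 : h 1 = h 0 := hsub ⟨1, rfl⟩ ⟨0, rfl⟩
  have hγ1 : γ 1 = gτ d _ _ _ _ _ _ hd (γ 0) := by
    apply Subtype.ext
    change ((⟨_, hrO _ (hW 1)⟩, 0, ed 1 * b0) : O × ℂ × ℂ) =
      (⟨_, hrO _ (hW 0)⟩, om d * 0, om d * (ed 0 * b0))
    refine Prod.ext (Subtype.ext ?_) (Prod.ext ?_ ?_)
    · simp only [ee_one, ee_zero]
    · simp
    · simp [ed, om]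
  simp only [h, hL0, hL1, zero_div, exp_zero, div_one] at h01
  rw [hγ1, (hse _).2] at h01
  exact ((om_prim d hd).pow_eq_one_iff_dvd m).1 ((mul_eq_right₀ (hse _).1).1 h01)

end CD
end BL
end

section
namespace BL
open Topology Filter Set Complex

theorem poly_of_growth (n : ℕ) : ∀ (g : ℂ → ℂ), Differentiable ℂ g → ∀ R K : ℝ,
    (∀ t, R ≤ ‖t‖ → ‖g t‖ ≤ K * ‖t‖ ^ n) → ∃ q : Polynomial ℂ, ∀ t, g t = q.eval t := by
  induction n with
  | zero =>
    intro g hg R K h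
    have hb : Bornology.IsBounded (range g) := by
      obtain ⟨C, hC⟩ := (isCompact_closedBall (0 : ℂ) R).exists_bound_of_continuousOn
        hg.continuous.continuousOn
      rw [isBounded_iff_forall_norm_le]
      refine ⟨max C K, ?_⟩
      rintro _ ⟨t, rfl⟩
      rcases le_total ‖t‖ R with ht | ht
      · exact (hC t (mem_closedBall_zero_iff.2 ht)).trans (le_max_left _ _)
      · have := h t ht
        rw [pow_zero, mul_one] at this
        exact this.trans (le_max_right _ _)
    exact ⟨Polynomial.C (g 0), fun t => by
      rw [Polynomial.eval_C]; exact hg.apply_eq_apply_of_bounded hb t 0⟩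
  | succ n ih =>
    intro g hg R K h
    have hd : Differentiable ℂ (dslope g 0) := by
      rw [← differentiableOn_univ, differentiableOn_dslope univ_mem, differentiableOn_univ]
      exact hg
    obtain ⟨q, hq⟩ := ih (dslope g 0) hd (max R 1) (K + ‖g 0‖) (by
      intro t ht
      have h1 : 1 ≤ ‖t‖ := (le_max_right _ _).trans ht
      have h0 : t ≠ 0 := by rintro rfl; simp at h1; linarith
      have hp : 0 < ‖t‖ := by linarith
      rw [dslope_of_ne _ h0, slope_def_field, sub_zero, norm_div, div_le_iff₀ hp]
      have h2 := h t ((le_max_left _ _).trans ht)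
      have h3 := norm_sub_le (g t) (g 0)
      have h4 : 1 ≤ ‖t‖ ^ (n + 1) := one_le_pow₀ h1
      have h5 : (K + ‖g 0‖) * ‖t‖ ^ n * ‖t‖ = K * ‖t‖ ^ (n + 1) + ‖g 0‖ * ‖t‖ ^ (n + 1) := by ring
      rw [h5]
      nlinarith [norm_nonneg (g 0)])
    refine ⟨Polynomial.C (g 0) + Polynomial.X * q, fun t => ?_⟩
    simp only [Polynomial.eval_add, Polynomial.eval_C, Polynomial.eval_mul, Polynomial.eval_X]
    rw [← hq]
    have := sub_smul_dslope g 0 t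
    rw [sub_zero, smul_eq_mul] at this
    rw [this]; ring

theorem poly_of_punctured (c : ℂ → ℂ) (B : Set ℂ) (hB : B.Finite) (hc : DifferentiableOn ℂ c Bᶜ)
    (n : ℕ) (K : ℝ) (hK : ∀ t ∉ B, ‖c t‖ ≤ K * (max 1 ‖t‖) ^ n) :
    ∃ q : Polynomial ℂ, ∀ t ∉ B, c t = q.eval t := by
  classical
  have hBo : IsOpen Bᶜ := hB.isClosed.isOpen_compl
  set g : ℂ → ℂ := fun t => limUnder (𝓝[≠] t) c with hgdef
  have hgc : ∀ t ∉ B, g t = c t := by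
    intro t ht
    have h1 : ContinuousAt c t := (hc.differentiableAt (hBo.mem_nhds ht)).continuousAt
    exact (h1.tendsto.mono_left nhdsWithin_le_nhds).limUnder_eq
  have hg : Differentiable ℂ g := by
    intro b
    by_cases hb : b ∈ B
    · have hU : IsOpen ((B \ {b})ᶜ ∩ Metric.ball b 1) :=
        ((hB.sdiff).isClosed.isOpen_compl).inter Metric.isOpen_ball
      have hbU : b ∈ (B \ {b})ᶜ ∩ Metric.ball b 1 := ⟨by simp, by simp⟩
      have hsub : ∀ t, t ∈ ((B \ {b})ᶜ ∩ Metric.ball b 1) \ {b} → t ∉ B := by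
        rintro t ⟨⟨h1, -⟩, h2⟩ h3
        exact h1 ⟨h3, h2⟩
      have h1 := differentiableOn_update_limUnder_of_bddAbove (f := c) (hU.mem_nhds hbU)
        (hc.mono hsub) (by
          refine ⟨|K| * (max 1 (‖b‖ + 1)) ^ n, ?_⟩
          rintro _ ⟨t, ht, rfl⟩
          refine (hK t (hsub t ht)).trans ?_
          have h2 : ‖t‖ ≤ ‖b‖ + 1 := by
            have := mem_ball_iff_norm.1 ht.1.2
            have := norm_le_norm_add_norm_sub b t
            rw [norm_sub_rev] at this
            linarith
          gcongr
          exact le_abs_self K)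
      refine (h1.differentiableAt (hU.mem_nhds hbU)).congr_of_eventuallyEq ?_
      filter_upwards [hU.mem_nhds hbU] with t ht
      by_cases htb : t = b
      · subst htb; simp [hgdef]
      · rw [Function.update_of_ne htb]
        exact hgc t (hsub t ⟨ht, htb⟩)
    · refine (hc.differentiableAt (hBo.mem_nhds hb)).congr_of_eventuallyEq ?_
      filter_upwards [hBo.mem_nhds hb] with t ht using hgc t ht
  obtain ⟨R, hR⟩ := hB.isBounded.exists_norm_le
  obtain ⟨q, hq⟩ := poly_of_growth n g hg (max 1 (R + 1)) K (by
    intro t ht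
    have h1 : 1 ≤ ‖t‖ := (le_max_left _ _).trans ht
    have h2 : R + 1 ≤ ‖t‖ := (le_max_right _ _).trans ht
    have htB : t ∉ B := fun h => by have := hR t h; linarith
    have := hK t htB
    rwa [max_eq_right h1, ← hgc t htB] at this)
  exact ⟨q, fun t ht => by rw [← hgc t ht, hq]⟩

end BL
end

section
namespace BL
open Topology Filter Set Complex
open scoped Classical

/-- the partial product over the roots in `u` -/
def pq {d : ℕ} (u : Set (ℂ × ℂ)) (t : ℂ) (r : Fin d → ℂ) : Polynomial ℂ :=
  ∏ i, if (t, r i) ∈ u then Polynomial.X - Polynomial.C (r i) else 1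

theorem pq_congr {d : ℕ} (u : Set (ℂ × ℂ)) (t : ℂ) {P : ℂ → ℂ} {r r' : Fin d → ℂ} (h : RT P r)
    (h' : RT P r') (hinj : Function.Injective r') : pq u t r' = pq u t r := by
  choose σ hσ using fun i => (h.zero_iff (r' i)).1 ((h'.zero_iff _).2 ⟨i, rfl⟩)
  have hi : Function.Injective σ := by
    intro i j hij
    apply hinj
    rw [hσ i, hσ j, hij]
  have hbij : Function.Bijective σ := Finite.injective_iff_bijective.1 hi
  unfold pq
  rw [← hbij.prod_comp (fun i => if (t, r i) ∈ u then Polynomial.X - Polynomial.C (r i) else 1)]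
  simp only [hσ]

theorem natDegree_prod_ite {ι : Type} (s : Finset ι) (p : ι → Prop) (a : ι → ℂ) :
    (∏ i ∈ s, if p i then Polynomial.X - Polynomial.C (a i) else 1).natDegree =
      ∑ i ∈ s, if p i then 1 else 0 := by
  rw [Polynomial.natDegree_prod_of_monic]
  · refine Finset.sum_congr rfl fun i _ => ?_
    split_ifs <;> simp
  · intro i _
    split_ifs
    · exact Polynomial.monic_X_sub_C _
    · exact Polynomial.monic_one

theorem coeff_step (a : ℂ) (P : Polynomial ℂ) (j : ℕ) :
    ((Polynomial.X - Polynomial.C a) * P).coeff j =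
      (if j = 0 then 0 else P.coeff (j - 1)) - a * P.coeff j := by
  rw [sub_mul, Polynomial.coeff_sub, Polynomial.coeff_C_mul]
  cases j with
  | zero => simp
  | succ j => simp [Polynomial.coeff_X_mul]

theorem coeff_bound {ι : Type} (s : Finset ι) (p : ι → Prop) (a : ι → ℂ) (M : ℝ) (hM : 0 ≤ M)
    (h : ∀ i ∈ s, ‖a i‖ ≤ M) (j : ℕ) :
    ‖(∏ i ∈ s, if p i then Polynomial.X - Polynomial.C (a i) else 1).coeff j‖ ≤
      (1 + M) ^ s.card := by
  induction s using Finset.induction_on generalizing j with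
  | empty =>
    simp only [Finset.prod_empty, Finset.card_empty, pow_zero, Polynomial.coeff_one]
    split_ifs <;> simp
  | insert i s hi ih =>
    have ih' := fun j => ih (fun i hi => h i (Finset.mem_insert_of_mem hi)) j
    rw [Finset.prod_insert hi, Finset.card_insert_of_notMem hi, pow_succ]
    have hpos : 0 ≤ (1 + M) ^ s.card := by positivity
    split_ifs with hp
    · rw [coeff_step]
      refine (norm_sub_le _ _).trans ?_
      rw [norm_mul]
      have h1 := mul_le_mul (h i (Finset.mem_insert_self _ _)) (ih' j) (norm_nonneg _) hM
      have h2 : ‖(if j = 0 then 0 else (∏ i ∈ s, if p i then Polynomial.X - Polynomial.C (a i)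
          else 1).coeff (j - 1))‖ ≤ (1 + M) ^ s.card := by
        split_ifs
        · simpa using hpos
        · exact ih' _
      nlinarith
    · rw [one_mul]
      exact (ih' j).trans (le_mul_of_one_le_right hpos (by linarith))

theorem coeff_diff {ι : Type} (s : Finset ι) (p : ι → Prop) (a : ι → ℂ → ℂ) (t₀ : ℂ)
    (h : ∀ i ∈ s, DifferentiableAt ℂ (a i) t₀) (j : ℕ) :
    DifferentiableAt ℂ (fun t =>
      (∏ i ∈ s, if p i then Polynomial.X - Polynomial.C (a i t) else 1).coeff j) t₀ := by
  induction s using Finset.induction_on generalizing j with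
  | empty => simp
  | insert i s hi ih =>
    have ih' := fun j => ih (fun i hi => h i (Finset.mem_insert_of_mem hi)) j
    simp only [Finset.prod_insert hi]
    by_cases hp : p i
    · simp only [if_pos hp, coeff_step]
      refine DifferentiableAt.sub ?_ ((h i (Finset.mem_insert_self _ _)).mul (ih' j))
      split_ifs
      · exact differentiableAt_const _
      · exact ih' _
    · simp only [if_neg hp, one_mul]
      exact ih' j

theorem factor {d : ℕ} {G : ℂ → ℂ → ℂ} (hF : Fam d G) (B : Set ℂ) (hB : B.Finite)
    (hs : ∀ s ∉ B, ∀ r : Fin d → ℂ, RT (G s) r → Function.Injective r) (C : ℝ) (hC : 0 ≤ C)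
    (hgr : ∀ t z, G t z = 0 → ‖z‖ ≤ C * max 1 ‖t‖) (u v : Set (ℂ × ℂ)) (hu : IsOpen u) (hv : IsOpen v)
    (hcov : ∀ t ∉ B, ∀ z, G t z = 0 → (t, z) ∈ u ∨ (t, z) ∈ v)
    (hdis : ∀ t ∉ B, ∀ z, G t z = 0 → (t, z) ∈ u → (t, z) ∉ v) :
    ∃ (k : ℕ) (a : Polynomial (Polynomial ℂ)), a.natDegree ≤ k ∧
      ∀ t ∉ B, ∀ r : Fin d → ℂ, RT (G t) r →
        a.map (Polynomial.evalRingHom t) = pq u t r ∧ (pq u t r).natDegree = k := by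
  choose R hR using hF.roots
  have hBo : IsOpen Bᶜ := hB.isClosed.isOpen_compl
  set p : ℂ → Polynomial ℂ := fun t => pq u t (R t) with hp
  have hpr : ∀ t ∉ B, ∀ r : Fin d → ℂ, RT (G t) r → p t = pq u t r := fun t ht r hr =>
    pq_congr u t hr (hR t) (hs t ht _ (hR t))
  have hloc : ∀ t₀ ∉ B, ∃ ρ : Fin d → ℂ → ℂ, (∀ i, DifferentiableAt ℂ (ρ i) t₀) ∧
      ∃ I : Fin d → Prop, ∀ᶠ t in 𝓝 t₀,
        p t = ∏ i, if I i then Polynomial.X - Polynomial.C (ρ i t) else 1 := by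
    intro t₀ ht₀
    obtain ⟨ε, hε, ρ, hls, -⟩ := hF.ls t₀ (R t₀) (hR t₀) (hs t₀ ht₀ _ (hR t₀))
    have hd : ∀ i, DifferentiableAt ℂ (ρ i) t₀ := fun i =>
      (hls.1 i).differentiableAt (Metric.ball_mem_nhds t₀ hε)
    refine ⟨ρ, hd, fun i => (t₀, ρ i t₀) ∈ u, ?_⟩
    have h1 : ∀ i, ∀ᶠ t in 𝓝 t₀, (t ∉ B → t ∈ Metric.ball t₀ ε → ((t, ρ i t) ∈ u ↔ (t₀, ρ i t₀) ∈ u)) := by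
      intro i
      have hc : ContinuousAt (fun t => (t, ρ i t)) t₀ := continuousAt_id.prodMk (hd i).continuousAt
      have hz : ∀ t ∈ Metric.ball t₀ ε, G t (ρ i t) = 0 := fun t ht =>
        ((hls.2.1 t ht).zero_iff _).2 ⟨i, rfl⟩
      by_cases hi : (t₀, ρ i t₀) ∈ u
      · filter_upwards [hc.preimage_mem_nhds (hu.mem_nhds hi)] with t ht _ _
        exact ⟨fun _ => hi, fun _ => ht⟩
      · have hi' := (hcov t₀ ht₀ _ (hz t₀ (Metric.mem_ball_self hε))).resolve_left hi
        filter_upwards [hc.preimage_mem_nhds (hv.mem_nhds hi')] with t ht h2 h3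
        exact ⟨fun h => absurd ht (hdis t h2 _ (hz t h3) h), fun h => absurd h hi⟩
    filter_upwards [eventually_all.2 h1, hBo.mem_nhds ht₀, Metric.ball_mem_nhds t₀ hε] with t h2 h3 h4
    rw [hpr t h3 _ (hls.2.1 t h4)]
    unfold pq
    refine Finset.prod_congr rfl fun i _ => ?_
    simp only [h2 i h3 h4]
  have hconn : IsPreconnected Bᶜ :=
    (hB.countable.isConnected_compl_of_one_lt_rank (by simp)).isPreconnected
  have hkc : ContinuousOn (fun t => (p t).natDegree) Bᶜ := by
    intro t₀ ht₀
    obtain ⟨ρ, -, I, hI⟩ := hloc t₀ ht₀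
    refine ContinuousAt.continuousWithinAt ?_
    refine ContinuousAt.congr (f := fun _ => ∑ i : Fin d, if I i then 1 else 0) continuousAt_const ?_
    filter_upwards [hI] with t ht
    rw [ht, natDegree_prod_ite]
  obtain ⟨t₁, ht₁⟩ := hB.exists_notMem
  have hk : ∀ t ∉ B, (p t).natDegree = (p t₁).natDegree := fun t ht =>
    hconn.constant hkc ht ht₁
  have hq : ∀ j, ∃ q : Polynomial ℂ, ∀ t ∉ B, (p t).coeff j = q.eval t := by
    intro j
    refine poly_of_punctured (fun t => (p t).coeff j) B hB ?_ d ((1 + C) ^ d) ?_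
    · intro t₀ ht₀
      obtain ⟨ρ, hρ, I, hI⟩ := hloc t₀ ht₀
      refine (DifferentiableAt.congr_of_eventuallyEq
        (coeff_diff Finset.univ I ρ t₀ (fun i _ => hρ i) j) ?_).differentiableWithinAt
      filter_upwards [hI] with t ht
      rw [ht]
    · intro t ht
      have h1 : 1 ≤ max 1 ‖t‖ := le_max_left _ _
      have h2 := coeff_bound Finset.univ (fun i => (t, R t i) ∈ u) (R t) (C * max 1 ‖t‖)
        (by positivity) (fun i _ => hgr t _ (((hR t).zero_iff _).2 ⟨i, rfl⟩)) j
      rw [Finset.card_univ, Fintype.card_fin] at h2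
      refine h2.trans ?_
      rw [← mul_pow]
      gcongr
      linarith
  choose q hq using hq
  refine ⟨(p t₁).natDegree, ∑ j ∈ Finset.range ((p t₁).natDegree + 1), Polynomial.monomial j (q j),
    ?_, ?_⟩
  · refine Polynomial.natDegree_sum_le_of_forall_le _ _ ?_
    intro j hj
    exact (Polynomial.natDegree_monomial_le _).trans (Nat.lt_succ_iff.1 (Finset.mem_range.1 hj))
  · intro t ht r hr
    rw [← hpr t ht r hr]
    refine ⟨?_, hk t ht⟩
    ext j
    rw [Polynomial.coeff_map, Polynomial.finsetSum_coeff]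
    simp only [Polynomial.coeff_monomial]
    rw [Finset.sum_ite_eq']
    split_ifs with hj
    · rw [Polynomial.coe_evalRingHom, hq j t ht]
    · rw [map_zero, Polynomial.coeff_eq_zero_of_natDegree_lt]
      rw [hk t ht]
      simpa using hj

end BL
end

section
namespace BL
open Topology Filter Set Complex
open Polynomial (evalRingHom evalEval)

theorem pow_lin {R : Type} [CommRing R] (a b : R) (n : ℕ) :
    ((Polynomial.C a + Polynomial.C b * Polynomial.X) ^ n).natDegree ≤ n ∧
    ((Polynomial.C a + Polynomial.C b * Polynomial.X) ^ n).coeff n = b ^ n := by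
  have h1 : (Polynomial.C a + Polynomial.C b * Polynomial.X).natDegree ≤ 1 := by
    rw [add_comm]; exact Polynomial.natDegree_linear_le
  constructor
  · exact (Polynomial.natDegree_pow_le_of_le n h1).trans (by simp)
  · have := Polynomial.coeff_pow_of_natDegree_le (m := n) (n := 1) h1
    simp only [mul_one, one_mul] at this
    rw [this]; simp

theorem lin_coeff {R : Type} [CommRing R] [Algebra ℂ R] (f : MvPolynomial (Fin 3) ℂ) (d : ℕ)
    (hf : f.IsHomogeneous d) (a b : Fin 3 → R) :
    (MvPolynomial.aeval (fun i => Polynomial.C (a i) + Polynomial.C (b i) * Polynomial.X) f).natDegree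
      ≤ d ∧
    (MvPolynomial.aeval (fun i => Polynomial.C (a i) + Polynomial.C (b i) * Polynomial.X) f).coeff d
      = MvPolynomial.aeval b f := by
  have key : ∀ m ∈ f.support, m 0 + m 1 + m 2 = d := by
    intro m hm
    have := hf (MvPolynomial.mem_support_iff.1 hm)
    rw [Finsupp.weight_apply, Finsupp.sum_fintype] at this
    · simpa [Fin.sum_univ_three] using this
    · simp
  have hmon : ∀ m ∈ f.support,
      (∏ i, (Polynomial.C (a i) + Polynomial.C (b i) * Polynomial.X) ^ m i).natDegree ≤ d ∧
      (∏ i, (Polynomial.C (a i) + Polynomial.C (b i) * Polynomial.X) ^ m i).coeff d = ∏ i, b i ^ m i := by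
    intro m hm
    have h0 := pow_lin (a 0) (b 0) (m 0)
    have h1 := pow_lin (a 1) (b 1) (m 1)
    have h2 := pow_lin (a 2) (b 2) (m 2)
    rw [Fin.prod_univ_three, Fin.prod_univ_three, ← key m hm]
    have h01 := Polynomial.natDegree_mul_le_of_le h0.1 h1.1
    refine ⟨Polynomial.natDegree_mul_le_of_le h01 h2.1, ?_⟩
    rw [Polynomial.coeff_mul_add_eq_of_natDegree_le h01 h2.1,
      Polynomial.coeff_mul_add_eq_of_natDegree_le h0.1 h1.1, h0.2, h1.2, h2.2]
  rw [MvPolynomial.aeval_def, MvPolynomial.eval₂_eq', MvPolynomial.aeval_def, MvPolynomial.eval₂_eq']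
  constructor
  · refine Polynomial.natDegree_sum_le_of_forall_le _ _ fun m hm => ?_
    refine (Polynomial.natDegree_C_mul_le _ _).trans (hmon m hm).1
  · rw [Polynomial.finsetSum_coeff]
    refine Finset.sum_congr rfl fun m hm => ?_
    have : algebraMap ℂ (Polynomial R) (MvPolynomial.coeff m f) =
      Polynomial.C (algebraMap ℂ R (MvPolynomial.coeff m f)) := rfl
    rw [this, Polynomial.coeff_C_mul, (hmon m hm).2]

abbrev V3 := ℂ × ℂ × ℂ
abbrev E3' := EuclideanSpace ℂ (Fin 3)

/-- evaluation in the new coordinates -/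
def ev (T : V3 ≃L[ℂ] E3') (v : V3) : MvPolynomial (Fin 3) ℂ →+* ℂ := MvPolynomial.eval (fun i => T v i)

theorem lin_poly (T : V3 ≃L[ℂ] E3') (φ : V3 →ₗ[ℂ] ℂ) :
    ∃ l : MvPolynomial (Fin 3) ℂ, ∀ v, ev T v l = φ v := by
  let ψ : E3' →ₗ[ℂ] ℂ := φ.comp T.symm.toLinearEquiv.toLinearMap
  refine ⟨∑ i, MvPolynomial.C (ψ (EuclideanSpace.single i 1)) * MvPolynomial.X i, fun v => ?_⟩
  have h1 : φ v = ψ (T v) := by simp [ψ]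
  have h2 : T v = ∑ i, T v i • EuclideanSpace.single i (1 : ℂ) := by
    ext j
    simp [Pi.single_apply]
  rw [h1]
  conv_rhs => rw [h2]
  simp only [map_sum, map_smul, ev, map_mul, MvPolynomial.eval_C, MvPolynomial.eval_X, smul_eq_mul]
  exact Finset.sum_congr rfl fun i _ => mul_comm _ _

theorem homog (T : V3 ≃L[ℂ] E3') (a : Polynomial (Polynomial ℂ)) :
    ∃ (N : ℕ) (A : MvPolynomial (Fin 3) ℂ), ∀ x y z, x ≠ 0 →
      ev T (x, y, z) A = x ^ N * a.evalEval (y / x) (z / x) := by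
  obtain ⟨lx, hlx⟩ := lin_poly T (LinearMap.fst ℂ ℂ (ℂ × ℂ))
  obtain ⟨ly, hly⟩ := lin_poly T ((LinearMap.fst ℂ ℂ ℂ).comp (LinearMap.snd ℂ ℂ (ℂ × ℂ)))
  obtain ⟨lz, hlz⟩ := lin_poly T ((LinearMap.snd ℂ ℂ ℂ).comp (LinearMap.snd ℂ ℂ (ℂ × ℂ)))
  simp only [LinearMap.fst_apply, LinearMap.snd_apply, LinearMap.comp_apply] at hlx hly hlz
  have hadd : ∀ a b : Polynomial (Polynomial ℂ),
      (∃ (N : ℕ) (A : MvPolynomial (Fin 3) ℂ), ∀ x y z, x ≠ 0 →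
        ev T (x, y, z) A = x ^ N * a.evalEval (y / x) (z / x)) →
      (∃ (N : ℕ) (A : MvPolynomial (Fin 3) ℂ), ∀ x y z, x ≠ 0 →
        ev T (x, y, z) A = x ^ N * b.evalEval (y / x) (z / x)) →
      (∃ (N : ℕ) (A : MvPolynomial (Fin 3) ℂ), ∀ x y z, x ≠ 0 →
        ev T (x, y, z) A = x ^ N * (a + b).evalEval (y / x) (z / x)) := by
    rintro a b ⟨N, A, hA⟩ ⟨M, B, hB⟩
    refine ⟨N + M, lx ^ M * A + lx ^ N * B, fun x y z hx => ?_⟩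
    rw [map_add, map_mul, map_mul, map_pow, map_pow, hA x y z hx, hB x y z hx, hlx,
      Polynomial.evalEval_add]
    ring
  refine Polynomial.induction_on a ?_ (fun p q => hadd p q) ?_
  · intro p
    refine Polynomial.induction_on p ?_ ?_ ?_
    · intro c
      refine ⟨0, MvPolynomial.C c, fun x y z hx => ?_⟩
      simp [ev, Polynomial.evalEval_C]
    · intro p q hp hq
      rw [map_add]
      exact hadd _ _ hp hq
    · rintro n c ⟨N, A, hA⟩
      refine ⟨N + 1, A * ly, fun x y z hx => ?_⟩
      rw [map_mul, hA x y z hx, hly]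
      simp only [Polynomial.evalEval_C, Polynomial.eval_mul, Polynomial.eval_C, Polynomial.eval_pow,
        Polynomial.eval_X]
      rw [pow_succ (y / x) n, pow_succ x N]
      have h5 : x * (y / x) = y := mul_div_cancel₀ _ hx
      linear_combination (-(x ^ N * c * (y / x) ^ n)) * h5
  · rintro n c ⟨N, A, hA⟩
    refine ⟨N + 1, A * lz, fun x y z hx => ?_⟩
    rw [map_mul, hA x y z hx, hlz]
    simp only [Polynomial.evalEval_C, Polynomial.evalEval_mul, Polynomial.evalEval_pow,
      Polynomial.evalEval_X]
    rw [pow_succ (z / x) n, pow_succ x N]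
    have h5 : x * (z / x) = z := mul_div_cancel₀ _ hx
    linear_combination (-(x ^ N * Polynomial.eval (y / x) c * (z / x) ^ n)) * h5

theorem evalEval_map (a : Polynomial (Polynomial ℂ)) (s z : ℂ) :
    (a.map (evalRingHom s)).eval z = a.evalEval s z := by
  rw [Polynomial.eval_map, Polynomial.eval₂_evalRingHom]

theorem ev_hom (T : V3 ≃L[ℂ] E3') (f : MvPolynomial (Fin 3) ℂ) (d : ℕ) (hf : f.IsHomogeneous d)
    (l : ℂ) (v : V3) : ev T (l • v) f = l ^ d * ev T v f := by
  simp only [ev, map_smul, PiLp.smul_apply, smul_eq_mul]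
  rw [MvPolynomial.eval_eq', MvPolynomial.eval_eq', Finset.mul_sum]
  refine Finset.sum_congr rfl fun m hm => ?_
  have := hf (MvPolynomial.mem_support_iff.1 hm)
  rw [Finsupp.weight_apply, Finsupp.sum_fintype] at this
  · simp only [Pi.one_apply, smul_eq_mul, mul_one] at this
    simp only [mul_pow, Finset.prod_mul_distrib, Finset.prod_pow_eq_pow_sum, this]
    ring
  · simp

theorem no_factor (T : V3 ≃L[ℂ] E3') (f : MvPolynomial (Fin 3) ℂ) (d : ℕ) (hf : f.IsHomogeneous d)
    (hirr : Irreducible f) (hd : 0 < d) (p a b : Polynomial (Polynomial ℂ)) (hp : p.Monic)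
    (hpd : p.natDegree = d) (hpf : ∀ s z, p.evalEval s z = ev T (1, s, z) f) (hab : p = a * b)
    (ha : a.natDegree < d) (hb : b.natDegree < d) : False := by
  have hpr : Prime f := hirr.prime
  obtain ⟨N, A, hA⟩ := homog T a
  obtain ⟨M, B, hB⟩ := homog T b
  obtain ⟨lx, hlx⟩ := lin_poly T (LinearMap.fst ℂ ℂ (ℂ × ℂ))
  simp only [LinearMap.fst_apply] at hlx
  have hpm : (p.map (evalRingHom 0)).Monic := hp.map _
  have hpmd : (p.map (evalRingHom 0)).natDegree = d := by rw [hp.natDegree_map, hpd]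
  have hdiv : ∀ (c : Polynomial (Polynomial ℂ)) (N : ℕ) (A : MvPolynomial (Fin 3) ℂ),
      c.natDegree < d → c.map (evalRingHom 0) ≠ 0 → (∀ x y z, x ≠ 0 →
      ev T (x, y, z) A = x ^ N * c.evalEval (y / x) (z / x)) → ¬ f ∣ A := by
    rintro c N A hc hc0 hA ⟨q, rfl⟩
    let Q : Polynomial ℂ := MvPolynomial.aeval (fun i => Polynomial.C (T (1, 0, 0) i) +
      Polynomial.C (T (0, 0, 1) i) * Polynomial.X) q
    have hQ : ∀ z, Q.eval z = ev T (1, 0, z) q := by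
      intro z
      have h1 : ((1 : ℂ), (0 : ℂ), z) = (1, 0, 0) + z • (0, 0, 1) := by simp
      have h2 := MvPolynomial.aeval_def (fun i => Polynomial.C (T (1, 0, 0) i) +
        Polynomial.C (T (0, 0, 1) i) * Polynomial.X) q
      change Polynomial.evalRingHom z (MvPolynomial.aeval _ q) = _
      rw [h2, MvPolynomial.hom_eval₂]
      unfold ev
      rw [← MvPolynomial.eval₂_id]
      congr 1
      · ext c; simp
      · funext i
        have h3 : T (1, 0, z) = T (1, 0, 0) + z • T (0, 0, 1) := by rw [h1, map_add, map_smul]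
        rw [h3]
        simp; ring
    have h3 : c.map (evalRingHom 0) = p.map (evalRingHom 0) * Q := by
      apply Polynomial.funext
      intro z
      have := hA 1 0 z one_ne_zero
      rw [map_mul, one_pow, one_mul, div_one, div_one] at this
      rw [Polynomial.eval_mul, evalEval_map, evalEval_map, hQ, hpf, this]
    apply hc0
    refine Polynomial.eq_zero_of_dvd_of_natDegree_lt (p := p.map (evalRingHom 0)) ⟨Q, h3⟩ ?_
    rw [hpmd]
    exact Polynomial.natDegree_map_le.trans_lt hc
  have habm : p.map (evalRingHom 0) = a.map (evalRingHom 0) * b.map (evalRingHom 0) := by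
    rw [hab, Polynomial.map_mul]
  have ha0 : a.map (evalRingHom 0) ≠ 0 := by
    intro h; rw [h, zero_mul] at habm; exact hpm.ne_zero habm
  have hb0 : b.map (evalRingHom 0) ≠ 0 := by
    intro h; rw [h, mul_zero] at habm; exact hpm.ne_zero habm
  have hx : ¬ f ∣ lx := by
    rintro ⟨q, hq⟩
    obtain ⟨z, hz⟩ := IsAlgClosed.exists_root (p.map (evalRingHom 0)) (by
      rw [Polynomial.degree_eq_natDegree hpm.ne_zero, hpmd]
      exact_mod_cast hd.ne')
    have h1 : ev T (1, 0, z) f = 0 := by rw [← hpf, ← evalEval_map]; exact hz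
    have h2 := hlx (1, 0, z)
    rw [hq, map_mul, h1, zero_mul] at h2
    exact zero_ne_one h2
  have hpoly : lx * (lx ^ (N + M) * f) = lx * (lx ^ d * (A * B)) := by
    apply MvPolynomial.funext
    intro w
    have hw : MvPolynomial.eval w = ev T (T.symm (WithLp.toLp 2 w)) := by
      unfold ev; simp
    rw [hw]
    obtain ⟨x, y, z⟩ := T.symm (WithLp.toLp 2 w)
    simp only [map_mul, map_pow, hlx]
    by_cases hx : x = 0
    · rw [hx]; ring
    · rw [hA x y z hx, hB x y z hx]
      have h1 := ev_hom T f d hf x (1, y / x, z / x)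
      have h2 : x • ((1 : ℂ), y / x, z / x) = (x, y, z) := by
        simp only [Prod.smul_mk, smul_eq_mul, mul_one, mul_div_cancel₀ _ hx]
      rw [h2, ← hpf, hab, Polynomial.evalEval_mul] at h1
      rw [h1]; ring
  have hdv : f ∣ lx * (lx ^ d * (A * B)) := ⟨lx * lx ^ (N + M), by rw [← hpoly]; ring⟩
  rcases hpr.dvd_or_dvd hdv with h | h
  · exact hx h
  rcases hpr.dvd_or_dvd h with h | h
  · exact hx (hpr.dvd_of_dvd_pow h)
  rcases hpr.dvd_or_dvd h with h | h
  · exact hdiv a N A ha ha0 hA h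
  · exact hdiv b M B hb hb0 hB h

theorem bezout (p : Polynomial (Polynomial ℂ)) (hp : p.Monic) (hirr : Irreducible p) :
    ∃ c : Polynomial ℂ, c ≠ 0 ∧ ∀ s z, c.eval s ≠ 0 → p.evalEval s z = 0 →
      (Polynomial.derivative p).evalEval s z ≠ 0 := by
  let K := FractionRing (Polynomial ℂ)
  have hK : Irreducible (p.map (algebraMap (Polynomial ℂ) K)) :=
    (hp.irreducible_iff_irreducible_map_fraction_map).1 hirr
  obtain ⟨A, B, hAB⟩ := hK.separable
  obtain ⟨a, ha⟩ := IsLocalization.integerNormalization_map_to_map (nonZeroDivisors (Polynomial ℂ)) A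
  obtain ⟨b, hb⟩ := IsLocalization.integerNormalization_map_to_map (nonZeroDivisors (Polynomial ℂ)) B
  set A' := IsLocalization.integerNormalization (nonZeroDivisors (Polynomial ℂ)) A
  set B' := IsLocalization.integerNormalization (nonZeroDivisors (Polynomial ℂ)) B
  have ha0 : (a : Polynomial ℂ) ≠ 0 := nonZeroDivisors.coe_ne_zero a
  have hb0 : (b : Polynomial ℂ) ≠ 0 := nonZeroDivisors.coe_ne_zero b
  have hid : Polynomial.C (b : Polynomial ℂ) * A' * p +
      Polynomial.C (a : Polynomial ℂ) * B' * Polynomial.derivative p =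
      Polynomial.C ((a : Polynomial ℂ) * b) := by
    apply Polynomial.map_injective (algebraMap (Polynomial ℂ) K) (IsFractionRing.injective _ _)
    simp only [Polynomial.map_add, Polynomial.map_mul, Polynomial.map_C, ha, hb,
      Polynomial.derivative_map] at hAB ⊢
    rw [Algebra.smul_def, Algebra.smul_def]
    have e : ∀ c : Polynomial ℂ, algebraMap (Polynomial ℂ) (Polynomial K) c =
      Polynomial.C (algebraMap _ K c) := fun c => rfl
    rw [e, e, map_mul, map_mul]
    linear_combination (Polynomial.C (algebraMap _ K (a : Polynomial ℂ)) *
      Polynomial.C (algebraMap _ K (b : Polynomial ℂ))) * hAB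
  refine ⟨a * b, mul_ne_zero ha0 hb0, fun s z hc h0 h1 => hc ?_⟩
  have := congrArg (Polynomial.evalEval s z) hid
  simp only [Polynomial.evalEval_add, Polynomial.evalEval_mul, h0, h1, mul_zero, add_zero,
    Polynomial.evalEval_C] at this
  exact this.symm

end BL
end

section
namespace BL
open Topology Filter Set Complex
open Polynomial (evalRingHom evalEval)

theorem rt_of_monic (q : Polynomial ℂ) (hq : q.Monic) (d : ℕ) (hd : q.natDegree = d) :
    ∃ r : Fin d → ℂ, RT (fun z => q.eval z) r := by
  have hs : q.Splits := IsAlgClosed.splits q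
  have hc : q.roots.toList.length = d := by
    rw [Multiset.length_toList, ← hs.natDegree_eq_card_roots, hd]
  subst hc
  refine ⟨fun i => q.roots.toList.get i, fun z => ?_⟩
  simp only
  rw [hs.eval_eq_prod_roots_of_monic hq]
  conv_lhs => rw [← Multiset.coe_toList q.roots]
  rw [Multiset.map_coe, Multiset.prod_coe, ← List.prod_ofFn]
  congr 1
  conv_lhs => rw [← List.ofFn_get q.roots.toList]
  rw [List.map_ofFn]; rfl

theorem split3 (T : V3 ≃L[ℂ] E3') (x y z : ℂ) : T (x, y, z) = T (x, y, 0) + z • T (0, 0, 1) := by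
  rw [← map_smul, ← map_add]; simp

theorem split2 (T : V3 ≃L[ℂ] E3') (s : ℂ) : T (1, s, 0) = T (1, 0, 0) + s • T (0, 1, 0) := by
  rw [← map_smul, ← map_add]; simp

theorem line_eval (T : V3 ≃L[ℂ] E3') (f : MvPolynomial (Fin 3) ℂ) (x y z : ℂ) :
    (MvPolynomial.aeval (fun i => Polynomial.C (T (x, y, 0) i) +
      Polynomial.C (T (0, 0, 1) i) * Polynomial.X) f).eval z = ev T (x, y, z) f := by
  change Polynomial.evalRingHom z (MvPolynomial.aeval _ f) = _
  rw [MvPolynomial.aeval_def, MvPolynomial.hom_eval₂]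
  unfold ev
  rw [← MvPolynomial.eval₂_id]
  congr 1
  · ext c; simp
  · funext i
    rw [split3 T x y z]
    simp; ring

theorem aeval_ev (T : V3 ≃L[ℂ] E3') (f : MvPolynomial (Fin 3) ℂ) (v : V3) :
    MvPolynomial.aeval (fun i => T v i) f = ev T v f := by
  rw [MvPolynomial.aeval_eq_eval]; rfl

theorem ev_roots (T : V3 ≃L[ℂ] E3') (f : MvPolynomial (Fin 3) ℂ) (d : ℕ) (hf : f.IsHomogeneous d)
    (h1 : ev T (0, 0, 1) f = 1) (x y : ℂ) : ∃ r : Fin d → ℂ, RT (fun z => ev T (x, y, z) f) r := by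
  have h := lin_coeff f d hf (fun i => T (x, y, 0) i) (fun i => T (0, 0, 1) i)
  have h2 : MvPolynomial.aeval (fun i => T (0, 0, 1) i) f = (1 : ℂ) := by
    rw [aeval_ev, h1]
  rw [h2] at h
  have hm := Polynomial.monic_of_natDegree_le_of_coeff_eq_one d h.1 h.2
  have hd := Polynomial.natDegree_eq_of_le_of_coeff_ne_zero h.1 (by rw [h.2]; exact one_ne_zero)
  obtain ⟨r, hr⟩ := rt_of_monic _ hm d hd
  refine ⟨r, fun z => ?_⟩
  exact (line_eval T f x y z).symm.trans (hr z)

theorem ev_smooth (T : V3 ≃L[ℂ] E3') (f : MvPolynomial (Fin 3) ℂ) :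
    ContDiff ℂ 1 fun v : ℂ × ℂ × ℂ => ev T (v.1, v.2.1, v.2.2) f := by
  simp only [ev, MvPolynomial.eval_eq']
  refine ContDiff.sum fun m _ => contDiff_const.mul (contDiff_prod fun i _ => ContDiff.pow ?_ _)
  have h1 : ContDiff ℂ 1 (fun v : V3 => T v) := T.contDiff
  exact (contDiff_euclidean.1 h1) i

theorem ev_bound (T : V3 ≃L[ℂ] E3') (f : MvPolynomial (Fin 3) ℂ) (d : ℕ) (hf : f.IsHomogeneous d)
    (h1 : ev T (0, 0, 1) f = 1) :
    ∃ C : ℝ, 0 < C ∧ ∀ x y z, ev T (x, y, z) f = 0 → ‖z‖ ≤ C * max ‖x‖ ‖y‖ := by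
  have hc : Continuous fun q : ℂ × ℂ => ev T (q.1, q.2, 1) f :=
    (ev_smooth T f).continuous.comp (f := fun q : ℂ × ℂ => (q.1, q.2, (1 : ℂ))) (by fun_prop)
  have hev : ∀ᶠ q : ℂ × ℂ in 𝓝 0, ev T (q.1, q.2, 1) f ≠ 0 :=
    hc.continuousAt.eventually_ne (by
      change ev T (0, 0, 1) f ≠ 0
      rw [h1]; exact one_ne_zero)
  obtain ⟨δ, hδ, hb⟩ := Metric.eventually_nhds_iff_ball.1 hev
  refine ⟨δ⁻¹, by positivity, fun x y z h => ?_⟩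
  by_contra! hlt
  have hz : z ≠ 0 := by
    rintro rfl
    simp only [norm_zero] at hlt
    have : 0 ≤ δ⁻¹ * max ‖x‖ ‖y‖ := by positivity
    linarith
  have hz' : 0 < ‖z‖ := norm_pos_iff.2 hz
  have h1 := ev_hom T f d hf z⁻¹ (x, y, z)
  simp only [Prod.smul_mk, smul_eq_mul] at h1
  rw [h, mul_zero, inv_mul_cancel₀ hz] at h1
  apply hb (z⁻¹ * x, z⁻¹ * y) _ h1
  rw [mem_ball_zero_iff, Prod.norm_def]
  simp only [norm_mul, norm_inv]
  have h3 : max ‖x‖ ‖y‖ < δ * ‖z‖ := by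
    rw [inv_mul_lt_iff₀ hδ] at hlt; exact hlt
  rw [max_lt_iff] at h3 ⊢
  constructor
  · rw [inv_mul_lt_iff₀ hz', mul_comm]; exact h3.1
  · rw [inv_mul_lt_iff₀ hz', mul_comm]; exact h3.2

theorem ev_fam (T : V3 ≃L[ℂ] E3') (f : MvPolynomial (Fin 3) ℂ) (d : ℕ) (hf : f.IsHomogeneous d)
    (h1 : ev T (0, 0, 1) f = 1) : Fam d (fun s z => ev T (1, s, z) f) := by
  refine ⟨(ev_smooth T f).comp (f := fun q : ℂ × ℂ => ((1 : ℂ), q.1, q.2)) (by fun_prop),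
    fun t => ev_roots T f d hf h1 1 t, fun R => ?_⟩
  obtain ⟨C, hC, hb⟩ := ev_bound T f d hf h1
  refine ⟨C * max ‖(1 : ℂ)‖ R, fun t z ht h => (hb _ _ _ h).trans ?_⟩
  gcongr

theorem ev_poly (T : V3 ≃L[ℂ] E3') (f : MvPolynomial (Fin 3) ℂ) (d : ℕ) (hf : f.IsHomogeneous d)
    (h1 : ev T (0, 0, 1) f = 1) : ∃ p : Polynomial (Polynomial ℂ), p.Monic ∧ p.natDegree = d ∧
      ∀ s z, p.evalEval s z = ev T (1, s, z) f := by
  have h := lin_coeff (R := Polynomial ℂ) f d hf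
    (fun i => Polynomial.C (T (1, 0, 0) i) + Polynomial.C (T (0, 1, 0) i) * Polynomial.X)
    (fun i => Polynomial.C (T (0, 0, 1) i))
  have h2 : MvPolynomial.aeval (fun i => Polynomial.C (T (0, 0, 1) i)) f = (1 : Polynomial ℂ) := by
    have h3 : (fun i => Polynomial.C (T (0, 0, 1) i)) =
      fun i => algebraMap ℂ (Polynomial ℂ) (T (0, 0, 1) i) := rfl
    rw [h3]
    have h4 := MvPolynomial.aeval_algebraMap_apply (B := Polynomial ℂ) (fun i => T (0, 0, 1) i) f
    have h5 : MvPolynomial.aeval (fun i => T (0, 0, 1) i) f = (1 : ℂ) := by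
      rw [aeval_ev, h1]
    rw [h5, map_one] at h4
    exact h4
  rw [h2] at h
  refine ⟨_, Polynomial.monic_of_natDegree_le_of_coeff_eq_one d h.1 h.2,
    Polynomial.natDegree_eq_of_le_of_coeff_ne_zero h.1 (by rw [h.2]; exact one_ne_zero), ?_⟩
  intro s z
  change Polynomial.evalEvalRingHom s z (MvPolynomial.aeval _ f) = _
  rw [MvPolynomial.aeval_def, MvPolynomial.hom_eval₂]
  unfold ev
  rw [← MvPolynomial.eval₂_id]
  congr 1
  · ext c
    have : algebraMap ℂ (Polynomial (Polynomial ℂ)) c = Polynomial.C (Polynomial.C c) := rfl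
    simp [this, Polynomial.evalEval_C]
  · funext i
    rw [split3 T 1 s z, split2 T s]
    simp [Polynomial.evalEval_C, Polynomial.evalEval_add, Polynomial.evalEval_mul,
      Polynomial.evalEval_X]
    ring

theorem poly_irr (T : V3 ≃L[ℂ] E3') (f : MvPolynomial (Fin 3) ℂ) (d : ℕ) (hf : f.IsHomogeneous d)
    (hirr : Irreducible f) (hd : 0 < d) (p : Polynomial (Polynomial ℂ)) (hp : p.Monic)
    (hpd : p.natDegree = d) (hpf : ∀ s z, p.evalEval s z = ev T (1, s, z) f) : Irreducible p := by
  rw [hp.irreducible_iff_natDegree']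
  refine ⟨fun h => by rw [h] at hpd; simp at hpd; omega, fun a b ha hb hab hmem => ?_⟩
  rw [Finset.mem_Ioc] at hmem
  have h1 : a.natDegree + b.natDegree = d := by rw [← ha.natDegree_mul hb, hab, hpd]
  exact no_factor T f d hf hirr hd p a b hp hpd hpf hab.symm (by omega) (by omega)

theorem pq_monic {d : ℕ} (u : Set (ℂ × ℂ)) (t : ℂ) (r : Fin d → ℂ) : (pq u t r).Monic := by
  classical
  unfold pq
  refine Polynomial.monic_prod_of_monic _ _ fun i _ => ?_
  split_ifs
  · exact Polynomial.monic_X_sub_C _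
  · exact Polynomial.monic_one

theorem pq_pos {d : ℕ} (u : Set (ℂ × ℂ)) (t : ℂ) (r : Fin d → ℂ) (i : Fin d) (hi : (t, r i) ∈ u) :
    0 < (pq u t r).natDegree := by
  classical
  unfold pq
  rw [natDegree_prod_ite]
  exact Finset.sum_pos' (fun _ _ => Nat.zero_le _) ⟨i, Finset.mem_univ i, by rw [if_pos hi]; exact one_pos⟩

theorem pq_mul {d : ℕ} (u v : Set (ℂ × ℂ)) (t : ℂ) (r : Fin d → ℂ)
    (h : ∀ i, ((t, r i) ∈ u ∧ (t, r i) ∉ v) ∨ ((t, r i) ∉ u ∧ (t, r i) ∈ v)) :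
    pq u t r * pq v t r = ∏ i, (Polynomial.X - Polynomial.C (r i)) := by
  classical
  unfold pq
  rw [← Finset.prod_mul_distrib]
  refine Finset.prod_congr rfl fun i _ => ?_
  rcases h i with h | h <;> simp [h.1, h.2]

theorem ev_conn (T : V3 ≃L[ℂ] E3') (f : MvPolynomial (Fin 3) ℂ) (d : ℕ) (hf : f.IsHomogeneous d)
    (hirr : Irreducible f) (hd : 0 < d) (h1 : ev T (0, 0, 1) f = 1) (B : Set ℂ) (hB : B.Finite)
    (hs : ∀ s ∉ B, ∀ r : Fin d → ℂ, RT (fun z => ev T (1, s, z) f) r → Function.Injective r) :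
    IsPreconnected {q : ℂ × ℂ | q.1 ∉ B ∧ ev T (1, q.1, q.2) f = 0} := by
  obtain ⟨p, hp, hpd, hpf⟩ := ev_poly T f d hf h1
  intro u v hu hv hcov hnu hnv
  by_contra hne
  have hcov' : ∀ t ∉ B, ∀ z, ev T (1, t, z) f = 0 → (t, z) ∈ u ∨ (t, z) ∈ v :=
    fun t ht z hz => hcov (show (t, z) ∈ _ from ⟨ht, hz⟩)
  have hdis : ∀ t ∉ B, ∀ z, ev T (1, t, z) f = 0 → (t, z) ∈ u → (t, z) ∉ v :=
    fun t ht z hz hzu hzv => hne ⟨(t, z), ⟨ht, hz⟩, hzu, hzv⟩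
  have hF := ev_fam T f d hf h1
  obtain ⟨C, hC, hb⟩ := ev_bound T f d hf h1
  have hgr : ∀ t z, ev T (1, t, z) f = 0 → ‖z‖ ≤ C * max 1 ‖t‖ := by
    intro t z h; simpa using hb 1 t z h
  obtain ⟨k, a, hak, ha⟩ := factor hF B hB hs C hC.le hgr u v hu hv hcov' hdis
  obtain ⟨k', b, hbk, hb'⟩ := factor hF B hB hs C hC.le hgr v u hv hu
    (fun t ht z hz => (hcov' t ht z hz).symm) (fun t ht z hz h1 h2 => hdis t ht z hz h2 h1)
  have hprod : ∀ t ∉ B, ∀ r : Fin d → ℂ, RT (fun z => ev T (1, t, z) f) r →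
      p.map (evalRingHom t) = pq u t r * pq v t r := by
    intro t ht r hr
    rw [pq_mul]
    · apply Polynomial.funext
      intro z
      rw [evalEval_map, hpf, Polynomial.eval_prod]
      simpa using hr z
    · intro i
      have hz : ev T (1, t, r i) f = 0 := (hr.zero_iff (r i)).2 ⟨i, rfl⟩
      rcases hcov' t ht _ hz with h | h
      · exact Or.inl ⟨h, hdis t ht _ hz h⟩
      · exact Or.inr ⟨fun h2 => hdis t ht _ hz h2 h, h⟩
  have hpab : p = a * b := by
    ext1 n
    apply Polynomial.eq_of_infinite_eval_eq
    refine hB.infinite_compl.mono fun t ht => ?_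
    obtain ⟨r, hr⟩ := hF.roots t
    have h := hprod t ht r hr
    rw [← (ha t ht r hr).1, ← (hb' t ht r hr).1, ← Polynomial.map_mul] at h
    have := congrArg (fun q => Polynomial.coeff q n) h
    simp only [Polynomial.coeff_map] at this
    exact this
  have hsum : ∀ t ∉ B, ∀ r : Fin d → ℂ, RT (fun z => ev T (1, t, z) f) r → k + k' = d := by
    intro t ht r hr
    rw [← (ha t ht r hr).2, ← (hb' t ht r hr).2, ← (pq_monic u t r).natDegree_mul (pq_monic v t r),
      ← hprod t ht r hr, hp.natDegree_map, hpd]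
  have hkpos : 0 < k := by
    obtain ⟨⟨t, z⟩, ⟨ht, hz⟩, hzu⟩ := hnu
    obtain ⟨r, hr⟩ := hF.roots t
    obtain ⟨i, hi⟩ := (hr.zero_iff z).1 hz
    rw [← (ha t ht r hr).2]
    exact pq_pos u t r i (hi ▸ hzu)
  have hkpos' : 0 < k' := by
    obtain ⟨⟨t, z⟩, ⟨ht, hz⟩, hzu⟩ := hnv
    obtain ⟨r, hr⟩ := hF.roots t
    obtain ⟨i, hi⟩ := (hr.zero_iff z).1 hz
    rw [← (hb' t ht r hr).2]
    exact pq_pos v t r i (hi ▸ hzu)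
  obtain ⟨t, ht⟩ := hB.exists_notMem
  obtain ⟨r, hr⟩ := hF.roots t
  have := hsum t ht r hr
  exact no_factor T f d hf hirr hd p a b hp hpd hpf hpab (by omega) (by omega)

theorem ev_simple (T : V3 ≃L[ℂ] E3') (f : MvPolynomial (Fin 3) ℂ) (d : ℕ) (hf : f.IsHomogeneous d)
    (hirr : Irreducible f) (hd : 0 < d) (h1 : ev T (0, 0, 1) f = 1) :
    ∃ B : Set ℂ, B.Finite ∧
    ∀ s ∉ B, ∀ r : Fin d → ℂ, RT (fun z => ev T (1, s, z) f) r → Function.Injective r := by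
  obtain ⟨p, hp, hpd, hpf⟩ := ev_poly T f d hf h1
  obtain ⟨c, hc0, hc⟩ := bezout p hp (poly_irr T f d hf hirr hd p hp hpd hpf)
  refine ⟨{s | c.IsRoot s}, Polynomial.finite_setOfPred_isRoot hc0, fun s hs r hr => ?_⟩
  refine hr.inj_of_deriv fun z hz => ?_
  have h2 := hc s z hs (by rw [hpf]; exact hz)
  have h3 : (fun z => ev T (1, s, z) f) = fun z => (p.map (evalRingHom s)).eval z := by
    funext z; rw [evalEval_map, hpf]
  rw [h3, Polynomial.deriv, Polynomial.derivative_map, evalEval_map]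
  exact h2

theorem exists_T (f : MvPolynomial (Fin 3) ℂ) (d : ℕ) (hf : f.IsHomogeneous d)
    (hirr : Irreducible f) (hd : 0 < d) : ∃ T : V3 ≃L[ℂ] E3', ev T (0, 0, 1) f = 1 := by
  have hex : ∃ γ : Fin 3 → ℂ, MvPolynomial.eval γ f ≠ 0 := by
    by_contra! h
    exact hirr.ne_zero (MvPolynomial.funext fun x => by rw [h x, map_zero])
  obtain ⟨γ, hγ⟩ := hex
  have hγ0 : (WithLp.toLp 2 γ : E3') ≠ 0 := by
    intro h0
    have h2 : γ = 0 := by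
      have := congrArg (WithLp.ofLp) h0
      simpa using this
    apply hγ
    rw [h2, MvPolynomial.eval_zero, MvPolynomial.constantCoeff_eq]
    by_contra hne
    have := hf hne
    simp at this
    omega
  have hfr : Module.finrank ℂ V3 = Module.finrank ℂ E3' := by simp
  let T0 : V3 ≃L[ℂ] E3' := ContinuousLinearEquiv.ofFinrankEq hfr
  have h0 : T0 (0, 0, 1) ≠ 0 := by simp
  obtain ⟨A, hA⟩ := SeparatingDual.exists_continuousLinearEquiv_apply_eq (R := ℂ) h0 hγ0
  obtain ⟨c, hc⟩ := IsAlgClosed.exists_pow_nat_eq (MvPolynomial.eval γ f)⁻¹ hd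
  have hc0 : c ≠ 0 := by
    rintro rfl
    rw [zero_pow hd.ne'] at hc
    exact hγ (inv_eq_zero.1 hc.symm)
  let T1 : V3 ≃L[ℂ] E3' := T0.trans A
  have hT1 : ev T1 (0, 0, 1) f = MvPolynomial.eval γ f := by
    unfold ev
    have : T1 (0, 0, 1) = WithLp.toLp 2 γ := hA
    rw [this]
  let S : V3 ≃L[ℂ] V3 := ContinuousLinearEquiv.smulLeft (Units.mk0 c hc0)
  refine ⟨S.trans T1, ?_⟩
  have : ev (S.trans T1) (0, 0, 1) f = ev T1 (c • (0, 0, 1)) f := rfl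
  rw [this, ev_hom T1 f d hf, hT1, hc, inv_mul_cancel₀ hγ]

theorem exists_CD (f : MvPolynomial (Fin 3) ℂ) (hirr : Irreducible f)
    (hf : f.IsHomogeneous f.totalDegree) :
    ∃ (D : CD f.totalDegree) (T : V3 ≃L[ℂ] E3'), ∀ v : V3, D.F v.1 v.2.1 v.2.2 = ev T v f := by
  have hd : 0 < f.totalDegree := by
    rw [Nat.pos_iff_ne_zero]
    intro h0
    rw [MvPolynomial.totalDegree_eq_zero_iff_eq_C] at h0
    apply hirr.not_isUnit
    rw [h0]
    apply IsUnit.map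
    rw [isUnit_iff_ne_zero]
    intro h2
    rw [h2, map_zero] at h0
    exact hirr.ne_zero h0
  generalize f.totalDegree = d at hd hf
  obtain ⟨T, h1⟩ := exists_T f d hf hirr hd
  obtain ⟨B, hB, hs⟩ := ev_simple T f d hf hirr hd h1
  obtain ⟨s0, hs0⟩ := hB.exists_notMem
  let S : V3 ≃L[ℂ] V3 := LinearEquiv.toContinuousLinearEquiv
    { toFun := fun v => (v.1, v.2.1 + s0 * v.1, v.2.2)
      invFun := fun v => (v.1, v.2.1 - s0 * v.1, v.2.2)
      map_add' := fun v w => by ext <;> simp; ring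
      map_smul' := fun c v => by ext <;> simp; ring
      left_inv := fun v => by simp
      right_inv := fun v => by simp }
  have hS : ∀ x y z, ev (S.trans T) (x, y, z) f = ev T (x, y + s0 * x, z) f := fun x y z => rfl
  have h1' : ev (S.trans T) (0, 0, 1) f = 1 := by rw [hS]; simpa using h1
  have hS1 : ∀ s z, ev (S.trans T) (1, s, z) f = ev T (1, s + s0, z) f := by
    intro s z; rw [hS, mul_one]
  have hB' : {s : ℂ | s + s0 ∈ B}.Finite := hB.preimage (fun a _ b _ h => add_right_cancel h)
  have hs' : ∀ s ∉ {s : ℂ | s + s0 ∈ B}, ∀ r : Fin d → ℂ,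
      RT (fun z => ev (S.trans T) (1, s, z) f) r → Function.Injective r := by
    intro s hsB r hr
    simp only [hS1] at hr
    exact hs _ hsB r hr
  refine ⟨{ F := fun x y z => ev (S.trans T) (x, y, z) f
            smooth := ev_smooth _ f
            hom := fun l x y z => ev_hom (S.trans T) f d hf l (x, y, z)
            roots := ev_roots _ f d hf h1'
            B := {s : ℂ | s + s0 ∈ B}
            Bfin := hB'
            B0 := by simpa using hs0
            simple := hs'
            conn := ev_conn _ f d hf hirr hd h1' _ hB' hs'
            dpos := hd }, S.trans T, fun v => rfl⟩

end BL
end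

namespace BL
open Topology Filter Set Complex

theorem shrink_homeo {d : ℕ} (D : CD d) (δ : ℝ) (hδ : 0 < δ) :
    Nonempty (D.W ≃ₜ (D.W ∩ Metric.ball 0 δ : Set V3)) := by
  have hn : ∀ v : V3, 0 < 1 + ‖v‖ := fun v => by positivity
  have hnc : ∀ v : V3, ((1 + ‖v‖ : ℝ) : ℂ) ≠ 0 := fun v => by
    exact_mod_cast (hn v).ne'
  have hδc : (δ : ℂ) ≠ 0 := by exact_mod_cast hδ.ne'
  have hnorm : ∀ v : V3, ‖((δ / (1 + ‖v‖) : ℝ) : ℂ) • v‖ = δ * ‖v‖ / (1 + ‖v‖) := by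
    intro v
    rw [norm_smul, Complex.norm_real, Real.norm_of_nonneg (by positivity)]
    ring
  have hlt : ∀ v : V3, δ * ‖v‖ / (1 + ‖v‖) < δ := by
    intro v
    rw [div_lt_iff₀ (hn v)]
    nlinarith
  have hnorm2 : ∀ v : V3, ‖v‖ < δ → ‖((1 / (δ - ‖v‖) : ℝ) : ℂ) • v‖ = ‖v‖ / (δ - ‖v‖) := by
    intro v hv
    have : 0 < δ - ‖v‖ := by linarith
    rw [norm_smul, Complex.norm_real, Real.norm_of_nonneg (by positivity)]
    ring
  refine ⟨⟨⟨fun v => ⟨((δ / (1 + ‖v.1‖) : ℝ) : ℂ) • v.1, ?_, ?_⟩,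
    fun w => ⟨((1 / (δ - ‖w.1‖) : ℝ) : ℂ) • w.1, ?_⟩, ?_, ?_⟩, ?_, ?_⟩⟩
  · refine D.mem_W_smul ?_ v.2
    have := hn v.1
    exact_mod_cast (div_pos hδ this).ne'
  · rw [mem_ball_zero_iff, hnorm]; exact hlt _
  · refine D.mem_W_smul ?_ w.2.1
    have : 0 < δ - ‖w.1‖ := by have := mem_ball_zero_iff.1 w.2.2; linarith
    exact_mod_cast (div_pos one_pos this).ne'
  · intro v
    apply Subtype.ext
    simp only
    rw [hnorm, smul_smul, ← Complex.ofReal_mul]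
    have h1 := hn v.1
    have : 1 / (δ - δ * ‖v.1‖ / (1 + ‖v.1‖)) * (δ / (1 + ‖v.1‖)) = 1 := by
      have h2 : δ - δ * ‖v.1‖ / (1 + ‖v.1‖) = δ / (1 + ‖v.1‖) := by
        field_simp; ring
      rw [h2]
      exact one_div_mul_cancel (div_pos hδ h1).ne'
    rw [this, Complex.ofReal_one, one_smul]
  · intro w
    apply Subtype.ext
    simp only
    have hw : ‖w.1‖ < δ := mem_ball_zero_iff.1 w.2.2
    have h0 : 0 < δ - ‖w.1‖ := by linarith
    rw [hnorm2 _ hw, smul_smul, ← Complex.ofReal_mul]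
    have : δ / (1 + ‖w.1‖ / (δ - ‖w.1‖)) * (1 / (δ - ‖w.1‖)) = 1 := by
      have h2 : 1 + ‖w.1‖ / (δ - ‖w.1‖) = δ / (δ - ‖w.1‖) := by
        field_simp; ring
      rw [h2]
      field_simp
    rw [this, Complex.ofReal_one, one_smul]
  · apply Continuous.subtype_mk
    refine Continuous.fun_smul ?_ continuous_subtype_val
    apply Complex.continuous_ofReal.comp
    exact Continuous.div (by fun_prop) (by fun_prop) (fun v => (hn v.1).ne')
  · apply Continuous.subtype_mk
    refine Continuous.fun_smul ?_ continuous_subtype_val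
    apply Complex.continuous_ofReal.comp
    refine Continuous.div (by fun_prop) (by fun_prop) (fun w => ?_)
    have := mem_ball_zero_iff.1 w.2.2
    linarith

theorem main_dvd (f g : MvPolynomial (Fin 3) ℂ) (hfirr : Irreducible f) (hgirr : Irreducible g)
    (hfhom : f.IsHomogeneous f.totalDegree) (hghom : g.IsHomogeneous g.totalDegree)
    (hφ : BiLipGermHomeo (pV f) (pV g)) : g.totalDegree ∣ f.totalDegree := by
  obtain ⟨D, T, hD⟩ := exists_CD f hfirr hfhom
  obtain ⟨E, S, hE⟩ := exists_CD g hgirr hghom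
  have hDW : ∀ v, v ∈ D.W ↔ v ≠ 0 ∧ T v ∈ pV f := by
    intro v; unfold CD.W; rw [mem_ofPred_eq, hD]; rfl
  have hEW : ∀ v, v ∈ E.W ↔ v ≠ 0 ∧ S v ∈ pV g := by
    intro v; unfold CD.W; rw [mem_ofPred_eq, hE]; rfl
  obtain ⟨U, U', φ, ψ, K, hU, hU', h0, h0', hφ0, hφU, hψU, hl, hr, hφL, hψL, him⟩ := hφ
  have hψ0 : ψ 0 = 0 := by
    have := hl h0
    rwa [hφ0] at this
  have hev : ∀ᶠ v : V3 in 𝓝 0, T v ∈ U :=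
    T.continuous.continuousAt.eventually_mem (hU.mem_nhds (by rw [map_zero]; exact h0))
  obtain ⟨δ, hδ, hb⟩ := Metric.eventually_nhds_iff_ball.1 hev
  obtain ⟨h1⟩ := shrink_homeo D δ hδ
  let A : Set V3 := D.W ∩ Metric.ball 0 δ
  let Φ : V3 → V3 := fun v => S.symm (φ (T v))
  let Ψ : V3 → V3 := fun w => T.symm (ψ (S w))
  have hΨΦ : ∀ v ∈ A, Ψ (Φ v) = v := by
    intro v hv
    simp only [Φ, Ψ, ContinuousLinearEquiv.apply_symm_apply]
    rw [hl (hb v hv.2), ContinuousLinearEquiv.symm_apply_apply]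
  have hSΦ : ∀ v ∈ A, S (Φ v) ∈ pV g ∩ U' := by
    intro v hv
    simp only [Φ, ContinuousLinearEquiv.apply_symm_apply]
    rw [← him]
    exact ⟨T v, ⟨((hDW v).1 hv.1).2, hb v hv.2⟩, rfl⟩
  have h2 : Nonempty (A ≃ₜ (Φ '' A : Set V3)) := by
    refine ⟨⟨⟨fun v => ⟨Φ v.1, v.1, v.2, rfl⟩, fun w => ⟨Ψ w.1, ?_⟩, ?_, ?_⟩, ?_, ?_⟩⟩
    · obtain ⟨v, hv, hw⟩ := w.2
      rw [← hw, hΨΦ v hv]; exact hv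
    · intro v
      exact Subtype.ext (hΨΦ v.1 v.2)
    · rintro ⟨w, v, hv, rfl⟩
      exact Subtype.ext (congrArg Φ (hΨΦ v hv))
    · apply Continuous.subtype_mk
      apply S.symm.continuous.comp
      exact hφL.continuousOn.comp_continuous (T.continuous.comp continuous_subtype_val)
        (fun v => hb v.1 v.2.2)
    · apply Continuous.subtype_mk
      apply T.symm.continuous.comp
      refine hψL.continuousOn.comp_continuous (S.continuous.comp continuous_subtype_val) ?_
      rintro ⟨w, v, hv, rfl⟩
      exact (hSΦ v hv).2
  obtain ⟨h2⟩ := h2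
  have hP : P (Φ '' A : Set V3) f.totalDegree := P_homeo (h1.trans h2) _ D.PW
  have hψc : ContinuousAt ψ 0 := hψL.continuousOn.continuousAt (hU'.mem_nhds h0')
  have hΨc : ContinuousAt Ψ 0 := by
    refine T.symm.continuous.continuousAt.comp ?_
    refine ContinuousAt.comp (g := ψ) (f := S) ?_ S.continuous.continuousAt
    rw [map_zero]; exact hψc
  have hΨ0 : Ψ 0 = 0 := by simp only [Ψ, map_zero, hψ0]
  have hev2 : ∀ᶠ w : V3 in 𝓝 0, S w ∈ U' ∧ Ψ w ∈ Metric.ball (0 : V3) δ :=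
    (S.continuous.continuousAt.eventually_mem (hU'.mem_nhds (by rw [map_zero]; exact h0'))).and
      (hΨc.eventually_mem (by rw [hΨ0]; exact Metric.ball_mem_nhds _ hδ))
  obtain ⟨δ', hδ', hb'⟩ := Metric.eventually_nhds_iff_ball.1 hev2
  refine E.dvd_of_P (Φ '' A) ?_ δ' hδ' ?_ _ hP
  · rintro _ ⟨v, hv, rfl⟩
    rw [hEW]
    refine ⟨fun h => ?_, (hSΦ v hv).1⟩
    have h3 := hΨΦ v hv
    rw [h, hΨ0] at h3
    exact ((hDW v).1 hv.1).1 h3.symm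
  · intro w hw hwδ
    obtain ⟨hw1, hw2⟩ := hb' w (mem_ball_zero_iff.2 hwδ)
    obtain ⟨hw0, hwg⟩ := (hEW w).1 hw
    have hΦΨ : Φ (Ψ w) = w := by
      simp only [Φ, Ψ, ContinuousLinearEquiv.apply_symm_apply]
      rw [hr hw1, ContinuousLinearEquiv.symm_apply_apply]
    refine ⟨Ψ w, ⟨?_, hw2⟩, hΦΨ⟩
    rw [hDW]
    constructor
    · intro h
      rw [h] at hΦΨ
      apply hw0
      rw [← hΦΨ]
      simp only [Φ, map_zero, hφ0]
    · have : S w ∈ φ '' (pV f ∩ U) := by rw [him]; exact ⟨hwg, hw1⟩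
      obtain ⟨x, hx, hxw⟩ := this
      simp only [Ψ, ContinuousLinearEquiv.apply_symm_apply]
      rw [← hxw, hl hx.2]
      exact hx.1

theorem germ_symm {X Y : Set E3} (h : BiLipGermHomeo X Y) : BiLipGermHomeo Y X := by
  obtain ⟨U, U', φ, ψ, K, hU, hU', h0, h0', hφ0, hφU, hψU, hl, hr, hφL, hψL, him⟩ := h
  refine ⟨U', U, ψ, φ, K, hU', hU, h0', h0, ?_, hψU, hφU, hr, hl, hψL, hφL, ?_⟩
  · have := hl h0
    rwa [hφ0] at this
  · rw [← him]
    ext x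
    constructor
    · rintro ⟨_, ⟨y, hy, rfl⟩, rfl⟩
      rw [hl hy.2]; exact hy
    · intro hx
      exact ⟨φ x, ⟨x, hx, rfl⟩, hl hx.2⟩

end BL

/-- Theorem: if `f, g ∈ ℂ[z₁, z₂, z₃]` are irreducible homogeneous polynomials and
there is a bi-Lipschitz homeomorphism `(ℂ³, V(f), 0) → (ℂ³, V(g), 0)`, then
`deg f = deg g` (no assumption on the singular loci, which may be one-dimensional). -/
theorem bilip_invariance_degree_irreducible_homogeneous_C3
    (f g : MvPolynomial (Fin 3) ℂ)
    (hfirr : Irreducible f) (hgirr : Irreducible g)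
    (hfhom : f.IsHomogeneous f.totalDegree) (hghom : g.IsHomogeneous g.totalDegree)
    (hφ : BiLipGermHomeo (pV f) (pV g)) :
    f.totalDegree = g.totalDegree :=
  Nat.dvd_antisymm (BL.main_dvd g f hgirr hfirr hghom hfhom (BL.germ_symm hφ))
    (BL.main_dvd f g hfirr hgirr hfhom hghom hφ)
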